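/- arXiv:1402.1199 — 5 statements merged into one kernel-verified Lean document; each statement's English description precedes it below -/
import Mathlib

section
/- Let m ≥ 2 be an integer, k = ⌊m/2⌋, and let d_0, d_1 be positive integers with n = d_0 + 2d_1. Then for every integer s, the number of λ ∈ Q_m(d_0, d_1, 0, …, 0) with |λ| = s equals the number of pairs (x, y) of integers with 0 ≤ x ≤ m·d_0 + (m−2)·d_1, 0 ≤ y ≤ (m−2)·d_1, and x + y = s − 2d_1. (Q_m(d_0,d_1,0,…,0) is isomorphic as a ranked set to the product of two chains [m d_0 + (m−2)d_1] × [(m−2)d_1], shifted up by 2d_1.) -/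
/-- `l : ℕ → ℕ` encodes a partition fitting in the `m × n` box, extended by the
conventions `λ_0 = n` and `λ_i = 0` for `i > m`. -/
def InBox (m n : ℕ) (l : ℕ → ℕ) : Prop :=
  l 0 = n ∧ (∀ i, m < i → l i = 0) ∧ ∀ i, l (i + 1) ≤ l i

/-- `fmr m r l = min { ∑_{j=0}^{m-2r} a_{2 t_j + j} : 0 ≤ t_0 ≤ … ≤ t_{m-2r} ≤ r }`,
where `a_i = λ_i − λ_{i+1}`. -/
noncomputable def fmr (m r : ℕ) (l : ℕ → ℕ) : ℕ :=
  sInf { S | ∃ t : Fin (m - 2 * r + 1) → ℕ,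
    (∀ i j, i ≤ j → t i ≤ t j) ∧ (∀ i, t i ≤ r) ∧
    S = ∑ j, (l (2 * t j + (j : ℕ)) - l (2 * t j + (j : ℕ) + 1)) }

/-- Membership in O'Hara's set `Q_m(d_0, …, d_k)`, where `k = ⌊m/2⌋`. -/
def InQ (m n : ℕ) (d : Fin (m / 2 + 1) → ℕ) (l : ℕ → ℕ) : Prop :=
  InBox m n l ∧ ∀ r, 1 ≤ r → r ≤ m / 2 →
    fmr m r l = ∑ j : Fin (m / 2 + 1), ((j : ℕ) + 1 - r) * d j

/-- The size `|λ| = λ_1 + … + λ_m` of the partition encoded by `l`. -/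
def psize (m : ℕ) (l : ℕ → ℕ) : ℕ := ∑ i ∈ Finset.Icc 1 m, l i

namespace OHara

/-- The chain state `y`, as a (shifted) sequence of partial sums. -/
def nu (d y i : ℕ) : ℕ := min d (y + 3 * d - i * d)

lemma sum_min (d Z N : ℕ) : ∑ i ∈ Finset.range N, min d (Z - i * d) = min Z (N * d) := by
  induction N with
  | zero => simp
  | succ N ih =>
    rw [Finset.sum_range_succ, ih, Nat.succ_mul]
    omega

lemma sum_Icc_range (m : ℕ) (g : ℕ → ℕ) :
    ∑ i ∈ Finset.range (m + 1), g i = g 0 + ∑ i ∈ Finset.Icc 1 m, g i := by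
  induction m with
  | zero => simp
  | succ m ih =>
    rw [Finset.sum_range_succ, ih, Finset.sum_Icc_succ_top (by omega)]
    omega

lemma nu_anti (d y : ℕ) {i j : ℕ} (h : i ≤ j) : nu d y j ≤ nu d y i := by
  have := Nat.mul_le_mul_right d h
  unfold nu
  omega

lemma nu_le (d y i : ℕ) : nu d y i ≤ d := by unfold nu; omega

lemma nu_two (d y : ℕ) : nu d y 2 = d := by unfold nu; omega

lemma nu_one (d y : ℕ) : nu d y 1 = d := by unfold nu; omega

lemma nu_zero (d y : ℕ) : nu d y 0 = d := by unfold nu; omega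

lemma bound_aux {m d y : ℕ} (hm : 2 ≤ m) (hy : y ≤ (m - 2) * d) : y + 3 * d ≤ (m + 1) * d := by
  obtain ⟨c, rfl⟩ := Nat.exists_eq_add_of_le hm
  have : 2 + c - 2 = c := by omega
  rw [this] at hy
  nlinarith

lemma nu_big {m d y : ℕ} (hm : 2 ≤ m) (hy : y ≤ (m - 2) * d) {i : ℕ} (hi : m < i) :
    nu d y i = 0 := by
  have h1 := bound_aux hm hy
  have h2 : (m + 1) * d ≤ i * d := Nat.mul_le_mul_right d hi
  unfold nu
  omega

lemma nu_sum {m d y : ℕ} (hm : 2 ≤ m) (hy : y ≤ (m - 2) * d) :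
    ∑ i ∈ Finset.Icc 1 m, nu d y i = 2 * d + y := by
  have h1 := bound_aux hm hy
  have h2 := sum_Icc_range m (nu d y)
  have h3 := sum_min d (y + 3 * d) (m + 1)
  rw [nu_zero] at h2
  unfold nu at *
  omega

lemma nu_sum2 {m d y : ℕ} (hm : 2 ≤ m) (hy : y ≤ (m - 2) * d) :
    ∑ i ∈ Finset.Icc 1 m, nu d y (i + 2) = y := by
  have h1 := bound_aux hm hy
  have h2 := sum_Icc_range m (fun i => nu d y (i + 2))
  have h3 := sum_min d (y + d) (m + 1)
  have h4 : ∀ i, nu d y (i + 2) = min d (y + d - i * d) := by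
    intro i
    unfold nu
    rw [Nat.add_mul]
    omega
  simp only [h4] at h2 ⊢
  omega

/-- There is at most one strictly intermediate value. -/
lemma nu_q {m d y : ℕ} (hm : 3 ≤ m) (hy : y ≤ (m - 2) * d) :
    ∃ q, 2 ≤ q ∧ q + 1 ≤ m ∧ (∀ i, i ≤ q → nu d y i = d) ∧ (∀ i, q + 2 ≤ i → nu d y i = 0) := by
  rcases Nat.eq_zero_or_pos d with rfl | hd
  · exact ⟨2, by omega, by omega, fun i _ => by simp [nu], fun i _ => by simp [nu]⟩
  by_cases hlt : y < (m - 2) * d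
  · refine ⟨y / d + 2, Nat.le_add_left _ _, ?_, ?_, ?_⟩
    · have := (Nat.div_lt_iff_lt_mul hd).2 hlt
      omega
    · intro i hi
      have h1 := Nat.mul_le_mul_right d hi
      have h2 := Nat.div_mul_le_self y d
      rw [Nat.add_mul] at h1
      unfold nu
      omega
    · intro i hi
      have h1 := Nat.mul_le_mul_right d hi
      have h2 := Nat.lt_div_mul_add (a := y) hd
      rw [Nat.add_mul, Nat.add_mul] at h1
      unfold nu
      omega
  · have hy' : y = (m - 2) * d := by omega
    refine ⟨m - 1, by omega, by omega, ?_, ?_⟩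
    · intro i hi
      have h1 := Nat.mul_le_mul_right d hi
      obtain ⟨c, rfl⟩ := Nat.exists_eq_add_of_le hm
      have e1 : 3 + c - 1 = c + 2 := by omega
      have e2 : 3 + c - 2 = c + 1 := by omega
      rw [e1, Nat.add_mul] at h1
      rw [e2, Nat.add_mul] at hy'
      unfold nu
      omega
    · intro i hi
      exact nu_big (by omega) hy (by omega)

/-- Conversely a sequence with at most one intermediate value is a chain state. -/
lemma eq_nu {m d : ℕ} (hd : 0 < d) (v : ℕ → ℕ) (q : ℕ) (hq : 2 ≤ q) (hqm : q + 1 ≤ m)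
    (h1 : ∀ i, i ≤ q → v i = d) (h2 : ∀ i, q + 2 ≤ i → v i = 0) (h3 : v (q + 1) ≤ d) :
    ∃ y, y ≤ (m - 2) * d ∧ ∀ i, v i = nu d y i := by
  obtain ⟨c, rfl⟩ := Nat.exists_eq_add_of_le hq
  refine ⟨c * d + v (2 + c + 1), ?_, ?_⟩
  · have h : c + 1 ≤ m - 2 := by omega
    have := Nat.mul_le_mul_right d h
    rw [Nat.add_mul] at this
    omega
  · intro i
    rcases lt_trichotomy i (2 + c + 1) with h | h | h
    · rw [h1 i (by omega)]
      have h : i ≤ c + 2 := by omega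
      have := Nat.mul_le_mul_right d h
      rw [Nat.add_mul] at this
      unfold nu
      omega
    · subst h
      have : (2 + c + 1) * d = c * d + 3 * d := by ring
      unfold nu
      rw [this]
      omega
    · rw [h2 i (by omega)]
      have h : c + 4 ≤ i := by omega
      have := Nat.mul_le_mul_right d h
      rw [Nat.add_mul] at this
      unfold nu
      omega

/-- `l` is obtained from `v` by inserting an adjacent pair of sum `M` ending at position `p`. -/
def R (m M : ℕ) (v l : ℕ → ℕ) (p : ℕ) : Prop :=
  1 ≤ p ∧ p ≤ m ∧ (∀ i, i < p → l i = M + v (i + 2)) ∧ (∀ i, p < i → l i = v i) ∧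
    v p ≤ l p ∧ l p ≤ M + v (p + 2)

/-- Uniqueness of the chain state. -/
lemma R_uniq_v {m M d y y' p q : ℕ} {l : ℕ → ℕ} (hM : d < M)
    (h : R m M (nu d y) l p) (h' : R m M (nu d y') l q) (hpq : p ≤ q) (i : ℕ) :
    nu d y i = nu d y' i := by
  obtain ⟨a1, a2, a3, a4, a5, a6⟩ := h
  obtain ⟨b1, b2, b3, b4, b5, b6⟩ := h'
  have hq : q ≤ p + 1 := by
    by_contra hc
    have e1 := a4 (p + 1) (by omega)
    have e2 := b3 (p + 1) (by omega)
    have := nu_le d y (p + 1)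
    omega
  rcases Nat.lt_or_ge i 2 with hi | hi
  · interval_cases i
    · rw [nu_zero, nu_zero]
    · rw [nu_one, nu_one]
  by_cases hip : i ≤ p + 1
  · have e1 := a3 (i - 2) (by omega)
    have e2 := b3 (i - 2) (by omega)
    have : i - 2 + 2 = i := by omega
    rw [this] at e1 e2
    omega
  · have e1 := a4 i (by omega)
    have e2 := b4 i (by omega)
    omega

/-- Pointwise comparison in a chain. -/
lemma R_le {m M d y p q : ℕ} {l l' : ℕ → ℕ} (hM : d < M)
    (h : R m M (nu d y) l p) (h' : R m M (nu d y) l' q) (hpq : p < q ∨ p = q ∧ l p ≤ l' q)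
    (i : ℕ) : l i ≤ l' i := by
  obtain ⟨a1, a2, a3, a4, a5, a6⟩ := h
  obtain ⟨b1, b2, b3, b4, b5, b6⟩ := h'
  rcases lt_trichotomy i p with hi | rfl | hi
  · rw [a3 i hi, b3 i (by omega)]
  · rcases hpq with hpq | ⟨rfl, h⟩
    · rw [b3 i (by omega)]; exact a6
    · exact h
  · rw [a4 i hi]
    rcases lt_trichotomy i q with hj | rfl | hj
    · rw [b3 i hj]
      have := nu_le d y i
      omega
    · exact b5
    · rw [b4 i hj]

lemma eq_of_le_psize {m : ℕ} {l l' : ℕ → ℕ} (h0 : l 0 = l' 0) (hbig : ∀ i, m < i → l i = l' i)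
    (hle : ∀ i, l i ≤ l' i) (hs : psize m l = psize m l') : l = l' := by
  funext i
  by_cases hi : i ∈ Finset.Icc 1 m
  · exact (Finset.sum_eq_sum_iff_of_le (fun i _ => hle i)).1 hs i hi
  · rcases Nat.eq_zero_or_pos i with rfl | hp
    · exact h0
    · refine hbig i ?_
      rw [Finset.mem_Icc] at hi
      omega

lemma R_uniq_l {m M d y p q : ℕ} {l l' : ℕ → ℕ} (hM : d < M)
    (h : R m M (nu d y) l p) (h' : R m M (nu d y) l' q) (hs : psize m l = psize m l') :
    l = l' := by
  have h0 : l 0 = l' 0 := by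
    rw [h.2.2.1 0 h.1, h'.2.2.1 0 h'.1]
  have hb : ∀ i, m < i → l i = l' i := by
    intro i hi
    rw [h.2.2.2.1 i (lt_of_le_of_lt h.2.1 hi), h'.2.2.2.1 i (lt_of_le_of_lt h'.2.1 hi)]
  have key : (p < q ∨ p = q ∧ l p ≤ l' q) ∨ (q < p ∨ q = p ∧ l' q ≤ l p) := by
    rcases lt_trichotomy p q with h | h | h
    · omega
    · rcases Nat.le_total (l p) (l' q) with h2 | h2
      · exact Or.inl (Or.inr ⟨h, h2⟩)
      · exact Or.inr (Or.inr ⟨h.symm, h2⟩)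
    · omega
  rcases key with k | k
  · exact eq_of_le_psize h0 hb (R_le hM h h' k) hs
  · exact (eq_of_le_psize h0.symm (fun i hi => (hb i hi).symm) (R_le hM h' h k) hs.symm).symm

lemma R_bounds {m M d y p : ℕ} {l : ℕ → ℕ} (hM : d < M) (h : R m M (nu d y) l p) (i : ℕ) :
    nu d y i ≤ l i ∧ l i ≤ M + nu d y (i + 2) := by
  obtain ⟨a1, a2, a3, a4, a5, a6⟩ := h
  have := nu_le d y i
  rcases lt_trichotomy i p with hi | rfl | hi
  · rw [a3 i hi]; omega
  · exact ⟨a5, a6⟩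
  · rw [a4 i hi]; omega

lemma psize_bounds {m M d y p : ℕ} {l : ℕ → ℕ} (hm : 2 ≤ m) (hy : y ≤ (m - 2) * d) (hM : d < M)
    (h : R m M (nu d y) l p) : 2 * d + y ≤ psize m l ∧ psize m l ≤ m * M + y := by
  constructor
  · rw [← nu_sum hm hy]
    exact Finset.sum_le_sum fun i _ => (R_bounds hM h i).1
  · have : ∑ i ∈ Finset.Icc 1 m, (M + nu d y (i + 2)) = m * M + y := by
      rw [Finset.sum_add_distrib, nu_sum2 hm hy]
      simp
    rw [← this]
    exact Finset.sum_le_sum fun i _ => (R_bounds hM h i).2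

lemma psize_update {m : ℕ} (l : ℕ → ℕ) {p : ℕ} (h1 : 1 ≤ p) (h2 : p ≤ m) :
    psize m (Function.update l p (l p + 1)) = psize m l + 1 := by
  have hp : p ∈ Finset.Icc 1 m := Finset.mem_Icc.2 ⟨h1, h2⟩
  unfold psize
  rw [Finset.sum_update_of_mem hp, ← Finset.add_sum_erase _ _ hp, Finset.sdiff_singleton_eq_erase]
  omega

lemma R_update {m M p : ℕ} {v l : ℕ → ℕ} (h : R m M v l p) (hlt : l p < M + v (p + 2)) :
    R m M v (Function.update l p (l p + 1)) p := by
  obtain ⟨a1, a2, a3, a4, a5, a6⟩ := h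
  refine ⟨a1, a2, ?_, ?_, ?_, ?_⟩
  · intro i hi
    rw [Function.update_of_ne (by omega)]; exact a3 i hi
  · intro i hi
    rw [Function.update_of_ne (by omega)]; exact a4 i hi
  · rw [Function.update_self]; omega
  · rw [Function.update_self]; omega

lemma R_exists {m M d y : ℕ} (hm : 2 ≤ m) (hy : y ≤ (m - 2) * d) (hM : d < M) (x : ℕ)
    (hx : 2 * d + x ≤ m * M) : ∃ l p, R m M (nu d y) l p ∧ psize m l = 2 * d + y + x := by
  induction x with
  | zero =>
    refine ⟨fun i => if i = 0 then M + d else nu d y i, 1, ⟨le_rfl, by omega, ?_, ?_, ?_, ?_⟩, ?_⟩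
    · intro i hi
      have : i = 0 := by omega
      subst this
      simp [nu_two]
    · intro i hi
      simp [show i ≠ 0 by omega]
    · simp
    · simp only [nu_one, one_ne_zero, if_false]; omega
    · rw [add_zero, ← nu_sum hm hy]
      refine Finset.sum_congr rfl fun i hi => ?_
      have := (Finset.mem_Icc.1 hi).1
      simp [show i ≠ 0 by omega]
  | succ x ih =>
    obtain ⟨l, p, h, hs⟩ := ih (by omega)
    by_cases hlt : l p < M + nu d y (p + 2)
    · exact ⟨_, p, R_update h hlt, by rw [psize_update l h.1 h.2.1, hs]; omega⟩
    have h' := h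
    obtain ⟨a1, a2, a3, a4, a5, a6⟩ := h'
    have hpm : p < m := by
      by_contra hc
      have hpm : p = m := by omega
      subst hpm
      have : psize p l = p * M + y := by
        have : ∑ i ∈ Finset.Icc 1 p, (M + nu d y (i + 2)) = p * M + y := by
          rw [Finset.sum_add_distrib, nu_sum2 hm hy]
          simp
        rw [← this]
        refine Finset.sum_congr rfl fun i hi => ?_
        have := (Finset.mem_Icc.1 hi).2
        rcases Nat.lt_or_eq_of_le this with h | rfl
        · exact a3 i h
        · omega
      omega
    have e := a4 (p + 1) (by omega)
    have hle := nu_le d y (p + 1)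
    have h2 : R m M (nu d y) l (p + 1) := by
      refine ⟨by omega, by omega, ?_, ?_, by omega, by omega⟩
      · intro i hi
        rcases Nat.lt_or_ge i p with h | h
        · exact a3 i h
        · have : i = p := by omega
          subst this
          omega
      · intro i hi
        exact a4 i (by omega)
    exact ⟨_, p + 1, R_update h2 (by omega), by rw [psize_update l h2.1 h2.2.1, hs]; omega⟩

/-! ### The functions `fmr` -/

lemma anti_of {l : ℕ → ℕ} (h : ∀ i, l (i + 1) ≤ l i) {i j : ℕ} (hij : i ≤ j) : l j ≤ l i :=
  antitone_nat_of_succ_le h hij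

/-- The set whose infimum is `fmr`. -/
def fset (m r : ℕ) (l : ℕ → ℕ) : Set ℕ :=
  { S | ∃ t : Fin (m - 2 * r + 1) → ℕ,
    (∀ i j, i ≤ j → t i ≤ t j) ∧ (∀ i, t i ≤ r) ∧
    S = ∑ j, (l (2 * t j + (j : ℕ)) - l (2 * t j + (j : ℕ) + 1)) }

lemma fset_nonempty (m r : ℕ) (l : ℕ → ℕ) : (fset m r l).Nonempty :=
  ⟨_, fun _ => 0, fun _ _ _ => le_rfl, fun _ => Nat.zero_le _, rfl⟩

lemma fmr_mem (m r : ℕ) (l : ℕ → ℕ) : fmr m r l ∈ fset m r l :=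
  Nat.sInf_mem (fset_nonempty m r l)

lemma fmr_le {m r : ℕ} {l : ℕ → ℕ} {S : ℕ} (h : S ∈ fset m r l) : fmr m r l ≤ S :=
  Nat.sInf_le h

lemma step_sum {l : ℕ → ℕ} (h : ∀ i, l (i + 1) ≤ l i) (e c : ℕ) :
    ∑ j ∈ Finset.range (e + c), (if j < e then l j - l (j + 1) else l (j + 2) - l (j + 3))
      + l e + l (e + c + 2) = l 0 + l (e + 2) := by
  induction c with
  | zero =>
    have : ∑ j ∈ Finset.range e, (if j < e then l j - l (j + 1) else l (j + 2) - l (j + 3))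
        = ∑ j ∈ Finset.range e, (l j - l (j + 1)) :=
      Finset.sum_congr rfl fun j hj => by rw [if_pos (Finset.mem_range.1 hj)]
    rw [add_zero, this]
    have : ∀ e, ∑ j ∈ Finset.range e, (l j - l (j + 1)) + l e = l 0 := by
      intro e
      induction e with
      | zero => simp
      | succ e ih =>
        rw [Finset.sum_range_succ]
        have := h e
        omega
    have := this e
    omega
  | succ c ih =>
    rw [← add_assoc, Finset.sum_range_succ, if_neg (by omega)]
    have h1 := h (e + c + 2)
    have : e + c + 1 + 2 = e + c + 3 := by omega
    rw [this]
    have : e + c + 2 + 1 = e + c + 3 := by omega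
    rw [this] at h1
    omega

/-- Threshold of a monotone predicate on `Fin N`. -/
lemma threshold {N : ℕ} (t : Fin N → ℕ) (ht : ∀ i j, i ≤ j → t i ≤ t j) (c : ℕ) :
    ∃ e, e ≤ N ∧ ∀ j : Fin N, ((j : ℕ) < e ↔ t j ≤ c) := by
  classical
  have hex : ∃ e, ∀ j : Fin N, e ≤ (j : ℕ) → c < t j := ⟨N, fun j hj => absurd j.2 (by omega)⟩
  refine ⟨Nat.find hex, Nat.find_min' hex fun j hj => absurd j.2 (by omega), fun j => ?_⟩
  constructor
  · intro hj
    have := Nat.find_min hex hj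
    push Not at this
    obtain ⟨i, hi, hi2⟩ := this
    exact (ht j i hi).trans hi2
  · intro hj
    by_contra hc
    have := Nat.find_spec hex j (by omega)
    omega

lemma fset_one {m n : ℕ} {l : ℕ → ℕ} (hm : 2 ≤ m) (hb : InBox m n l) (S : ℕ) :
    S ∈ fset m 1 l ↔ ∃ p, 1 ≤ p ∧ p ≤ m ∧ S + l (p - 1) = n + l (p + 1) := by
  obtain ⟨b0, b1, b2⟩ := hb
  have hN : m - 2 * 1 + 1 = m - 1 := by omega
  have main : ∀ e, e ≤ m - 1 → ∑ j : Fin (m - 2 * 1 + 1),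
      (if (j : ℕ) < e then l j - l (j + 1) else l (j + 2) - l (j + 3)) + l e = n + l (e + 2) := by
    intro e he
    rw [Fin.sum_univ_eq_sum_range
      (fun j => if j < e then l j - l (j + 1) else l (j + 2) - l (j + 3)), hN]
    obtain ⟨c, hc⟩ := Nat.exists_eq_add_of_le he
    have := step_sum b2 e c
    rw [hc]
    have h0 := b1 (e + c + 2) (by omega)
    omega
  constructor
  · rintro ⟨t, t1, t2, rfl⟩
    obtain ⟨e, he, hte⟩ := threshold t t1 0
    refine ⟨e + 1, by omega, by omega, ?_⟩
    have := main e (by omega)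
    rw [← this]
    simp only [Nat.add_sub_cancel]
    congr 1
    refine Finset.sum_congr rfl fun j _ => ?_
    split_ifs with h
    · have : t j = 0 := by have := (hte j).1 h; omega
      rw [this]; simp
    · have : t j = 1 := by
        have h1 := t2 j
        have h2 := mt (hte j).2 h
        omega
      rw [this]
      congr 2 <;> omega
  · rintro ⟨p, p1, p2, hS⟩
    refine ⟨fun j => if (j : ℕ) < p - 1 then 0 else 1, ?_, ?_, ?_⟩
    · intro i j hij
      have : (i : ℕ) ≤ j := hij
      dsimp only
      split_ifs <;> omega
    · intro i
      dsimp only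
      split_ifs <;> omega
    · have h1 := main (p - 1) (by omega)
      have e : p - 1 + 2 = p + 1 := by omega
      rw [e] at h1
      have : S = ∑ j : Fin (m - 2 * 1 + 1),
        (if (j : ℕ) < p - 1 then l j - l (j + 1) else l (j + 2) - l (j + 3)) := by omega
      rw [this]
      refine Finset.sum_congr rfl fun j _ => ?_
      dsimp only
      split_ifs with h
      · simp
      · congr 2 <;> omega

lemma fmr_one {m n d : ℕ} {l : ℕ → ℕ} (hm : 2 ≤ m) (hb : InBox m n l) :
    fmr m 1 l = d ↔ (∃ p, 1 ≤ p ∧ p ≤ m ∧ d + l (p - 1) = n + l (p + 1)) ∧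
      ∀ p, 1 ≤ p → p ≤ m → d + l (p - 1) ≤ n + l (p + 1) := by
  constructor
  · rintro rfl
    refine ⟨(fset_one hm hb _).1 (fmr_mem m 1 l), fun p p1 p2 => ?_⟩
    have h1 := anti_of hb.2.2 (show 0 ≤ p - 1 by omega)
    rw [hb.1] at h1
    have h2 : n + l (p + 1) - l (p - 1) ∈ fset m 1 l :=
      (fset_one hm hb _).2 ⟨p, p1, p2, by omega⟩
    have := fmr_le h2
    omega
  · rintro ⟨h1, h2⟩
    apply le_antisymm
    · exact fmr_le ((fset_one hm hb _).2 h1)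
    · obtain ⟨p, p1, p2, hp⟩ := (fset_one hm hb _).1 (fmr_mem m 1 l)
      have := h2 p p1 p2
      omega

lemma fmr_succ_le {m r : ℕ} {l : ℕ → ℕ} (hr : 2 * (r + 1) ≤ m) : fmr m (r + 1) l ≤ fmr m r l := by
  obtain ⟨t, t1, t2, hS⟩ := fmr_mem m r l
  rw [hS]
  have hN : m - 2 * r + 1 = (m - 2 * (r + 1) + 1) + 2 := by omega
  have hlt : ∀ j : Fin (m - 2 * (r + 1) + 1), (j : ℕ) + 2 < m - 2 * r + 1 := fun j => by
    have := j.2; omega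
  let emb : Fin (m - 2 * (r + 1) + 1) → Fin (m - 2 * r + 1) := fun j => ⟨(j : ℕ) + 2, hlt j⟩
  have hinj : Function.Injective emb := by
    intro i j hij
    have := congrArg Fin.val hij
    simp only [emb] at this
    exact Fin.ext (by omega)
  refine (fmr_le (S := ∑ j, (l (2 * t (emb j) + (emb j : ℕ)) - l (2 * t (emb j) + (emb j : ℕ) + 1)))
    ⟨fun j => t (emb j) + 1, ?_, ?_, ?_⟩).trans ?_
  · intro i j hij
    have : (i : ℕ) ≤ j := hij
    have : t (emb i) ≤ t (emb j) := t1 _ _ (by simp only [emb, Fin.mk_le_mk]; omega)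
    dsimp only
    omega
  · intro i
    have := t2 (emb i)
    dsimp only
    omega
  · refine Finset.sum_congr rfl fun j _ => ?_
    simp only [emb]
    congr 2 <;> omega
  · rw [← Finset.sum_image (s := Finset.univ) (g := emb)
      (f := fun j => l (2 * t j + (j : ℕ)) - l (2 * t j + (j : ℕ) + 1)) (fun _ _ _ _ h => hinj h)]
    exact Finset.sum_le_sum_of_subset (Finset.subset_univ _)

lemma const_of_steps {l : ℕ → ℕ} (a c : ℕ) (h : ∀ i, a ≤ i → i < a + c → l (i + 1) = l i) :
    l (a + c) = l a := by
  induction c with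
  | zero => rfl
  | succ c ih =>
    rw [← add_assoc, h (a + c) (by omega) (by omega)]
    exact ih fun i h1 h2 => h i h1 (by omega)

lemma fmr_two {m n : ℕ} {l : ℕ → ℕ} (hm : 4 ≤ m) (hb : InBox m n l) :
    fmr m 2 l = 0 ↔ ∃ e1 e2, e1 ≤ e2 ∧ e2 + 3 ≤ m ∧ l e1 = n ∧ l (e1 + 2) = l (e2 + 2) ∧
      l (e2 + 4) = 0 := by
  obtain ⟨b0, b1, b2⟩ := hb
  constructor
  · intro h
    obtain ⟨t, t1, t2, hS⟩ := fmr_mem m 2 l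
    rw [h] at hS
    have hz := (Finset.sum_eq_zero_iff_of_nonneg (fun _ _ => Nat.zero_le _)).1 hS.symm
    obtain ⟨e1, he1, ht1⟩ := threshold t t1 0
    obtain ⟨e2, he2, ht2⟩ := threshold t t1 1
    have hz' : ∀ j : Fin (m - 2 * 2 + 1), l (2 * t j + j + 1) = l (2 * t j + j) := by
      intro j
      have h1 := hz j (Finset.mem_univ _)
      have h2 := b2 (2 * t j + j)
      omega
    have h12 : e1 ≤ e2 := by
      by_contra hc
      have h1 := (ht1 ⟨e2, by omega⟩).1 (by simp only; omega)
      have h2 := (ht2 ⟨e2, by omega⟩).2 (by omega)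
      simp only at h2
      omega
    refine ⟨e1, e2, h12, by omega, ?_, ?_, ?_⟩
    · have := const_of_steps (l := l) 0 e1 (fun i _ hi => by
        have h1 := (ht1 ⟨i, by omega⟩).1 (by simp only; omega)
        have h2 := hz' ⟨i, by omega⟩
        have h3 : t ⟨i, by omega⟩ = 0 := by omega
        rw [h3] at h2
        simpa using h2)
      rw [zero_add] at this
      rw [this, b0]
    · obtain ⟨c, rfl⟩ := Nat.exists_eq_add_of_le h12
      have := const_of_steps (l := l) (e1 + 2) c (fun i hi1 hi2 => by
        obtain ⟨i, rfl⟩ := Nat.exists_eq_add_of_le (show 2 ≤ i by omega)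
        have h0 := mt (ht1 ⟨i, by omega⟩).2 (by simp only; omega)
        have h1 := (ht2 ⟨i, by omega⟩).1 (by simp only; omega)
        have h2 := hz' ⟨i, by omega⟩
        have h3 : t ⟨i, by omega⟩ = 1 := by omega
        rw [h3] at h2
        exact h2)
      rw [← this]
      congr 1
      omega
    · obtain ⟨c, hc⟩ := Nat.exists_eq_add_of_le (show e2 + 3 ≤ m by omega)
      have := const_of_steps (l := l) (e2 + 4) c (fun i hi1 hi2 => by
        obtain ⟨i, rfl⟩ := Nat.exists_eq_add_of_le (show 4 ≤ i by omega)
        have h1 := mt (ht2 ⟨i, by omega⟩).2 (by simp only; omega)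
        have h0 := t2 ⟨i, by omega⟩
        have h2 := hz' ⟨i, by omega⟩
        have h3 : t ⟨i, by omega⟩ = 2 := by omega
        rw [h3] at h2
        exact h2)
      rw [← this]
      exact b1 _ (by omega)
  · rintro ⟨e1, e2, h12, h2m, l1, l2, l3⟩
    have key : (0 : ℕ) ∈ fset m 2 l := by
      refine ⟨fun j => if (j : ℕ) < e1 then 0 else if (j : ℕ) < e2 then 1 else 2, ?_, ?_, ?_⟩
      · intro i j hij
        have : (i : ℕ) ≤ j := hij
        dsimp only
        split_ifs <;> omega
      · intro i
        dsimp only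
        split_ifs <;> omega
      · symm
        refine Finset.sum_eq_zero fun j _ => ?_
        dsimp only
        split_ifs with c1 c2
        · have h1 := anti_of b2 (show 0 ≤ 2 * 0 + (j : ℕ) by omega)
          have h2 := anti_of b2 (show 2 * 0 + (j : ℕ) + 1 ≤ e1 by omega)
          omega
        · have h1 := anti_of b2 (show e1 + 2 ≤ 2 * 1 + (j : ℕ) by omega)
          have h2 := anti_of b2 (show 2 * 1 + (j : ℕ) + 1 ≤ e2 + 2 by omega)
          omega
        · have h1 := anti_of b2 (show e2 + 4 ≤ 2 * 2 + (j : ℕ) by omega)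
          omega
    have := fmr_le key
    omega

lemma fmr_zero_of_two {m : ℕ} {l : ℕ → ℕ} (h2 : fmr m 2 l = 0) (r : ℕ) (hr : 2 ≤ r)
    (hrm : 2 * r ≤ m) : fmr m r l = 0 := by
  induction r, hr using Nat.le_induction with
  | base => exact h2
  | succ r hr ih =>
    have := ih (by omega)
    have := fmr_succ_le (l := l) hrm
    omega

lemma rhs_one {m : ℕ} (d0 d1 : ℕ) (hm : 2 ≤ m) :
    ∑ j : Fin (m / 2 + 1), ((j : ℕ) + 1 - 1) *
      (if (j : ℕ) = 0 then d0 else if (j : ℕ) = 1 then d1 else 0) = d1 := by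
  rw [Finset.sum_eq_single (⟨1, by omega⟩ : Fin (m / 2 + 1))]
  · simp
  · intro j _ hj
    have : (j : ℕ) ≠ 1 := fun h => hj (Fin.ext h)
    split_ifs <;> simp_all
  · simp

lemma rhs_two {m : ℕ} (d0 d1 r : ℕ) (hr : 2 ≤ r) :
    ∑ j : Fin (m / 2 + 1), ((j : ℕ) + 1 - r) *
      (if (j : ℕ) = 0 then d0 else if (j : ℕ) = 1 then d1 else 0) = 0 := by
  refine Finset.sum_eq_zero fun j _ => ?_
  split_ifs with h1 h2
  · have : (j : ℕ) + 1 - r = 0 := by omega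
    rw [this, zero_mul]
  · have : (j : ℕ) + 1 - r = 0 := by omega
    rw [this, zero_mul]
  · simp

lemma inBox_of_R {m M d y p : ℕ} {l : ℕ → ℕ} (hm : 2 ≤ m) (hy : y ≤ (m - 2) * d)
    (h : R m M (nu d y) l p) : InBox m (M + d) l := by
  obtain ⟨a1, a2, a3, a4, a5, a6⟩ := h
  refine ⟨?_, ?_, ?_⟩
  · rw [a3 0 (by omega), zero_add, nu_two]
  · intro i hi
    rw [a4 i (by omega)]
    exact nu_big hm hy hi
  · intro i
    rcases lt_trichotomy i p with hi | rfl | hi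
    · rw [a3 i hi]
      rcases Nat.lt_or_ge (i + 1) p with h | h
      · rw [a3 _ h]
        have := nu_anti d y (show i + 2 ≤ i + 1 + 2 by omega)
        omega
      · have : p = i + 1 := by omega
        subst this
        have := nu_anti d y (show i + 2 ≤ i + 1 + 2 by omega)
        omega
    · rw [a4 (i + 1) (by omega)]
      have := nu_anti d y (show i ≤ i + 1 by omega)
      omega
    · rw [a4 i hi, a4 (i + 1) (by omega)]
      exact nu_anti d y (by omega)

lemma inQ_of_R {m d0 d1 y p : ℕ} {l : ℕ → ℕ} (hm : 2 ≤ m) (h0 : 0 < d0)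
    (hy : y ≤ (m - 2) * d1) (h : R m (d0 + d1) (nu d1 y) l p) :
    InQ m (d0 + 2 * d1)
        (fun j => if (j : ℕ) = 0 then d0 else if (j : ℕ) = 1 then d1 else 0) l := by
  have hb := inBox_of_R hm hy h
  rw [show d0 + d1 + d1 = d0 + 2 * d1 by omega] at hb
  refine ⟨hb, fun r hr1 hr2 => ?_⟩
  obtain ⟨a1, a2, a3, a4, a5, a6⟩ := h
  rcases Nat.eq_or_lt_of_le hr1 with rfl | hr
  · rw [rhs_one d0 d1 hm, fmr_one hm hb]
    constructor
    · refine ⟨p, a1, a2, ?_⟩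
      rw [a3 (p - 1) (by omega), a4 (p + 1) (by omega), show p - 1 + 2 = p + 1 by omega]
      omega
    · intro i i1 i2
      obtain ⟨i, rfl⟩ := Nat.exists_eq_add_of_le' i1
      rw [Nat.add_sub_cancel]
      have hle := nu_le d1 y i
      have hle2 := nu_le d1 y (i + 2)
      rcases lt_trichotomy i p with hi | rfl | hi
      · rw [a3 i hi]
        rcases lt_trichotomy (i + 2) p with h | h | h
        · rw [a3 _ h]; omega
        · subst h
          have : i + 1 + 1 = i + 2 := rfl
          rw [this]; omega
        · rw [a4 _ h]
          have : i + 1 + 1 = i + 2 := rfl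
          rw [this]; omega
      · rw [a4 (i + 1 + 1) (by omega)]
        have : i + 1 + 1 = i + 2 := rfl
        rw [this]; omega
      · rw [a4 i hi]; omega
  · rw [rhs_two d0 d1 r hr]
    refine fmr_zero_of_two ?_ r hr (by omega)
    rw [fmr_two (by omega) hb]
    obtain ⟨q, q1, q2, v1, v2⟩ := nu_q (m := m) (d := d1) (by omega) hy
    rcases lt_trichotomy p q with hpq | rfl | hpq
    · refine ⟨p - 1, q - 2, by omega, by omega, ?_, ?_, ?_⟩
      · rw [a3 _ (by omega), v1 _ (by omega)]; omega
      · rw [a4 _ (by omega), a4 _ (by omega), v1 _ (by omega), v1 _ (by omega)]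
      · rw [a4 _ (by omega), v2 _ (by omega)]
    · refine ⟨p - 2, p - 2, by omega, by omega, ?_, rfl, ?_⟩
      · rw [a3 _ (by omega), v1 _ (by omega)]; omega
      · rw [a4 _ (by omega), v2 _ (by omega)]
    · refine ⟨q - 2, p - 3, by omega, by omega, ?_, ?_, ?_⟩
      · rw [a3 _ (by omega), v1 _ (by omega)]; omega
      · rw [a3 _ (by omega), a3 _ (by omega), v2 _ (by omega), v2 _ (by omega)]
      · rw [a4 _ (by omega), v2 _ (by omega)]

lemma R_of_inQ {m d0 d1 : ℕ} {l : ℕ → ℕ} (hm : 2 ≤ m) (h0 : 0 < d0) (h1 : 0 < d1)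
    (h : InQ m (d0 + 2 * d1)
        (fun j => if (j : ℕ) = 0 then d0 else if (j : ℕ) = 1 then d1 else 0) l) :
    ∃ y p, y ≤ (m - 2) * d1 ∧ R m (d0 + d1) (nu d1 y) l p := by
  obtain ⟨hb, hf⟩ := h
  have hf1 := hf 1 le_rfl (by omega)
  rw [rhs_one d0 d1 hm, fmr_one hm hb] at hf1
  obtain ⟨⟨p, p1, p2, hp⟩, hmax⟩ := hf1
  have hb' := hb
  obtain ⟨b0, b1, b2⟩ := hb'
  have anti : ∀ i j, i ≤ j → l j ≤ l i := fun i j h => anti_of b2 h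
  -- the reduced sequence
  let v : ℕ → ℕ := fun i => if i < 2 then d1 else if i ≤ p + 1 then l (i - 2) - (d0 + d1) else l i
  have vlow : ∀ i, i < 2 → v i = d1 := fun i hi => by simp only [v]; rw [if_pos hi]
  have vmid : ∀ i, i < p → l i = d0 + d1 + v (i + 2) := fun i hi => by
    simp only [v]
    rw [if_neg (by omega), if_pos (by omega), Nat.add_sub_cancel]
    have := anti i (p - 1) (by omega)
    omega
  have vhigh : ∀ i, p < i → l i = v i := fun i hi => by
    simp only [v]
    rw [if_neg (by omega)]
    split_ifs with h
    · have : i = p + 1 := by omega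
      subst this
      rw [show p + 1 - 2 = p - 1 by omega]
      omega
    · rfl
  have vle : ∀ i, v i ≤ d1 := by
    intro i
    rcases Nat.lt_or_ge i 2 with hi | hi
    · exact (vlow i hi).le
    rcases Nat.lt_or_ge p i with hi2 | hi2
    · rw [← vhigh i hi2]
      have h1 := anti (p + 1) i (by omega)
      have h2 := anti 0 (p - 1) (by omega)
      omega
    · have h1 := vmid (i - 2) (by omega)
      rw [show i - 2 + 2 = i by omega] at h1
      have h2 := anti 0 (i - 2) (by omega)
      omega
  have hvp : v p ≤ l p := by
    rcases Nat.lt_or_ge p 2 with hp2 | hp2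
    · have e : p = 1 := by omega
      subst e
      rw [vlow 1 (by omega)]
      have h1 := anti 1 2 (by omega)
      simp only [Nat.sub_self, Nat.reduceAdd] at hp
      omega
    · have h1 := vmid (p - 2) (by omega)
      rw [show p - 2 + 2 = p by omega] at h1
      have h2 := hmax (p - 1) (by omega) (by omega)
      rw [show p - 1 - 1 = p - 2 by omega, show p - 1 + 1 = p by omega] at h2
      omega
  have hvp2 : l p ≤ d0 + d1 + v (p + 2) := by
    rw [← vhigh (p + 2) (by omega)]
    rcases Nat.lt_or_ge p m with h | h
    · have h2 := hmax (p + 1) (by omega) (by omega)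
      rw [show p + 1 - 1 = p by omega, show p + 1 + 1 = p + 2 by omega] at h2
      omega
    · have e : p = m := by omega
      have h1 := anti (p - 1) p (by omega)
      have h2 := b1 (p + 1) (by omega)
      omega
  -- it suffices to identify `v`
  suffices hs : ∃ y, y ≤ (m - 2) * d1 ∧ ∀ i, v i = nu d1 y i by
    obtain ⟨y, hy, hv⟩ := hs
    have hv' : v = nu d1 y := funext hv
    refine ⟨y, p, hy, ?_⟩
    rw [← hv']
    exact ⟨p1, p2, vmid, vhigh, hvp, hvp2⟩
  have v2 : v 2 = d1 := by
    have := vmid 0 (by omega)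
    rw [zero_add] at this
    omega
  have vbig : ∀ i, m < i → v i = 0 := fun i hi => by
    rw [← vhigh i (by omega)]; exact b1 i hi
  rcases Nat.eq_or_lt_of_le hm with rfl | hm3
  · refine ⟨0, by omega, fun i => ?_⟩
    rcases Nat.lt_or_ge i 3 with hi | hi
    · have : v i = d1 := by
        rcases Nat.lt_or_ge i 2 with h | h
        · exact vlow i h
        · rw [show i = 2 by omega]; exact v2
      rw [this]
      have := Nat.mul_le_mul_right d1 (show i ≤ 2 by omega)
      unfold nu; omega
    · rw [vbig i (by omega)]
      have := Nat.mul_le_mul_right d1 hi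
      unfold nu; omega
  have he : ∃ e1 e2, e1 ≤ e2 ∧ e2 + 3 ≤ m ∧ l e1 = d0 + 2 * d1 ∧ l (e1 + 2) = l (e2 + 2) ∧
      l (e2 + 4) = 0 := by
    rcases Nat.eq_or_lt_of_le (show 3 ≤ m from hm3) with rfl | hm4
    · exact ⟨0, 0, le_rfl, by omega, b0, rfl, b1 _ (by omega)⟩
    · have := hf 2 (by omega) (by omega)
      rw [rhs_two d0 d1 2 le_rfl] at this
      exact (fmr_two hm4 hb).1 this
  obtain ⟨e1, e2, h12, h2m, l1, l2, l3⟩ := he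
  have vanti : ∀ i, v (i + 1) ≤ v i := by
    intro i
    rcases Nat.lt_or_ge i 2 with hi | hi
    · rw [vlow i hi]; exact vle _
    rcases Nat.lt_or_ge p i with hi2 | hi2
    · rw [← vhigh i hi2, ← vhigh (i + 1) (by omega)]
      exact b2 i
    · have h1 := vmid (i - 2) (by omega)
      have h2 := vmid (i - 1) (by omega)
      rw [show i - 2 + 2 = i by omega] at h1
      rw [show i - 1 + 2 = i + 1 by omega] at h2
      have h3 := anti (i - 2) (i - 1) (by omega)
      omega
  have finish : ∀ q, 2 ≤ q → q + 1 ≤ m → v q = d1 → v (q + 2) = 0 →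
      ∃ y, y ≤ (m - 2) * d1 ∧ ∀ i, v i = nu d1 y i := by
    intro q q1 q2 hq hq2
    refine eq_nu h1 v q q1 q2 (fun i hi => ?_) (fun i hi => ?_) (vle _)
    · have := anti_of vanti hi
      have := vle i
      omega
    · have := anti_of vanti hi
      omega
  by_cases c1 : p ≤ e1 + 2
  · -- remaining pair is the second one
    apply finish (e2 + 2) (by omega) (by omega)
    · by_cases c3 : e2 < p
      · have k1 := vmid e2 c3
        by_cases c4 : e2 = e1
        · subst c4; omega
        · have : e2 = e1 + 1 := by omega
          subst this
          have : p = e1 + 2 := by omega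
          subst this
          have k5 := vle (e1 + 3)
          rw [show e1 + 2 - 1 = e1 + 1 by omega] at hp
          simp only [show e1 + 2 + 1 = e1 + 3 by omega, show e1 + 1 + 2 = e1 + 3 by omega,
            show e1 + 1 + 1 = e1 + 2 by omega] at *
          have k3 := hmax (e1 + 1) (by omega) (by omega)
          rw [Nat.add_sub_cancel, show e1 + 1 + 1 = e1 + 2 by omega] at k3
          omega
      · rcases Nat.lt_or_ge p (e2 + 2) with c4 | c4
        · rw [← vhigh (e2 + 2) c4, ← l2]
          have k3 := hmax (e1 + 1) (by omega) (by omega)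
          rw [Nat.add_sub_cancel, show e1 + 1 + 1 = e1 + 2 by omega] at k3
          have k4 := vle (e2 + 2)
          rw [← vhigh (e2 + 2) c4, ← l2] at k4
          omega
        · omega
    · rw [← vhigh (e2 + 2 + 2) (by omega)]
      exact l3
  · by_cases c2 : e2 + 2 ≤ p
    · apply finish (e1 + 2) (by omega) (by omega)
      · have := vmid e1 (by omega)
        omega
      · have k1 := vmid (e1 + 2) (by omega)
        have k3 := hmax (e2 + 3) (by omega) (by omega)
        rw [show e2 + 3 - 1 = e2 + 2 by omega, show e2 + 3 + 1 = e2 + 4 by omega] at k3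
        omega
    · exfalso
      have k1 := anti (e1 + 2) (p - 1) (by omega)
      have k2 := anti (p + 1) (e2 + 2) (by omega)
      omega

end OHara

open OHara in
/-- `Q_m(d_0, d_1, 0, …, 0)` is isomorphic as a ranked set to the product of
two chains `[m d_0 + (m-2) d_1] × [(m-2) d_1]`, shifted up by `2 d_1`. -/
theorem stmt14 (m d0 d1 : ℕ) (hm : 2 ≤ m) (h0 : 0 < d0) (h1 : 0 < d1) (s : ℤ) :
    Set.ncard {l : ℕ → ℕ | InQ m (d0 + 2 * d1)
        (fun j => if (j : ℕ) = 0 then d0 else if (j : ℕ) = 1 then d1 else 0) l ∧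
      (psize m l : ℤ) = s} =
    Set.ncard {xy : ℤ × ℤ |
      0 ≤ xy.1 ∧ xy.1 ≤ (m : ℤ) * d0 + ((m : ℤ) - 2) * d1 ∧
      0 ≤ xy.2 ∧ xy.2 ≤ ((m : ℤ) - 2) * d1 ∧
      xy.1 + xy.2 = s - 2 * d1} := by
  have hM : d1 < d0 + d1 := by omega
  have hcast : (((m - 2) * d1 : ℕ) : ℤ) = ((m : ℤ) - 2) * d1 := by
    push_cast [hm]; ring
  have hcast2 : ((m * (d0 + d1) : ℕ) : ℤ) = (m : ℤ) * d0 + ((m : ℤ) - 2) * d1 + 2 * d1 := by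
    push_cast; ring
  have hex : ∀ l : ℕ → ℕ, InQ m (d0 + 2 * d1)
        (fun j => if (j : ℕ) = 0 then d0 else if (j : ℕ) = 1 then d1 else 0) l →
      ∃ y : ℕ, y ≤ (m - 2) * d1 ∧ ∃ p, R m (d0 + d1) (nu d1 y) l p := by
    intro l hl
    obtain ⟨y, p, hy, h⟩ := R_of_inQ hm h0 h1 hl
    exact ⟨y, hy, p, h⟩
  choose! f hf1 hf2 using hex
  have huniq : ∀ (l : ℕ → ℕ) (y y' p q : ℕ), y ≤ (m - 2) * d1 → y' ≤ (m - 2) * d1 →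
      R m (d0 + d1) (nu d1 y) l p → R m (d0 + d1) (nu d1 y') l q → y = y' := by
    intro l y y' p q hy hy' h h'
    have hv : ∀ i, nu d1 y i = nu d1 y' i := by
      rcases Nat.le_total p q with hpq | hpq
      · exact R_uniq_v hM h h' hpq
      · exact fun i => (R_uniq_v hM h' h hpq i).symm
    have e1 := nu_sum hm hy
    have e2 := nu_sum hm hy'
    have e3 : ∑ i ∈ Finset.Icc 1 m, nu d1 y i = ∑ i ∈ Finset.Icc 1 m, nu d1 y' i :=
      Finset.sum_congr rfl fun i _ => hv i
    omega
  refine Set.ncard_congr (fun l _ => (s - 2 * d1 - (f l : ℤ), (f l : ℤ))) ?_ ?_ ?_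
  · rintro l ⟨hl, hs⟩
    obtain ⟨p, hp⟩ := hf2 l hl
    have hy := hf1 l hl
    obtain ⟨k1, k2⟩ := psize_bounds hm hy hM hp
    simp only [Set.mem_ofPred_eq]
    refine ⟨?_, ?_, ?_, ?_, ?_⟩ <;> omega
  · rintro l l' ⟨hl, hs⟩ ⟨hl', hs'⟩ heq
    obtain ⟨p, hp⟩ := hf2 l hl
    obtain ⟨q, hq⟩ := hf2 l' hl'
    have e : f l = f l' := by
      have := congrArg Prod.snd heq
      simpa using this
    rw [← e] at hq
    exact R_uniq_l hM hp hq (by omega)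
  · rintro ⟨x, y⟩ ⟨k1, k2, k3, k4, k5⟩
    simp only at k1 k2 k3 k4 k5
    obtain ⟨x, rfl⟩ := Int.eq_ofNat_of_zero_le k1
    obtain ⟨y, rfl⟩ := Int.eq_ofNat_of_zero_le k3
    have hy : y ≤ (m - 2) * d1 := by omega
    obtain ⟨l, p, hR, hs⟩ := R_exists hm hy hM x (by omega)
    have hl := inQ_of_R hm h0 hy hR
    refine ⟨l, ⟨hl, by omega⟩, ?_⟩
    obtain ⟨q, hq⟩ := hf2 l hl
    have e := huniq l _ _ _ _ (hf1 l hl) hy hq hR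
    rw [e]
    simp only [Prod.mk.injEq, and_true]
    omega
end

section
/- Let m ≥ 4 be an integer, k = ⌊m/2⌋, and let d_0, d_1, d_2 be positive integers with n = d_0 + 2d_1 + 3d_2. Then for every integer s, the number of λ ∈ Q_m(d_0, d_1, d_2, 0, …, 0) with |λ| = s equals the number of triples (x, y, z) of integers with 0 ≤ x ≤ m·d_0 + (m−2)·d_1 + (m−4)·d_2, 0 ≤ y ≤ (m−2)·d_1 + (m−4)·d_2, 0 ≤ z ≤ (m−4)·d_2, and x + y + z = s − 2d_1 − 6d_2. (Q_m(d_0,d_1,d_2,0,…,0) is isomorphic as a ranked set to a product of three chains, shifted up by 2d_1 + 6d_2.) -/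
namespace OH

/-- `Ch r l S`: `S` is the sum of what is left of `l` after deleting `r` disjoint adjacent pairs. -/
inductive Ch : ℕ → List ℕ → ℕ → Prop
  | nil : Ch 0 [] 0
  | keep {r l S} (x : ℕ) : Ch r l S → Ch r (x :: l) (x + S)
  | skip {r l S} (x y : ℕ) : Ch r l S → Ch (r + 1) (x :: y :: l) S

theorem ch_zero (l : List ℕ) : Ch 0 l l.sum := by
  induction l with
  | nil => exact Ch.nil
  | cons x l ih => simpa using Ch.keep x ih

theorem ch_zero_eq {l : List ℕ} {S : ℕ} (h : Ch 0 l S) : S = l.sum := by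
  induction l generalizing S with
  | nil => cases h; rfl
  | cons x l ih =>
    cases h with
    | keep _ h => simp [ih h]

theorem ch_exists (r : ℕ) (l : List ℕ) (h : 2 * r ≤ l.length) : ∃ S, Ch r l S := by
  induction r generalizing l with
  | zero => exact ⟨_, ch_zero l⟩
  | succ r ih =>
    match l, h with
    | [], h => simp at h
    | [x], h => simp at h; omega
    | x :: y :: l, h =>
      obtain ⟨S, hS⟩ := ih l (by simp at h; omega)
      exact ⟨S, Ch.skip x y hS⟩

theorem ch_length {r : ℕ} {l : List ℕ} {S : ℕ} (h : Ch r l S) : 2 * r ≤ l.length := by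
  induction h with
  | nil => simp
  | keep x _ ih => simp; omega
  | skip x y _ ih => simp; omega

theorem ch_full {r : ℕ} {l : List ℕ} {S : ℕ} (h : Ch r l S) (hl : l.length = 2 * r) : S = 0 := by
  induction h with
  | nil => rfl
  | keep x h ih => have := ch_length h; simp at hl; omega
  | skip x y _ ih => apply ih; simp at hl; omega

theorem ch_lift (x y : ℕ) (l2 : List ℕ) : ∀ (l1 : List ℕ) {r S : ℕ},
    Ch r (l1 ++ l2) S → Ch (r + 1) (l1 ++ x :: y :: l2) S
  | [], _, _, h => Ch.skip x y h
  | [p], _, _, h => by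
    simp only [List.cons_append, List.nil_append] at h ⊢
    cases h with
    | keep _ h => exact Ch.keep p (Ch.skip x y h)
    | skip _ q h => exact Ch.skip p x (Ch.skip y q h)
  | p :: q :: l1, _, _, h => by
    simp only [List.cons_append] at h ⊢
    cases h with
    | keep _ h => exact Ch.keep p (ch_lift x y l2 (q :: l1) h)
    | skip _ _ h => exact Ch.skip p q (ch_lift x y l2 l1 h)

abbrev EL (A : ℕ) (l : List ℕ) : Prop := List.IsChain (fun x y => x + y ≤ A) l
abbrev ELt (A : ℕ) (l : List ℕ) : Prop := List.IsChain (fun x y => x + y < A) l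

theorem ch_unskip {A r : ℕ} {l : List ℕ} {S : ℕ} (h : Ch r l S) (hA : EL A l) (hr : 0 < r) :
    ∃ S' ≤ S + A, Ch (r - 1) l S' := by
  induction h with
  | nil => omega
  | keep x h ih =>
    obtain ⟨S', h1, h2⟩ := ih hA.tail hr
    exact ⟨x + S', by omega, Ch.keep x h2⟩
  | skip x y h ih =>
    have : x + y ≤ A := (List.isChain_cons_cons.1 hA).1
    exact ⟨x + (y + _), by omega, Ch.keep x (Ch.keep y h)⟩

theorem ch_descend {x y : ℕ} {l2 : List ℕ} : ∀ (l1 : List ℕ) {r S : ℕ},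
    EL (x + y) (l1 ++ x :: y :: l2) →
    Ch (r + 1) (l1 ++ x :: y :: l2) S → ∃ S' ≤ S, Ch r (l1 ++ l2) S'
  | [], r, S, hA, h => by
    simp only [List.nil_append] at h hA ⊢
    cases h with
    | skip _ _ h => exact ⟨S, le_rfl, h⟩
    | keep _ h =>
      cases h with
      | skip _ z h =>
        simp only [List.isChain_cons_cons] at hA
        exact ⟨_, by omega, Ch.keep z h⟩
      | keep _ h =>
        obtain ⟨S', h1, h2⟩ := ch_unskip h hA.tail.tail (by omega)
        exact ⟨S', by omega, h2⟩
  | [p], r, S, hA, h => by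
    simp only [List.cons_append, List.nil_append] at h hA ⊢
    cases h with
    | keep _ h =>
      obtain ⟨S', h1, h2⟩ := ch_descend [] hA.tail h
      exact ⟨p + S', by omega, Ch.keep p h2⟩
    | skip _ _ h =>
      simp only [List.isChain_cons_cons] at hA
      cases h with
      | keep _ h => exact ⟨_, by omega, Ch.keep p h⟩
      | skip _ z h => exact ⟨_, le_rfl, Ch.skip p z h⟩
  | p :: q :: l1, r, S, hA, h => by
    simp only [List.cons_append] at h hA ⊢
    cases h with
    | keep _ h =>
      obtain ⟨S', h1, h2⟩ := ch_descend (q :: l1) hA.tail h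
      exact ⟨p + S', by omega, Ch.keep p h2⟩
    | skip _ _ h =>
      cases r with
      | zero =>
        have := ch_zero_eq h
        refine ⟨_, ?_, ch_zero _⟩
        simp only [List.isChain_cons_cons] at hA
        simp at this ⊢
        omega
      | succ r =>
        obtain ⟨S', h1, h2⟩ := ch_descend l1 hA.tail.tail h
        exact ⟨S', h1, Ch.skip p q h2⟩

/-- The inductive membership condition. -/
def IsQ (ps a : List ℕ) : Prop :=
  ∀ r, 2 * r ≤ a.length → IsLeast {S | Ch r a S} (ps.drop r).sum

theorem least_iff {l1 l2 : List ℕ} {x y r v : ℕ} (h : EL (x + y) (l1 ++ x :: y :: l2)) :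
    IsLeast {S | Ch (r + 1) (l1 ++ x :: y :: l2) S} v ↔ IsLeast {S | Ch r (l1 ++ l2) S} v := by
  constructor
  · rintro ⟨h1, h2⟩
    obtain ⟨S', h3, h4⟩ := ch_descend l1 h h1
    have h5 : v ≤ S' := h2 (ch_lift x y l2 l1 h4)
    have : S' = v := by omega
    subst this
    exact ⟨h4, fun S hS => h2 (ch_lift x y l2 l1 hS)⟩
  · rintro ⟨h1, h2⟩
    refine ⟨ch_lift x y l2 l1 h1, fun S hS => ?_⟩
    obtain ⟨S', h3, h4⟩ := ch_descend l1 h hS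
    exact (h2 h4).trans h3

theorem ch_one {r : ℕ} {a : List ℕ} {S : ℕ} (h : Ch r a S) (hr : r = 1) :
    ∃ l1 x y l2, a = l1 ++ x :: y :: l2 ∧ S + (x + y) = a.sum := by
  induction h with
  | nil => omega
  | keep x h ih =>
    obtain ⟨l1, p, q, l2, rfl, h2⟩ := ih hr
    exact ⟨x :: l1, p, q, l2, rfl, by simp at h2 ⊢; omega⟩
  | @skip r l S x y h ih =>
    obtain rfl : r = 0 := by omega
    have := ch_zero_eq h
    exact ⟨[], x, y, _, rfl, by simp; omega⟩

theorem isQ_sum {ps a : List ℕ} (h : IsQ ps a) : a.sum = ps.sum := by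
  have := (h 0 (by simp)).1
  simpa using (ch_zero_eq this).symm

theorem isQ_edge {A : ℕ} {ps l1 l2 : List ℕ} {x y : ℕ} (h : IsQ (A :: ps) (l1 ++ x :: y :: l2)) :
    x + y ≤ A := by
  have h0 := isQ_sum h
  have h1 := (h 1 (by simp; omega)).2 (ch_lift x y l2 l1 (ch_zero _))
  simp at h0 h1
  omega

theorem isQ_EL {A : ℕ} {ps a : List ℕ} (h : IsQ (A :: ps) a) : EL A a := by
  rw [EL, List.isChain_iff_forall_rel_of_append_cons_cons]
  rintro x y l1 l2 rfl
  exact isQ_edge h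

theorem isQ_nil {a : List ℕ} (h : IsQ [] a) : a = List.replicate a.length 0 := by
  have := isQ_sum h
  simp at this
  exact List.eq_replicate_iff.2 ⟨rfl, List.sum_eq_zero_iff.1 this⟩

theorem isQ_zeros (L : ℕ) : IsQ [] (List.replicate L 0) := by
  intro r hr
  obtain ⟨S, hS⟩ := ch_exists r _ hr
  have key : ∀ {r l S}, Ch r l S → S ≤ l.sum := by
    intro r l S h
    induction h with
    | nil => simp
    | keep x _ ih => simp; omega
    | skip x y _ ih => simp; omega
  have := key hS
  simp at this
  subst this
  simpa using ⟨hS, fun _ _ => Nat.zero_le _⟩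

def ins (A : ℕ) : ℕ → List ℕ → List ℕ
  | v, [] => [A - v, v]
  | v, b :: l => if v + b ≤ A then (A - v) :: v :: b :: l else b :: ins A (v + 2 * b - A) l

def del (A : ℕ) : List ℕ → ℕ × List ℕ
  | x :: y :: l => if x + y = A then (y, l) else
      ((del A (y :: l)).1 + A - 2 * x, x :: (del A (y :: l)).2)
  | _ => (0, [])

def W : List ℕ → ℕ
  | [] => 0
  | _ :: l => W l + l.sum

abbrev Bd (A v : ℕ) (l : List ℕ) : Prop := v + 2 * l.sum ≤ (l.length + 1) * A

theorem bd_cons {A v b : ℕ} {l : List ℕ} (h : Bd A v (b :: l)) (hb : ¬ v + b ≤ A) :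
    Bd A (v + 2 * b - A) l := by
  simp only [Bd, List.sum_cons, List.length_cons, add_mul] at h ⊢
  have : 0 ≤ l.length * A := Nat.zero_le _
  omega

theorem ins_length (A v : ℕ) (l : List ℕ) : (ins A v l).length = l.length + 2 := by
  induction l generalizing v with
  | nil => simp [ins]
  | cons b l ih => unfold ins; split_ifs <;> simp [ih]

theorem ins_sum {A v : ℕ} {l : List ℕ} (h : Bd A v l) : (ins A v l).sum = l.sum + A := by
  induction l generalizing v with
  | nil => simp [Bd] at h; simp [ins]; omega
  | cons b l ih =>
    unfold ins; split_ifs with hb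
    · simp; omega
    · simp [ih (bd_cons h hb)]; omega

theorem ins_W {A v : ℕ} {l : List ℕ} (h : Bd A v l) : W (ins A v l) = W l + 2 * l.sum + v := by
  induction l generalizing v with
  | nil => simp [ins, W]
  | cons b l ih =>
    unfold ins; split_ifs with hb
    · simp [W]; omega
    · have := bd_cons h hb
      simp [W, ih this, ins_sum this]; omega

theorem ins_decomp {A v : ℕ} {l : List ℕ} (h : Bd A v l) :
    ∃ l1 x y l2, ins A v l = l1 ++ x :: y :: l2 ∧ l = l1 ++ l2 ∧ x + y = A := by
  induction l generalizing v with
  | nil => simp [Bd] at h; exact ⟨[], A - v, v, [], by simp [ins], rfl, by omega⟩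
  | cons b l ih =>
    unfold ins; split_ifs with hb
    · exact ⟨[], A - v, v, b :: l, rfl, rfl, by omega⟩
    · obtain ⟨l1, x, y, l2, h1, h2, h3⟩ := ih (bd_cons h hb)
      exact ⟨b :: l1, x, y, l2, by simp [h1], by simp [h2], h3⟩

theorem elt_le {A : ℕ} {l : List ℕ} (h : ELt A l) : EL A l := h.imp (fun _ _ h => h.le)

theorem ins_EL_aux {A : ℕ} {l : List ℕ} : ∀ {v b : ℕ}, b ≤ v → ELt A (b :: l) → Bd A v l →
    EL A (b :: ins A v l) := by
  induction l with
  | nil => intro v b hb _ h; simp [Bd] at h; simp [ins]; omega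
  | cons c l ih =>
    intro v b hb hE h
    have hE' := hE
    simp only [ELt, List.isChain_cons_cons] at hE'
    unfold ins; split_ifs with hc
    · simp only [EL, List.isChain_cons_cons]
      exact ⟨by omega, by omega, by omega, elt_le hE.tail⟩
    · simp only [EL, List.isChain_cons_cons]
      exact ⟨by omega, ih (by omega) hE.tail (bd_cons h hc)⟩

theorem ins_EL {A v : ℕ} {l : List ℕ} (hE : ELt A l) (h : Bd A v l) : EL A (ins A v l) := by
  cases l with
  | nil => simp [Bd] at h; simp [ins]; omega
  | cons c l =>
    unfold ins; split_ifs with hc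
    · simp only [EL, List.isChain_cons_cons]
      exact ⟨by omega, by omega, elt_le hE⟩
    · exact ins_EL_aux (by omega) hE (bd_cons h hc)

theorem ins_head {A v b : ℕ} {l : List ℕ} (hb : b < v) (hE : ELt A (b :: l)) (h : Bd A v l) :
    ∃ p t, ins A v l = p :: t ∧ b + p < A := by
  cases l with
  | nil => simp [Bd] at h; exact ⟨A - v, [v], by simp [ins], by omega⟩
  | cons c l =>
    unfold ins; split_ifs with hc
    · exact ⟨_, _, rfl, by omega⟩
    · exact ⟨_, _, rfl, (List.isChain_cons_cons.1 hE).1⟩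

theorem del_ins {A v : ℕ} {l : List ℕ} (hE : ELt A l) (h : Bd A v l) :
    del A (ins A v l) = (v, l) := by
  induction l generalizing v with
  | nil => simp [Bd] at h; simp [ins, del]; omega
  | cons b l ih =>
    unfold ins; split_ifs with hc
    · have : A - v + v = A := by omega
      simp [del, this]
    · obtain ⟨p, t, h1, h2⟩ := ins_head (by omega) hE (bd_cons h hc)
      have h3 := ih hE.tail (bd_cons h hc)
      rw [h1] at h3 ⊢
      rw [del, if_neg (by omega), h3]
      simp; omega

theorem bd_base {A : ℕ} {l : List ℕ} : ∀ {y : ℕ}, y ≤ A → EL A (y :: l) → Bd A y l := by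
  induction l with
  | nil => intro y h _; simpa [Bd] using h
  | cons b l ih =>
    intro y h hE
    have h1 := (List.isChain_cons_cons.1 hE).1
    have := ih (by omega) hE.tail
    simp [Bd, add_mul] at this ⊢
    omega

theorem ins_surj {A : ℕ} : ∀ (a l1 : List ℕ) (x y : ℕ) (l2 : List ℕ), EL A a →
    a = l1 ++ x :: y :: l2 → x + y = A →
    ∃ v l, a = ins A v l ∧ Bd A v l ∧ ∀ p ∈ a.head?, A ≤ v + p
  | [], l1, x, y, l2, _, h, _ => by simp at h
  | [p], l1, x, y, l2, _, h, _ => by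
    have := congrArg List.length h; simp at this; omega
  | p :: q :: a, l1, x, y, l2, hE, h, hxy => by
    have hpq := (List.isChain_cons_cons.1 hE).1
    by_cases hA : p + q = A
    · refine ⟨q, a, ?_, bd_base (by omega) hE.tail, by simp; omega⟩
      have hp : p = A - q := by omega
      cases a with
      | nil => simp [ins, hp]
      | cons b a =>
        have := (List.isChain_cons_cons.1 hE.tail).1
        simp [ins, hp, this]
    · cases l1 with
      | nil => simp at h; omega
      | cons p' l1 =>
        simp at h
        obtain ⟨v, l, h1, h2, h3⟩ := ins_surj (q :: a) l1 x y l2 hE.tail h.2 hxy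
        simp at h3
        refine ⟨v + A - 2 * p, p :: l, ?_, ?_, ?_⟩
        · rw [ins, if_neg (by omega), h1]
          congr 2; omega
        · simp [Bd, add_mul] at h2 ⊢; omega
        · simp; omega

theorem step_fwd {A : ℕ} {ps a : List ℕ} (h : IsQ (A :: ps) a) (hl : 2 ≤ a.length) :
    ∃ v l, IsQ ps l ∧ Bd A v l ∧ a = ins A v l := by
  obtain ⟨l1, x, y, l2, h1, h2⟩ := ch_one (h 1 (by omega)).1 rfl
  have h3 := isQ_sum h
  simp at h2 h3
  have hE := isQ_EL h
  obtain ⟨v, l, h4, h5, -⟩ := ins_surj a l1 x y l2 hE h1 (by omega)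
  refine ⟨v, l, ?_, h5, h4⟩
  obtain ⟨m1, x, y, m2, h6, rfl, rfl⟩ := ins_decomp h5
  rw [h4, h6] at h hE
  intro r hr
  rw [← least_iff hE]
  have := h (r + 1) (by simp at hr ⊢; omega)
  simpa using this

theorem step_bwd {A v : ℕ} {ps l : List ℕ} (hE : ELt A l) (h : IsQ ps l) (hb : Bd A v l) :
    IsQ (A :: ps) (ins A v l) := by
  have hs := ins_sum hb
  have hE' := ins_EL hE hb
  obtain ⟨m1, x, y, m2, h6, rfl, rfl⟩ := ins_decomp hb
  rw [h6] at hs hE' ⊢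
  intro r hr
  cases r with
  | zero =>
    have h0 := isQ_sum h
    have : (List.drop 0 ((x + y) :: ps)).sum = (m1 ++ x :: y :: m2).sum := by
      rw [hs, h0]; simp; omega
    rw [this]
    exact ⟨ch_zero _, fun S hS => (ch_zero_eq hS).ge⟩
  | succ r =>
    rw [least_iff hE']
    simpa using h r (by simp at hr ⊢; omega)

theorem elt_of_lt {A B : ℕ} (h : B < A) {l : List ℕ} (hE : EL B l) : ELt A l :=
  hE.imp (fun _ _ h => by omega)

/-- lists for a single part `C` -/
def base (L C z : ℕ) : List ℕ := if L = 1 then [C] else ins C z (List.replicate (L - 2) 0)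

theorem W_zeros (L : ℕ) : W (List.replicate L 0) = 0 := by
  induction L with
  | zero => rfl
  | succ L ih => simp [List.replicate_succ, W, ih]

theorem zeros_bd {L C z : ℕ} (hL : 1 ≤ L) (h1 : L ≠ 1) (hz : z ≤ (L - 1) * C) :
    Bd C z (List.replicate (L - 2) 0) := by
  simp [Bd]
  rwa [show L - 2 + 1 = L - 1 by omega]

theorem base_W {L C z : ℕ} (hL : 1 ≤ L) (hz : z ≤ (L - 1) * C) : W (base L C z) = z := by
  unfold base
  split_ifs with h
  · subst h; simp at hz; simp [W, hz]
  · rw [ins_W (zeros_bd hL h hz)]; simp [W_zeros]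

theorem base_length {L C z : ℕ} (hL : 1 ≤ L) : (base L C z).length = L := by
  unfold base
  split_ifs with h
  · simp [h]
  · simp [ins_length]; omega

theorem base_isQ {L C z : ℕ} (hC : 0 < C) (hL : 1 ≤ L) (hz : z ≤ (L - 1) * C) :
    IsQ [C] (base L C z) := by
  unfold base
  split_ifs with h
  · intro r hr
    obtain rfl : r = 0 := by simp at hr; omega
    exact ⟨by simpa using ch_zero [C], fun S hS => (by simpa using (ch_zero_eq hS).ge)⟩
  · apply step_bwd _ (isQ_zeros _) (zeros_bd hL h hz)
    rw [ELt, List.isChain_iff_forall_rel_of_append_cons_cons]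
    intro x y l1 l2 h
    have := congrArg List.sum h
    simp at this
    omega

theorem base_surj {L C : ℕ} {a : List ℕ} (hL : 1 ≤ L) (ha : a.length = L) (h : IsQ [C] a) :
    ∃ z ≤ (L - 1) * C, a = base L C z := by
  by_cases h1 : L = 1
  · subst h1
    obtain ⟨x, rfl⟩ := List.length_eq_one_iff.1 ha
    have := isQ_sum h
    simp at this
    exact ⟨0, by simp, by simp [base, this]⟩
  · obtain ⟨v, l, h2, h3, rfl⟩ := step_fwd h (by omega)
    have h4 := isQ_nil h2
    rw [ins_length] at ha
    have h5 : l.length = L - 2 := by omega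
    rw [h5] at h4
    refine ⟨v, ?_, by simp [base, h1, h4]⟩
    rw [h4] at h3
    simp [Bd] at h3
    rwa [show L - 2 + 1 = L - 1 by omega] at h3

/-- the partition of a difference list -/
def toFun (a : List ℕ) (i : ℕ) : ℕ := (a.drop i).sum

theorem toFun_sub (a : List ℕ) (i : ℕ) : toFun a i - toFun a (i + 1) = a.getD i 0 := by
  unfold toFun
  by_cases h : i < a.length
  · rw [List.drop_eq_getElem_cons h, List.sum_cons]; simp [h]
  · rw [List.drop_eq_nil_of_le (by omega)]; simp; rw [List.getElem?_eq_none (by omega)]; rfl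

theorem toFun_inj {a b : List ℕ} (hl : a.length = b.length) (h : toFun a = toFun b) : a = b := by
  apply List.ext_getElem hl
  intro i h1 h2
  have := toFun_sub a i
  rw [h, toFun_sub b i] at this
  simpa [h1, h2] using this.symm

theorem toFun_inBox {m n : ℕ} {a : List ℕ} (hl : a.length = m + 1) (hs : a.sum = n) :
    InBox m n (toFun a) := by
  refine ⟨by simp [toFun, hs], fun i hi => ?_, fun i => ?_⟩
  · rw [toFun, List.drop_eq_nil_of_le (by omega)]; rfl
  · unfold toFun
    by_cases h : i < a.length
    · rw [List.drop_eq_getElem_cons h, List.sum_cons]; exact Nat.le_add_left _ _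
    · rw [List.drop_eq_nil_of_le (by omega)]; simp

theorem exists_toFun (m : ℕ) : ∀ (n : ℕ) (l : ℕ → ℕ), InBox m n l →
    ∃ a : List ℕ, a.length = m + 1 ∧ a.sum = n ∧ l = toFun a := by
  induction m with
  | zero =>
    rintro n l ⟨h1, h2, h3⟩
    refine ⟨[n], rfl, by simp, funext fun i => ?_⟩
    cases i with
    | zero => simp [toFun, h1]
    | succ i => simp [toFun, h2]
  | succ m ih =>
    rintro n l ⟨h1, h2, h3⟩
    obtain ⟨a, ha, hb, hc⟩ := ih (l 1) (fun i => l (i + 1))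
      ⟨rfl, fun i hi => h2 _ (by omega), fun i => h3 _⟩
    have := h3 0
    simp at this
    refine ⟨(n - l 1) :: a, by simp [ha], by simp [hb]; omega, funext fun i => ?_⟩
    cases i with
    | zero => simp [toFun, hb]; omega
    | succ i => simpa [toFun] using congrFun hc i

theorem W_toFun (m : ℕ) : ∀ (a : List ℕ), a.length = m + 1 → psize m (toFun a) = W a := by
  have key : ∀ (m : ℕ) (a : List ℕ), a.length = m + 1 →
      ∑ i ∈ Finset.range m, toFun a (i + 1) = W a := by
    intro m
    induction m with
    | zero => intro a h; obtain ⟨x, rfl⟩ := List.length_eq_one_iff.1 h; simp [W]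
    | succ m ih =>
      intro a h
      cases a with
      | nil => simp at h
      | cons x a =>
        rw [Finset.sum_range_succ', W, ← ih a (by simpa using h)]
        simp [toFun]
  intro a h
  rw [← key m a h, psize, Finset.range_eq_Ico, Finset.sum_Ico_add' (toFun a) 0 m 1]
  rfl

theorem ch_of_t (N : ℕ) : ∀ (r : ℕ) (a : List ℕ), a.length = N + 2 * r → ∀ t : Fin N → ℕ,
    (∀ i j, i ≤ j → t i ≤ t j) → (∀ i, t i ≤ r) →
    Ch r a (∑ j, a.getD (2 * t j + (j : ℕ)) 0) := by
  induction N with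
  | zero =>
    intro r a ha t _ _
    obtain ⟨S, hS⟩ := ch_exists r a (by omega)
    have := ch_full hS (by omega)
    simpa [this] using hS
  | succ N ih =>
    intro r
    induction r with
    | zero =>
      intro a ha t h1 h2
      cases a with
      | nil => simp at ha
      | cons x a =>
        have h0 : ∀ i, t i = 0 := fun i => Nat.le_zero.1 (h2 i)
        have := ih 0 a (by simpa using ha) (fun _ => 0) (by simp) (by simp)
        rw [Fin.sum_univ_succ]
        simpa [h0] using Ch.keep x this
    | succ r ihr =>
      intro a ha t h1 h2
      by_cases h0 : t 0 = 0
      · cases a with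
        | nil => simp at ha
        | cons x a =>
          have := ih (r + 1) a (by simp at ha; omega) (fun i => t i.succ)
            (fun i j h => h1 _ _ (by simpa using h)) (fun i => h2 _)
          rw [Fin.sum_univ_succ]
          simpa [h0, ← add_assoc] using Ch.keep x this
      · match a, ha with
        | [], ha => simp at ha
        | [x], ha => simp at ha; omega
        | x :: y :: a, ha =>
          have hpos : ∀ i, 1 ≤ t i := fun i => by have := h1 0 i (by simp); omega
          have := ihr a (by simp at ha; omega) (fun i => t i - 1)
            (fun i j h => by have := h1 i j h; simp; omega) (fun i => by have := h2 i; simp; omega)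
          have := Ch.skip x y this
          convert this using 2 with j
          rename_i j _
          have := hpos j
          rw [show 2 * t j + (j : ℕ) = (2 * (t j - 1) + (j : ℕ)) + 1 + 1 by omega]
          simp

theorem t_of_ch {r : ℕ} {a : List ℕ} {S : ℕ} (h : Ch r a S) : ∀ N, a.length = N + 2 * r →
    ∃ t : Fin N → ℕ, (∀ i j, i ≤ j → t i ≤ t j) ∧ (∀ i, t i ≤ r) ∧
    S = ∑ j, a.getD (2 * t j + (j : ℕ)) 0 := by
  induction h with
  | nil =>
    intro N hN
    obtain rfl : N = 0 := by simp at hN; omega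
    exact ⟨fun _ => 0, by simp, by simp, by simp⟩
  | @keep r l S x h ih =>
    intro N hN
    have := ch_length h
    obtain ⟨N, rfl⟩ : ∃ M, N = M + 1 := ⟨N - 1, by simp at hN; omega⟩
    obtain ⟨t, h1, h2, h3⟩ := ih N (by simp at hN; omega)
    refine ⟨Fin.cons 0 t, ?_, ?_, ?_⟩
    · intro i j hij
      cases i using Fin.cases with
      | zero => simp
      | succ i =>
        cases j using Fin.cases with
        | zero => simp at hij
        | succ j => simpa using h1 i j (by simpa using hij)
    · intro i
      cases i using Fin.cases with
      | zero => simp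
      | succ i => simpa using h2 i
    · rw [Fin.sum_univ_succ, h3]; simp [← add_assoc]
  | @skip r l S x y h ih =>
    intro N hN
    obtain ⟨t, h1, h2, h3⟩ := ih N (by simp at hN; omega)
    refine ⟨fun i => t i + 1, fun i j h => by simpa using h1 i j h,
      fun i => by simpa using h2 i, ?_⟩
    rw [h3]
    refine Finset.sum_congr rfl fun j _ => ?_
    rw [show 2 * (t j + 1) + (j : ℕ) = (2 * t j + (j : ℕ)) + 1 + 1 by omega]
    simp

theorem fmr_toFun {m r : ℕ} {a : List ℕ} (ha : a.length = m + 1) (hr : 2 * r ≤ m) :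
    fmr m r (toFun a) = sInf {S | Ch r a S} := by
  unfold fmr
  congr 1
  ext S
  simp only [toFun_sub, Set.mem_ofPred_eq]
  constructor
  · rintro ⟨t, h1, h2, rfl⟩
    exact ch_of_t _ r a (by omega) t h1 h2
  · intro h
    exact t_of_ch h _ (by omega)

theorem fmr_iff {m r v : ℕ} {a : List ℕ} (ha : a.length = m + 1) (hr : 2 * r ≤ m) :
    fmr m r (toFun a) = v ↔ IsLeast {S | Ch r a S} v := by
  rw [fmr_toFun ha hr]
  constructor
  · rintro rfl
    exact ⟨Nat.sInf_mem (ch_exists r a (by omega)), fun S hS => Nat.sInf_le hS⟩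
  · intro h
    exact h.csInf_eq

theorem sum_d {k r d0 d1 d2 : ℕ} (hk : 2 ≤ k) (hr : 1 ≤ r) :
    ∑ j : Fin (k + 1), ((j : ℕ) + 1 - r) * (if (j : ℕ) = 0 then d0 else if (j : ℕ) = 1 then d1
          else if (j : ℕ) = 2 then d2 else 0) =
      (List.drop r [d0 + d1 + d2, d1 + d2, d2]).sum := by
  obtain ⟨k, rfl⟩ : ∃ j, k = j + 2 := ⟨k - 2, by omega⟩
  rw [Finset.sum_range (fun j : ℕ => (j + 1 - r) * (if j = 0 then d0 else if j = 1 then d1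
          else if j = 2 then d2 else 0)) |>.symm]
  rw [Finset.sum_range_succ', Finset.sum_range_succ', Finset.sum_range_succ']
  simp
  match r, hr with
  | 1, _ => simp; omega
  | 2, _ => simp
  | r + 3, _ =>
    simp

theorem inQ_iff {m d0 d1 d2 : ℕ} (hm : 4 ≤ m) (l : ℕ → ℕ) :
    InQ m (d0 + 2 * d1 + 3 * d2)
        (fun j => if (j : ℕ) = 0 then d0 else if (j : ℕ) = 1 then d1
          else if (j : ℕ) = 2 then d2 else 0) l ↔
    ∃ a, a.length = m + 1 ∧ IsQ [d0 + d1 + d2, d1 + d2, d2] a ∧ l = toFun a := by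
  constructor
  · rintro ⟨h1, h2⟩
    obtain ⟨a, ha, hs, rfl⟩ := exists_toFun _ _ _ h1
    refine ⟨a, ha, ?_, rfl⟩
    intro r hr
    by_cases h0 : r = 0
    · subst h0
      have : (List.drop 0 [d0 + d1 + d2, d1 + d2, d2]).sum = a.sum := by simp [hs]; omega
      rw [this]
      exact ⟨ch_zero _, fun S hS => (ch_zero_eq hS).ge⟩
    · by_cases h3 : 2 * r ≤ m
      · rw [← fmr_iff ha h3, h2 r (by omega) (by omega)]
        exact sum_d (by omega) (by omega)
      · have h4 : a.length = 2 * r := by omega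
        rw [List.drop_eq_nil_of_le (by simp; omega)]
        obtain ⟨S, hS⟩ := ch_exists r a hr
        have := ch_full hS h4
        subst this
        exact ⟨hS, fun _ _ => Nat.zero_le _⟩
  · rintro ⟨a, ha, h, rfl⟩
    have hs := isQ_sum h
    refine ⟨toFun_inBox ha (by simp at hs; omega), fun r h1 h2 => ?_⟩
    rw [fmr_iff ha (by omega), sum_d (by omega) h1]
    exact h r (by omega)

/-- the three-fold insertion -/
def F (m A B C x y z : ℕ) : List ℕ := ins A x (ins B y (base (m - 3) C z))

theorem main_aux {m A B C : ℕ} (hm : 4 ≤ m) (hC : 0 < C) (hB : C < B) (hA : B < A) :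
    (∀ a, (a.length = m + 1 ∧ IsQ [A, B, C] a) ↔ ∃ x y z, x + 2 * (B + C) ≤ m * A ∧
      y + 2 * C ≤ (m - 2) * B ∧ z ≤ (m - 4) * C ∧ a = F m A B C x y z) ∧
    (∀ x y z, x + 2 * (B + C) ≤ m * A → y + 2 * C ≤ (m - 2) * B → z ≤ (m - 4) * C →
      W (F m A B C x y z) = x + y + z + 2 * B + 4 * C ∧
      (del A (F m A B C x y z)).1 = x ∧
      (del B (del A (F m A B C x y z)).2).1 = y) := by
  have hb : ∀ y z, y + 2 * C ≤ (m - 2) * B → z ≤ (m - 4) * C →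
      Bd B y (base (m - 3) C z) ∧ IsQ [C] (base (m - 3) C z) := by
    intro y z hy hz
    have h1 := base_isQ (L := m - 3) (z := z) hC (by omega) hz
    refine ⟨?_, h1⟩
    have := isQ_sum h1
    simp at this
    rw [Bd, base_length (by omega), this]
    rwa [show m - 3 + 1 = m - 2 by omega]
  have ha : ∀ x y z, x + 2 * (B + C) ≤ m * A → y + 2 * C ≤ (m - 2) * B → z ≤ (m - 4) * C →
      Bd A x (ins B y (base (m - 3) C z)) ∧ IsQ [B, C] (ins B y (base (m - 3) C z)) := by
    intro x y z hx hy hz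
    obtain ⟨h1, h2⟩ := hb y z hy hz
    have h3 := step_bwd (elt_of_lt hB (isQ_EL h2)) h2 h1
    refine ⟨?_, h3⟩
    have := isQ_sum h3
    simp at this
    rw [Bd, ins_length, base_length (by omega), this]
    rwa [show m - 3 + 2 + 1 = m by omega]
  refine ⟨fun a => ⟨?_, ?_⟩, ?_⟩
  · rintro ⟨h1, h2⟩
    obtain ⟨x, l, h3, h4, rfl⟩ := step_fwd h2 (by omega)
    rw [ins_length] at h1
    obtain ⟨y, l, h5, h6, rfl⟩ := step_fwd h3 (by omega)
    rw [ins_length] at h1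
    obtain ⟨z, hz, rfl⟩ := base_surj (L := m - 3) (by omega) (by omega) h5
    have e1 := isQ_sum h3
    have e2 := isQ_sum h5
    simp at e1 e2
    refine ⟨x, y, z, ?_, ?_, hz, rfl⟩
    · rw [Bd, e1, ins_length, (by omega : (base (m-3) C z).length + 2 + 1 = m)] at h4
      exact h4
    · rw [Bd, e2, (by omega : (base (m-3) C z).length + 1 = m - 2)] at h6
      exact h6
  · rintro ⟨x, y, z, hx, hy, hz, rfl⟩
    obtain ⟨h1, h2⟩ := ha x y z hx hy hz
    refine ⟨?_, step_bwd (elt_of_lt hA (isQ_EL h2)) h2 h1⟩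
    rw [F, ins_length, ins_length, base_length (by omega)]
    omega
  · intro x y z hx hy hz
    obtain ⟨h1, h2⟩ := ha x y z hx hy hz
    obtain ⟨h3, h4⟩ := hb y z hy hz
    have e1 := isQ_sum h2
    have e2 := isQ_sum h4
    simp at e1 e2
    refine ⟨?_, ?_, ?_⟩
    · rw [F, ins_W h1, ins_W h3, base_W (L := m - 3) (by omega) hz, e1, e2]; omega
    · rw [F, del_ins (elt_of_lt hA (isQ_EL h2)) h1]
    · rw [F, del_ins (elt_of_lt hA (isQ_EL h2)) h1, del_ins (elt_of_lt hB (isQ_EL h4)) h3]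

end OH

/-- `Q_m(d_0, d_1, d_2, 0, …, 0)` is isomorphic as a ranked set to a product
of three chains, shifted up by `2 d_1 + 6 d_2`. -/
theorem stmt15 (m d0 d1 d2 : ℕ) (hm : 4 ≤ m) (h0 : 0 < d0) (h1 : 0 < d1) (h2 : 0 < d2)
    (s : ℤ) :
    Set.ncard {l : ℕ → ℕ | InQ m (d0 + 2 * d1 + 3 * d2)
        (fun j => if (j : ℕ) = 0 then d0 else if (j : ℕ) = 1 then d1
          else if (j : ℕ) = 2 then d2 else 0) l ∧
      (psize m l : ℤ) = s} =
    Set.ncard {xyz : ℤ × ℤ × ℤ |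
      0 ≤ xyz.1 ∧ xyz.1 ≤ (m : ℤ) * d0 + ((m : ℤ) - 2) * d1 + ((m : ℤ) - 4) * d2 ∧
      0 ≤ xyz.2.1 ∧ xyz.2.1 ≤ ((m : ℤ) - 2) * d1 + ((m : ℤ) - 4) * d2 ∧
      0 ≤ xyz.2.2 ∧ xyz.2.2 ≤ ((m : ℤ) - 4) * d2 ∧
      xyz.1 + xyz.2.1 + xyz.2.2 = s - 2 * d1 - 6 * d2} := by
  obtain ⟨hQ, hF⟩ := OH.main_aux (m := m) (A := d0 + d1 + d2) (B := d1 + d2) (C := d2) hm h2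
    (by omega) (by omega)
  obtain ⟨p, rfl⟩ : ∃ p, m = p + 4 := ⟨m - 4, by omega⟩
  have e1 : p + 4 - 2 = p + 2 := by omega
  have e2 : p + 4 - 4 = p := by omega
  rw [e1, e2] at hQ hF
  have conv : ∀ x y z : ℤ, (0 ≤ x ∧ x ≤ ((p + 4 : ℕ) : ℤ) * d0 + (((p + 4 : ℕ) : ℤ) - 2) * d1
        + (((p + 4 : ℕ) : ℤ) - 4) * d2 ∧
      0 ≤ y ∧ y ≤ (((p + 4 : ℕ) : ℤ) - 2) * d1 + (((p + 4 : ℕ) : ℤ) - 4) * d2 ∧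
      0 ≤ z ∧ z ≤ (((p + 4 : ℕ) : ℤ) - 4) * d2) ↔ ∃ x' y' z' : ℕ, x = x' ∧ y = y' ∧ z = z' ∧
      x' + 2 * (d1 + d2 + d2) ≤ (p + 4) * (d0 + d1 + d2) ∧
      y' + 2 * d2 ≤ (p + 2) * (d1 + d2) ∧ z' ≤ p * d2 := by
    intro x y z
    constructor
    · rintro ⟨a1, a2, a3, a4, a5, a6⟩
      lift x to ℕ using a1
      lift y to ℕ using a3
      lift z to ℕ using a5
      refine ⟨x, y, z, rfl, rfl, rfl, ?_, ?_, ?_⟩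
      all_goals zify; push_cast at *; nlinarith
    · rintro ⟨x, y, z, rfl, rfl, rfl, a1, a2, a3⟩
      zify at a1 a2 a3
      refine ⟨by omega, ?_, by omega, ?_, by omega, ?_⟩
      all_goals push_cast at *; nlinarith
  symm
  apply Set.ncard_congr (fun xyz _ => OH.toFun (OH.F (p + 4) (d0 + d1 + d2) (d1 + d2) d2
    xyz.1.toNat xyz.2.1.toNat xyz.2.2.toNat))
  · rintro ⟨x, y, z⟩ ⟨a1, a2, a3, a4, a5, a6, a7⟩
    obtain ⟨x, y, z, rfl, rfl, rfl, b1, b2, b3⟩ := (conv x y z).1 ⟨a1, a2, a3, a4, a5, a6⟩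
    simp only [Int.toNat_natCast] at a7 ⊢
    have hq := (hQ _).2 ⟨x, y, z, b1, b2, b3, rfl⟩
    refine ⟨(OH.inQ_iff hm _).2 ⟨_, hq.1, hq.2, rfl⟩, ?_⟩
    rw [OH.W_toFun _ _ hq.1, (hF x y z b1 b2 b3).1]
    push_cast
    omega
  · rintro ⟨x, y, z⟩ ⟨x', y', z'⟩ ⟨a1, a2, a3, a4, a5, a6, a7⟩ ⟨a1', a2', a3', a4', a5', a6', a7'⟩ h
    obtain ⟨x, y, z, rfl, rfl, rfl, b1, b2, b3⟩ := (conv x y z).1 ⟨a1, a2, a3, a4, a5, a6⟩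
    obtain ⟨x', y', z', rfl, rfl, rfl, b1', b2', b3'⟩ :=
      (conv x' y' z').1 ⟨a1', a2', a3', a4', a5', a6'⟩
    simp only [Int.toNat_natCast] at h a7 a7'
    have hq := (hQ _).2 ⟨x, y, z, b1, b2, b3, rfl⟩
    have hq' := (hQ _).2 ⟨x', y', z', b1', b2', b3', rfl⟩
    have e := OH.toFun_inj (hq.1.trans hq'.1.symm) h
    obtain ⟨c1, c2, c3⟩ := hF x y z b1 b2 b3
    obtain ⟨c1', c2', c3'⟩ := hF x' y' z' b1' b2' b3'
    rw [e] at c2 c3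
    have hx : x = x' := c2.symm.trans c2'
    have hy : y = y' := c3.symm.trans c3'
    have hz : z = z' := by omega
    rw [hx, hy, hz]
  · rintro l ⟨hl, hs⟩
    obtain ⟨a, ha, hq, rfl⟩ := (OH.inQ_iff hm _).1 hl
    obtain ⟨x, y, z, b1, b2, b3, rfl⟩ := (hQ a).1 ⟨ha, hq⟩
    rw [OH.W_toFun _ _ ha, (hF x y z b1 b2 b3).1] at hs
    obtain ⟨a1, a2, a3, a4, a5, a6⟩ := (conv x y z).2 ⟨x, y, z, rfl, rfl, rfl, b1, b2, b3⟩
    refine ⟨((x : ℤ), (y : ℤ), (z : ℤ)), ⟨a1, a2, a3, a4, a5, a6, ?_⟩, by simp⟩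
    push_cast at hs
    simp only
    omega
end

section
/- Let m ≥ 2 be an integer and let d_0, d_1 be positive integers with n = d_0 + 2d_1. Then p_r(m,n) > p_{r−1}(m,n) for every integer r with 2d_1 ≤ r ≤ m·d_1. -/
/-- `gaussP m n r` is the number of partitions of `r` into at most `m` parts,
each part of size at most `n` (the coefficient of `q^r` in the Gaussian
binomial coefficient `binom(m+n, m)_q`). -/
def gaussP (m n r : ℕ) : ℕ :=
  (Finset.univ.filter fun f : Fin m → Fin (n + 1) =>
    (∀ i j : Fin m, i ≤ j → f j ≤ f i) ∧ ∑ i, (f i : ℕ) = r).card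

open MvPolynomial in
/-- Symmetric homogeneous polynomials of degree `r` in `m` variables, of degree at most `n`
in each variable. -/
noncomputable def WSp (m n r : ℕ) : Submodule ℚ (MvPolynomial (Fin m) ℚ) :=
  homogeneousSubmodule (Fin m) ℚ r ⊓ restrictDegree (Fin m) ℚ n ⊓
    Subalgebra.toSubmodule (symmetricSubalgebra (Fin m) ℚ)

namespace WSp
open MvPolynomial

lemma mem_iff {m n r : ℕ} {f : MvPolynomial (Fin m) ℚ} :
    f ∈ WSp m n r ↔ f.IsHomogeneous r ∧ f ∈ restrictDegree (Fin m) ℚ n ∧ f.IsSymmetric := by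
  simp [WSp, Submodule.mem_inf, mem_symmetricSubalgebra, mem_homogeneousSubmodule, and_assoc]

instance (m n r : ℕ) : FiniteDimensional ℚ (WSp m n r) :=
  Submodule.finiteDimensional_of_le (S₂ := restrictDegree (Fin m) ℚ n)
    (fun _ hf => (mem_iff.1 hf).2.1)

/-- lowering operator -/
noncomputable def opD (m : ℕ) : Derivation ℚ (MvPolynomial (Fin m) ℚ) (MvPolynomial (Fin m) ℚ) :=
  ∑ i, pderiv i

lemma opD_apply {m : ℕ} (f : MvPolynomial (Fin m) ℚ) : opD m f = ∑ i, pderiv i f := by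
  unfold opD
  induction (Finset.univ : Finset (Fin m)) using Finset.induction_on with
  | empty => simp
  | insert a s ha ih => rw [Finset.sum_insert ha, Finset.sum_insert ha, Derivation.add_apply, ih]

/-- raising operator -/
noncomputable def opU (m n : ℕ) : MvPolynomial (Fin m) ℚ →ₗ[ℚ] MvPolynomial (Fin m) ℚ :=
  ∑ i, ((n : ℚ) • LinearMap.mulLeft ℚ (X i) -
    (LinearMap.mulLeft ℚ (X i ^ 2)) ∘ₗ (pderiv i).toLinearMap)

lemma opU_apply {m n : ℕ} (f : MvPolynomial (Fin m) ℚ) :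
    opU m n f = ∑ i, ((n : ℚ) • (X i * f) - X i ^ 2 * pderiv i f) := by
  simp [opU, LinearMap.sum_apply]

lemma pderiv_comm' {m : ℕ} (i j : Fin m) (f : MvPolynomial (Fin m) ℚ) :
    pderiv i (pderiv j f) = pderiv j (pderiv i f) := by
  ext s
  simp only [coeff_pderiv]
  rw [add_right_comm]
  by_cases h : i = j
  · subst h; rfl
  · simp [h, Ne.symm h]; ring

lemma pderiv_U_term {m n : ℕ} (i j : Fin m) (f : MvPolynomial (Fin m) ℚ) :
    pderiv j ((n : ℚ) • (X i * f) - X i ^ 2 * pderiv i f) =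
      ((n : ℚ) • (X i * pderiv j f) - X i ^ 2 * pderiv i (pderiv j f)) +
      (if i = j then (n : ℚ) • f - (2 : ℚ) • (X i * pderiv i f) else 0) := by
  rw [map_sub, Derivation.map_smul, pderiv_mul, pderiv_mul, pderiv_pow, pderiv_comm' j i]
  by_cases h : i = j
  · subst h
    have h2 : (C 2 : MvPolynomial (Fin m) ℚ) = 2 := map_ofNat C 2
    simp [smul_eq_C_mul, h2]
    ring
  · simp [h, smul_eq_C_mul]

lemma comm {m n r : ℕ} (f : MvPolynomial (Fin m) ℚ) (hf : f.IsHomogeneous r) :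
    opD m (opU m n f) = opU m n (opD m f) + ((m : ℚ) * n - 2 * r) • f := by
  have e1 : opD m (opU m n f) = ∑ j, ∑ i,
      (((n : ℚ) • (X i * pderiv j f) - X i ^ 2 * pderiv i (pderiv j f)) +
      (if i = j then (n : ℚ) • f - (2 : ℚ) • (X i * pderiv i f) else 0)) := by
    rw [opD_apply, opU_apply]
    refine Finset.sum_congr rfl fun j _ => ?_
    rw [map_sum]
    exact Finset.sum_congr rfl fun i _ => pderiv_U_term i j f
  have e2 : opU m n (opD m f) = ∑ j, ∑ i,
      ((n : ℚ) • (X i * pderiv j f) - X i ^ 2 * pderiv i (pderiv j f)) := by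
    rw [opD_apply, map_sum]
    exact Finset.sum_congr rfl fun j _ => opU_apply _
  rw [e1, e2]
  simp only [Finset.sum_add_distrib]
  congr 1
  simp only [Finset.sum_ite_eq', Finset.mem_univ, if_true]
  rw [Finset.sum_sub_distrib, ← Finset.smul_sum, ← Finset.smul_sum, hf.sum_X_mul_pderiv]
  simp [← Nat.cast_smul_eq_nsmul ℚ, smul_smul, sub_smul, mul_comm]

lemma rename_opD {m : ℕ} (e : Equiv.Perm (Fin m)) (f : MvPolynomial (Fin m) ℚ) :
    rename e (opD m f) = opD m (rename e f) := by
  rw [opD_apply, opD_apply, map_sum, ← Equiv.sum_comp e (fun i => pderiv i (rename e f))]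
  exact Finset.sum_congr rfl fun i _ => (pderiv_rename e.injective i f).symm

lemma rename_opU {m n : ℕ} (e : Equiv.Perm (Fin m)) (f : MvPolynomial (Fin m) ℚ) :
    rename e (opU m n f) = opU m n (rename e f) := by
  rw [opU_apply, opU_apply, map_sum, ← Equiv.sum_comp e (fun i =>
    (n : ℚ) • (X i * rename e f) - X i ^ 2 * pderiv i (rename e f))]
  refine Finset.sum_congr rfl fun i _ => ?_
  rw [pderiv_rename e.injective]
  simp

lemma opU_monomial {m n : ℕ} (a : Fin m →₀ ℕ) (c : ℚ) :
    opU m n (monomial a c) = ∑ i, monomial (a + Finsupp.single i 1) (c * ((n : ℚ) - a i)) := by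
  rw [opU_apply]
  refine Finset.sum_congr rfl fun i _ => ?_
  rw [pow_two, mul_assoc, X_mul_pderiv_monomial, X, ← Nat.cast_smul_eq_nsmul ℚ, mul_smul_comm,
    monomial_mul, smul_monomial, smul_monomial, ← map_sub]
  congr 1
  · rw [add_comm]
  · simp; ring

lemma opU_deg {m n : ℕ} {f : MvPolynomial (Fin m) ℚ} (hf : f ∈ restrictDegree (Fin m) ℚ n) :
    opU m n f ∈ restrictDegree (Fin m) ℚ n := by
  classical
  rw [f.as_sum, map_sum]
  refine Submodule.sum_mem _ fun a ha => ?_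
  rw [opU_monomial]
  refine Submodule.sum_mem _ fun i _ => ?_
  have h := (mem_restrictDegree _ _ _ ).1 hf a ha
  by_cases hi : a i = n
  · simp [hi]
  · rw [mem_restrictDegree]
    intro s hs j
    have := support_monomial_subset hs
    rw [Finset.mem_singleton] at this
    subst this
    have h1 := h i
    have h2 := h j
    rw [Finsupp.add_apply, Finsupp.single_apply]
    split_ifs with hij
    · subst hij; omega
    · omega

lemma opD_deg {m n : ℕ} {f : MvPolynomial (Fin m) ℚ} (hf : f ∈ restrictDegree (Fin m) ℚ n) :
    opD m f ∈ restrictDegree (Fin m) ℚ n := by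
  classical
  rw [opD_apply]
  refine Submodule.sum_mem _ fun i _ => ?_
  rw [mem_restrictDegree] at hf ⊢
  intro s hs j
  rw [mem_support_iff, coeff_pderiv] at hs
  have := hf _ (mem_support_iff.2 (left_ne_zero_of_mul hs)) j
  rw [Finsupp.add_apply] at this
  omega

lemma opU_hom {m n r : ℕ} {f : MvPolynomial (Fin m) ℚ} (hf : f.IsHomogeneous r) :
    (opU m n f).IsHomogeneous (r + 1) := by
  classical
  rw [f.as_sum, map_sum]
  refine IsHomogeneous.sum _ _ _ fun a ha => ?_
  rw [opU_monomial]
  refine IsHomogeneous.sum _ _ _ fun i _ => ?_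
  apply isHomogeneous_monomial
  have := hf (mem_support_iff.1 ha)
  have h2 : a.degree = r := by rw [Finsupp.degree_eq_weight_one]; exact this
  rw [map_add, h2, Finsupp.degree_single]

lemma opD_hom {m r : ℕ} {f : MvPolynomial (Fin m) ℚ} (hf : f.IsHomogeneous (r + 1)) :
    (opD m f).IsHomogeneous r := by
  rw [opD_apply]
  exact IsHomogeneous.sum _ _ _ fun i _ => by simpa using hf.pderiv (i := i)

lemma opU_mem {m n r : ℕ} {f : MvPolynomial (Fin m) ℚ} (hf : f ∈ WSp m n r) :
    opU m n f ∈ WSp m n (r + 1) := by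
  rw [mem_iff] at *
  exact ⟨opU_hom hf.1, opU_deg hf.2.1, fun e => by rw [rename_opU, hf.2.2 e]⟩

lemma opD_zero {m : ℕ} {f : MvPolynomial (Fin m) ℚ} (hf : f.IsHomogeneous 0) :
    opD m f = 0 := by
  rw [← totalDegree_zero_iff_isHomogeneous, totalDegree_eq_zero_iff_eq_C] at hf
  rw [hf, opD_apply]; simp

lemma key {m n : ℕ} (r : ℕ) (f : MvPolynomial (Fin m) ℚ) (hf : f.IsHomogeneous r)
    (e : ℚ) (he : 0 < e) (hr : 2 * r ≤ m * n) (h : opU m n (opD m f) = (-e) • f) : f = 0 := by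
  induction r generalizing f e with
  | zero =>
    rw [opD_zero hf, map_zero] at h
    simpa [he.ne'] using h.symm
  | succ r ih =>
    have h1 := comm (n := n) (opD m f) (opD_hom hf)
    rw [h, Derivation.map_smul] at h1
    have hr' : (2 * (r + 1) : ℚ) ≤ m * n := by exact_mod_cast hr
    have h2 := ih (opD m f) (opD_hom hf) (e + ((m : ℚ) * n - 2 * r)) (by linarith) (by omega) (by
      rw [neg_add, add_smul, h1, neg_smul ((m : ℚ) * n - 2 * r)]; abel)
    rw [h2, map_zero] at h
    simpa [he.ne'] using h.symm

lemma finrank_lt {m n r : ℕ} (hr : 2 * r < m * n) (f : MvPolynomial (Fin m) ℚ)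
    (hf : f ∈ WSp m n (r + 1)) (hf0 : f ≠ 0) (hD : opD m f = 0) :
    Module.finrank ℚ (WSp m n r) < Module.finrank ℚ (WSp m n (r + 1)) := by
  let L : WSp m n r →ₗ[ℚ] WSp m n (r + 1) :=
    (opU m n).restrict (fun x hx => opU_mem hx)
  have hDU : ∀ g ∈ WSp m n r, opD m (opU m n g) = 0 → g = 0 := by
    intro g hg h
    have hg' := (mem_iff.1 hg).1
    rw [comm g hg'] at h
    have hr' : (2 * r : ℚ) < m * n := by exact_mod_cast hr
    refine key (n := n) r g hg' ((m : ℚ) * n - 2 * r) (by linarith) hr.le ?_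
    rw [neg_smul]; exact eq_neg_of_add_eq_zero_left h
  have hinj : Function.Injective L := by
    rw [← LinearMap.ker_eq_bot, LinearMap.ker_eq_bot']
    intro g hg
    have h0 : opU m n g = 0 := congrArg Subtype.val hg
    exact Subtype.ext (hDU g g.2 (by rw [h0, map_zero]))
  rw [← LinearMap.finrank_range_of_inj hinj]
  apply Submodule.finrank_lt
  intro htop
  have : (⟨f, hf⟩ : WSp m n (r + 1)) ∈ LinearMap.range L := htop ▸ Submodule.mem_top
  obtain ⟨g, hg⟩ := this
  have h0 : opU m n g = f := congrArg Subtype.val hg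
  have := hDU g g.2 (by rw [h0, hD])
  rw [this, map_zero] at h0
  exact hf0 h0.symm

end WSp

namespace WSp
open MvPolynomial

/-- exponent vector of a tuple -/
noncomputable def toF {m n : ℕ} (a : Fin m → Fin (n + 1)) : Fin m →₀ ℕ :=
  Finsupp.equivFunOnFinite.symm (fun i => (a i : ℕ))

lemma toF_apply {m n : ℕ} (a : Fin m → Fin (n + 1)) (i : Fin m) : toF a i = a i := rfl

lemma toF_inj {m n : ℕ} {a b : Fin m → Fin (n + 1)} (h : toF a = toF b) : a = b := by
  funext i
  exact Fin.ext (by rw [← toF_apply, h, toF_apply])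

lemma toF_degree {m n : ℕ} (a : Fin m → Fin (n + 1)) : (toF a).degree = ∑ i, (a i : ℕ) := by
  rw [Finsupp.degree_eq_sum]; rfl

lemma mapDomain_toF {m n : ℕ} (a : Fin m → Fin (n + 1)) (e : Equiv.Perm (Fin m)) :
    (toF (a ∘ e)).mapDomain e = toF a := by
  ext i
  rw [Finsupp.mapDomain_equiv_apply]
  simp [toF_apply]

/-- decreasing rearrangement -/
def srt {m n : ℕ} (a : Fin m → Fin (n + 1)) : Fin m → Fin (n + 1) :=
  a ∘ ((Fin.revPerm.trans (Tuple.sort a) : Equiv.Perm (Fin m)))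

lemma srt_eq {m n : ℕ} (a : Fin m → Fin (n + 1)) : srt a = (a ∘ Tuple.sort a) ∘ Fin.rev := rfl

lemma srt_anti {m n : ℕ} (a : Fin m → Fin (n + 1)) (i j : Fin m) (h : i ≤ j) :
    srt a j ≤ srt a i := by
  rw [srt_eq]
  exact Tuple.monotone_sort a (Fin.rev_le_rev.2 h)

lemma srt_perm {m n : ℕ} (a : Fin m → Fin (n + 1)) (e : Equiv.Perm (Fin m)) :
    srt (a ∘ e) = srt a := by
  rw [srt_eq, srt_eq, Tuple.comp_perm_comp_sort_eq_comp_sort]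

lemma srt_of_anti {m n : ℕ} (a : Fin m → Fin (n + 1)) (h : ∀ i j : Fin m, i ≤ j → a j ≤ a i) :
    srt a = a := by
  have h1 : Monotone (a ∘ (Fin.revPerm : Equiv.Perm (Fin m))) := fun i j hij =>
    h _ _ (Fin.rev_le_rev.2 hij)
  have h2 := Tuple.unique_monotone (Tuple.monotone_sort a) h1
  rw [srt_eq, h2]
  funext i; simp

lemma srt_sum {m n : ℕ} (a : Fin m → Fin (n + 1)) : ∑ i, (srt a i : ℕ) = ∑ i, (a i : ℕ) :=
  Equiv.sum_comp (Fin.revPerm.trans (Tuple.sort a) : Equiv.Perm (Fin m)) (fun i => (a i : ℕ))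

/-- index set -/
def idx (m n r : ℕ) : Finset (Fin m → Fin (n + 1)) :=
  Finset.univ.filter fun f : Fin m → Fin (n + 1) =>
    (∀ i j : Fin m, i ≤ j → f j ≤ f i) ∧ ∑ i, (f i : ℕ) = r

lemma mem_idx {m n r : ℕ} {f : Fin m → Fin (n + 1)} : f ∈ idx m n r ↔
    (∀ i j : Fin m, i ≤ j → f j ≤ f i) ∧ ∑ i, (f i : ℕ) = r := by
  simp [idx]

/-- coefficient map -/
noncomputable def cf (m n r : ℕ) : WSp m n r →ₗ[ℚ] (idx m n r → ℚ) :=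
  LinearMap.pi fun a => (lcoeff ℚ (toF a.1)) ∘ₗ (WSp m n r).subtype

lemma cf_apply {m n r : ℕ} (f : WSp m n r) (a : idx m n r) :
    cf m n r f a = coeff (toF a.1) f.1 := rfl

lemma coeff_symm {m n : ℕ} {f : MvPolynomial (Fin m) ℚ} (hf : f.IsSymmetric)
    (a : Fin m → Fin (n + 1)) (e : Equiv.Perm (Fin m)) :
    coeff (toF (a ∘ e)) f = coeff (toF a) f := by
  rw [← coeff_rename_mapDomain e e.injective, hf e, mapDomain_toF]

lemma cf_inj (m n r : ℕ) : Function.Injective (cf m n r) := by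
  rw [← LinearMap.ker_eq_bot, LinearMap.ker_eq_bot']
  rintro ⟨f, hf⟩ h
  obtain ⟨h1, h2, h3⟩ := mem_iff.1 hf
  apply Subtype.ext
  change f = 0
  by_contra hne
  obtain ⟨s, hs⟩ := ne_zero_iff.1 hne
  have hsn := (mem_restrictDegree _ _ _).1 h2 s (mem_support_iff.2 hs)
  let a : Fin m → Fin (n + 1) := fun i => ⟨s i, Nat.lt_succ_of_le (hsn i)⟩
  have ha : toF a = s := by ext i; rfl
  have hdeg : s.degree = r := by rw [Finsupp.degree_eq_weight_one]; exact h1 hs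
  have hmem : srt a ∈ idx m n r := mem_idx.2 ⟨srt_anti a, by
    rw [srt_sum, ← toF_degree, ha, hdeg]⟩
  have := congrFun h ⟨srt a, hmem⟩
  rw [cf_apply] at this
  change coeff (toF (a ∘ _)) f = 0 at this
  rw [coeff_symm h3, ha] at this
  exact hs this

open Classical in
/-- symmetric extension of a coefficient function -/
noncomputable def psi {m n r : ℕ} (φ : idx m n r → ℚ) (b : Fin m → Fin (n + 1)) : ℚ :=
  if h : srt b ∈ idx m n r then φ ⟨srt b, h⟩ else 0

lemma psi_perm {m n r : ℕ} (φ : idx m n r → ℚ) (b : Fin m → Fin (n + 1))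
    (e : Equiv.Perm (Fin m)) : psi φ (b ∘ e) = psi φ b := by
  unfold psi
  simp only [srt_perm]

lemma cf_surj (m n r : ℕ) : Function.Surjective (cf m n r) := by
  classical
  intro φ
  let f : MvPolynomial (Fin m) ℚ := ∑ b : Fin m → Fin (n + 1), monomial (toF b) (psi φ b)
  have hf : f ∈ WSp m n r := by
    rw [mem_iff]
    refine ⟨?_, ?_, ?_⟩
    · refine IsHomogeneous.sum _ _ _ fun b _ => ?_
      by_cases hb : srt b ∈ idx m n r
      · apply isHomogeneous_monomial
        rw [toF_degree, ← srt_sum]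
        exact (mem_idx.1 hb).2
      · have : psi φ b = 0 := by unfold psi; rw [dif_neg hb]
        rw [this, map_zero]
        exact isHomogeneous_zero _ _ _
    · refine Submodule.sum_mem _ fun b _ => ?_
      rw [mem_restrictDegree]
      intro s hs j
      have := support_monomial_subset hs
      rw [Finset.mem_singleton] at this
      subst this
      rw [toF_apply]
      exact Nat.le_of_lt_succ (b j).2
    · intro e
      change rename e (∑ b, _) = ∑ b, _
      rw [map_sum, ← Equiv.sum_comp (Equiv.arrowCongr e.symm (Equiv.refl (Fin (n + 1))))]
      refine Finset.sum_congr rfl fun b _ => ?_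
      have : (Equiv.arrowCongr e.symm (Equiv.refl (Fin (n + 1)))) b = b ∘ e := by
        funext i; simp
      rw [this, rename_monomial, mapDomain_toF, psi_perm]
  refine ⟨⟨f, hf⟩, ?_⟩
  funext a
  rw [cf_apply]
  change coeff _ (∑ b, _) = _
  rw [coeff_sum, Finset.sum_eq_single a.1]
  · rw [coeff_monomial, if_pos rfl]
    unfold psi
    have h1 := srt_of_anti a.1 (mem_idx.1 a.2).1
    have h2 : srt a.1 ∈ idx m n r := by rw [h1]; exact a.2
    rw [dif_pos h2]
    congr 1
    exact Subtype.ext h1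
  · intro b _ hb
    rw [coeff_monomial, if_neg]
    exact fun h => hb (toF_inj h)
  · simp

lemma finrank_eq (m n r : ℕ) : Module.finrank ℚ (WSp m n r) = gaussP m n r := by
  rw [(LinearEquiv.ofBijective (cf m n r) ⟨cf_inj m n r, cf_surj m n r⟩).finrank_eq,
    Module.finrank_fintype_fun_eq_card, Fintype.card_coe]
  rfl

/-- the main criterion -/
lemma criterion {m n r : ℕ} (hr : 2 * r < m * n) (P : MvPolynomial (Fin m) ℚ)
    (hP : P.IsHomogeneous (r + 1)) (hdeg : ∀ v, degreeOf v P ≤ n) (hD : opD m P = 0)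
    (x : Fin m → ℚ) (hx : ∀ e : Equiv.Perm (Fin m), 0 < eval (x ∘ e) P) :
    gaussP m n r < gaussP m n (r + 1) := by
  classical
  rw [← finrank_eq, ← finrank_eq]
  let f : MvPolynomial (Fin m) ℚ := ∑ e : Equiv.Perm (Fin m), rename e P
  refine finrank_lt hr f (mem_iff.2 ⟨?_, ?_, ?_⟩) ?_ ?_
  · exact IsHomogeneous.sum _ _ _ fun e _ => hP.rename_isHomogeneous
  · refine Submodule.sum_mem _ fun e _ => ?_
    rw [mem_restrictDegree]
    intro s hs i
    have h1 := hdeg (e.symm i)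
    rw [← degreeOf_rename_of_injective e.injective, Equiv.apply_symm_apply] at h1
    exact degreeOf_le_iff.1 h1 s hs
  · intro e
    change rename e (∑ b, _) = ∑ b, _
    rw [map_sum]
    refine Fintype.sum_equiv (Equiv.mulLeft e) _ _ fun σ => ?_
    rw [rename_rename]
    rfl
  · intro h0
    have h1 : eval x f = 0 := by rw [h0, map_zero]
    have h2 : eval x f = ∑ e : Equiv.Perm (Fin m), eval (x ∘ e) P := by
      change eval x (∑ b, _) = _
      rw [map_sum]
      exact Finset.sum_congr rfl fun e _ => eval_rename _ _ _
    rw [h2] at h1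
    have := Finset.sum_pos (s := Finset.univ) (fun e _ => hx e) Finset.univ_nonempty
    linarith
  · change opD m (∑ b, _) = _
    rw [map_sum]
    refine Finset.sum_eq_zero fun e _ => ?_
    rw [← rename_opD, hD, map_zero]

end WSp

namespace WSp
open MvPolynomial

/-- vertex -/
def vx {m : ℕ} (hm : 0 < m) (u : ℕ) : Fin m := ⟨u % m, Nat.mod_lt _ hm⟩

/-- indicator -/
def ind (m v u : ℕ) : ℕ := if u % m = v then 1 else 0

lemma sum_ind_le (m d v r : ℕ) (hr : r ≤ m * d) : ∑ u ∈ Finset.range r, ind m v u ≤ d := by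
  unfold ind
  rw [← Finset.card_filter]
  calc _ ≤ (Finset.range d).card := by
        refine Finset.card_le_card_of_injOn (fun u => u / m) ?_ ?_
        · intro u hu
          simp only [Finset.coe_filter, Finset.mem_range, Set.mem_ofPred_eq, Finset.coe_range, Set.mem_Iio] at hu ⊢
          exact Nat.div_lt_of_lt_mul (by omega)
        · intro a ha b hb hab
          simp only [Finset.coe_filter, Finset.mem_range, Set.mem_ofPred_eq] at ha hb hab
          rw [← Nat.div_add_mod a m, ← Nat.div_add_mod b m, hab, ha.2, hb.2]
    _ = d := Finset.card_range d

lemma sum_stub (f : ℕ → ℕ) (c s : ℕ) : ∑ u ∈ Finset.range c, f u +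
    ∑ t ∈ Finset.range s, (f (c + 2 * t) + f (c + 2 * t + 1)) =
      ∑ u ∈ Finset.range (c + 2 * s), f u := by
  induction s with
  | zero => simp
  | succ s ih =>
    rw [Finset.sum_range_succ, ← add_assoc, ih, show c + 2 * (s + 1) = c + 2 * s + 1 + 1 by ring,
      Finset.sum_range_succ, Finset.sum_range_succ]
    ring

/-- product of squared differences -/
noncomputable def sq {m : ℕ} (hm : 0 < m) (c s : ℕ) : MvPolynomial (Fin m) ℚ :=
  ∏ t ∈ Finset.range s, (X (vx hm (c + 2 * t)) - X (vx hm (c + 2 * t + 1))) ^ 2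

lemma degX {m : ℕ} (hm : 0 < m) (v : Fin m) (u : ℕ) :
    degreeOf v (X (vx hm u) : MvPolynomial (Fin m) ℚ) = ind m v u := by
  classical
  rw [degreeOf_X]
  unfold ind vx
  simp only [Fin.ext_iff]
  split_ifs <;> first | rfl | omega

lemma sq_deg {m : ℕ} (hm : 0 < m) (c s : ℕ) (v : Fin m) : degreeOf v (sq hm c s) ≤
    2 * ∑ t ∈ Finset.range s, (ind m v (c + 2 * t) + ind m v (c + 2 * t + 1)) := by
  unfold sq
  refine (degreeOf_prod_le _ _ _).trans ?_
  rw [Finset.mul_sum]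
  refine Finset.sum_le_sum fun t _ => (degreeOf_pow_le _ _ _).trans ?_
  refine Nat.mul_le_mul_left _ ((degreeOf_sub_le _ _ _).trans ?_)
  rw [degX, degX]
  omega

lemma sq_hom {m : ℕ} (hm : 0 < m) (c s : ℕ) : (sq hm c s).IsHomogeneous (2 * s) := by
  unfold sq
  have := IsHomogeneous.prod (Finset.range s)
    (fun t => ((X (vx hm (c + 2 * t)) - X (vx hm (c + 2 * t + 1))) ^ 2 : MvPolynomial (Fin m) ℚ))
    (fun _ => 2) (fun t _ => by
      simpa using (((isHomogeneous_X ℚ (vx hm (c + 2 * t))).sub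
        (isHomogeneous_X ℚ (vx hm (c + 2 * t + 1)))).pow 2))
  simpa [mul_comm] using this

lemma opD_X {m : ℕ} (v : Fin m) : opD m (X v) = 1 := by
  classical
  rw [opD_apply]
  simp [Pi.single_apply]

lemma opD_mul {m : ℕ} {f g : MvPolynomial (Fin m) ℚ} (hf : opD m f = 0) (hg : opD m g = 0) :
    opD m (f * g) = 0 := by
  rw [Derivation.leibniz, hf, hg]; simp

lemma sq_D {m : ℕ} (hm : 0 < m) (c s : ℕ) : opD m (sq hm c s) = 0 := by
  unfold sq
  induction s with
  | zero => simp
  | succ s ih =>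
    rw [Finset.prod_range_succ]
    have h : opD m (X (vx hm (c + 2 * s)) - X (vx hm (c + 2 * s + 1))) = 0 := by
      rw [map_sub, opD_X, opD_X, sub_self]
    rw [pow_two]
    exact opD_mul ih (opD_mul h h)

lemma vx_ne {m : ℕ} (hm : 0 < m) (a b : ℕ) (hab : a < b) (hb : b < a + m) :
    vx hm a ≠ vx hm b := by
  intro h
  have h' : a ≡ b [MOD m] := congrArg Fin.val h
  have := (Nat.modEq_iff_dvd' hab.le).1 h'
  have := Nat.le_of_dvd (by omega) this
  omega

lemma sq_pos {m : ℕ} (hm : 2 ≤ m) (c s : ℕ) (y : Fin m → ℚ) (hy : Function.Injective y) :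
    0 < eval y (sq (by omega : 0 < m) c s) := by
  unfold sq
  rw [map_prod]
  refine Finset.prod_pos fun t _ => ?_
  rw [map_pow, map_sub, eval_X, eval_X]
  refine pow_two_pos_of_ne_zero (sub_ne_zero.2 fun h => ?_)
  exact vx_ne (by omega) _ _ (by omega) (by omega) (hy h)

/-- cubic seminvariant -/
noncomputable def cub {m : ℕ} (hm : 0 < m) : MvPolynomial (Fin m) ℚ :=
  ((X (vx hm 2) - X (vx hm 0)) + (X (vx hm 2) - X (vx hm 1))) *
  ((X (vx hm 1) - X (vx hm 0)) + (X (vx hm 2) - X (vx hm 0))) *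
  ((X (vx hm 0) - X (vx hm 1)) + (X (vx hm 2) - X (vx hm 1)))

lemma lin_deg {m : ℕ} (hm : 0 < m) (v : Fin m) (a b c d : ℕ) (ha : a < 3) (hb : b < 3)
    (hc : c < 3) (hd : d < 3) :
    degreeOf v ((X (vx hm a) - X (vx hm b)) + (X (vx hm c) - X (vx hm d)) :
      MvPolynomial (Fin m) ℚ) ≤ max (ind m v 0) (max (ind m v 1) (ind m v 2)) := by
  refine (degreeOf_add_le _ _ _).trans (max_le ?_ ?_) <;>
  · refine (degreeOf_sub_le _ _ _).trans ?_
    rw [degX, degX]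
    interval_cases a <;> interval_cases b <;> interval_cases c <;> interval_cases d <;> omega

lemma cub_deg {m : ℕ} (hm : 0 < m) (v : Fin m) : degreeOf v (cub hm) ≤
    1 + 2 * ∑ u ∈ Finset.range 3, ind m v u := by
  have h1 := lin_deg hm v 2 0 2 1 (by omega) (by omega) (by omega) (by omega)
  have h2 := lin_deg hm v 1 0 2 0 (by omega) (by omega) (by omega) (by omega)
  have h3 := lin_deg hm v 0 1 2 1 (by omega) (by omega) (by omega) (by omega)
  have h4 : degreeOf v (cub hm) ≤ _ := (degreeOf_mul_le v _ _).trans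
    (add_le_add ((degreeOf_mul_le v _ _).trans (add_le_add h1 h2)) h3)
  refine h4.trans ?_
  simp only [Finset.sum_range_succ, Finset.sum_range_zero]
  unfold ind
  split_ifs <;> simp

lemma lin_hom {m : ℕ} (hm : 0 < m) (a b c d : ℕ) :
    ((X (vx hm a) - X (vx hm b)) + (X (vx hm c) - X (vx hm d)) :
      MvPolynomial (Fin m) ℚ).IsHomogeneous 1 :=
  ((isHomogeneous_X _ _).sub (isHomogeneous_X _ _)).add
    ((isHomogeneous_X _ _).sub (isHomogeneous_X _ _))

lemma cub_hom {m : ℕ} (hm : 0 < m) : (cub hm).IsHomogeneous 3 :=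
  ((lin_hom hm 2 0 2 1).mul (lin_hom hm 1 0 2 0)).mul (lin_hom hm 0 1 2 1)

lemma cub_D {m : ℕ} (hm : 0 < m) : opD m (cub hm) = 0 := by
  unfold cub
  refine opD_mul (opD_mul ?_ ?_) ?_ <;> simp [opD_X]

/-- cubic form -/
def cb (x y z : ℚ) : ℚ := (z - x + (z - y)) * (y - x + (z - x)) * (x - y + (z - y))

lemma cb_pos_aux {p q s : ℕ} (h1 : p < q) (h2 : q < s) : 0 < cb (3 ^ p) (3 ^ q) (3 ^ s) := by
  have hp : (0 : ℚ) < 3 ^ p := by positivity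
  have a1 : (3 : ℚ) ^ (p + 1) ≤ 3 ^ q := pow_le_pow_right₀ (by norm_num) h1
  have a2 : (3 : ℚ) ^ (q + 1) ≤ 3 ^ s := pow_le_pow_right₀ (by norm_num) h2
  rw [pow_succ] at a1 a2
  unfold cb
  refine mul_pos (mul_pos ?_ ?_) ?_ <;> linarith

lemma cb_pos {p q s : ℕ} (h1 : p ≠ q) (h2 : q ≠ s) (h3 : p ≠ s) :
    0 < cb (3 ^ p) (3 ^ q) (3 ^ s) := by
  have c1 : ∀ x y z, cb x y z = cb y x z := fun x y z => by unfold cb; ring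
  have c2 : ∀ x y z, cb x y z = cb x z y := fun x y z => by unfold cb; ring
  rcases lt_or_gt_of_ne h1 with h1 | h1 <;> rcases lt_or_gt_of_ne h2 with h2 | h2 <;>
    rcases lt_or_gt_of_ne h3 with h3 | h3
  · exact cb_pos_aux h1 h2
  · omega
  · rw [c2]; exact cb_pos_aux h3 h2
  · rw [c2, c1]; exact cb_pos_aux h3 h1
  · rw [c1]; exact cb_pos_aux h1 h3
  · rw [c1, c2]; exact cb_pos_aux h2 h3
  · omega
  · rw [c1, c2, c1]; exact cb_pos_aux h2 h1

lemma pow_inj {m : ℕ} : Function.Injective (fun i : Fin m => (3 : ℚ) ^ (i : ℕ)) := by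
  intro a b h
  exact Fin.ext (pow_right_injective₀ (by norm_num) (by norm_num) h)

end WSp

theorem stmt16 (m d0 d1 r : ℕ) (hm : 2 ≤ m) (h0 : 0 < d0) (h1 : 0 < d1)
    (hr1 : 2 * d1 ≤ r) (hr2 : r ≤ m * d1) :
    gaussP m (d0 + 2 * d1) (r - 1) < gaussP m (d0 + 2 * d1) r := by
  obtain ⟨k, rfl⟩ : ∃ k, r = k + 1 := ⟨r - 1, by omega⟩
  have hm0 : 0 < m := by omega
  have hlt : 2 * k < m * (d0 + 2 * d1) := by
    have : m * (d0 + 2 * d1) = m * d0 + 2 * (m * d1) := by ring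
    omega
  rw [Nat.add_sub_cancel]
  have hinj : ∀ e : Equiv.Perm (Fin m),
      Function.Injective ((fun i : Fin m => (3 : ℚ) ^ (i : ℕ)) ∘ e) :=
    fun e => WSp.pow_inj.comp e.injective
  have hcount : ∀ v : Fin m, _ := fun v => WSp.sum_ind_le m d1 v (k + 1) hr2
  rcases Nat.even_or_odd' (k + 1) with ⟨s, hs | hs⟩
  · refine WSp.criterion hlt (WSp.sq hm0 0 s) (hs ▸ WSp.sq_hom hm0 0 s) (fun v => ?_)
      (WSp.sq_D hm0 0 s) (fun i => (3 : ℚ) ^ (i : ℕ)) (fun e => WSp.sq_pos hm 0 s _ (hinj e))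
    have a := WSp.sq_deg hm0 0 s v
    have b := WSp.sum_stub (WSp.ind m v) 0 s
    have c := hcount v
    rw [hs] at c
    simp only [Finset.sum_range_zero, zero_add] at a b
    omega
  · have hm3 : 3 ≤ m := by
      by_contra h
      have : m = 2 := by omega
      subst this
      omega
    obtain ⟨s, rfl⟩ : ∃ t, s = t + 1 := ⟨s - 1, by omega⟩
    have hs' : k + 1 = 3 + 2 * s := by omega
    refine WSp.criterion hlt (WSp.cub hm0 * WSp.sq hm0 3 s)
      (hs' ▸ (WSp.cub_hom hm0).mul (WSp.sq_hom hm0 3 s)) (fun v => ?_)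
      (WSp.opD_mul (WSp.cub_D hm0) (WSp.sq_D hm0 3 s)) (fun i => (3 : ℚ) ^ (i : ℕ)) (fun e => ?_)
    · have a := WSp.sq_deg hm0 3 s v
      have b := WSp.sum_stub (WSp.ind m v) 3 s
      have c := hcount v
      have d := WSp.cub_deg hm0 v
      have e := MvPolynomial.degreeOf_mul_le v (WSp.cub hm0) (WSp.sq hm0 3 s)
      rw [hs'] at c
      omega
    · rw [map_mul]
      refine mul_pos ?_ (WSp.sq_pos hm 3 s _ (hinj e))
      have hne : ∀ a b : ℕ, a < b → b < 3 → (e (WSp.vx hm0 a) : ℕ) ≠ e (WSp.vx hm0 b) := by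
        intro a b hab hb h
        exact WSp.vx_ne hm0 a b hab (by omega) (e.injective (Fin.ext h))
      have := WSp.cb_pos (hne 0 1 (by omega) (by omega)) (hne 1 2 (by omega) (by omega))
        (hne 0 2 (by omega) (by omega))
      simpa [WSp.cub, WSp.cb] using this
end

section
/- Let m ≥ 4 be an integer and let d_0, d_1, d_2 be positive integers with n = d_0 + 2d_1 + 3d_2 and m·d_0 ≤ (m−4)·d_2 + 1. Then p_r(m,n) > p_{r−1}(m,n) for every integer r with 2d_1 + 6d_2 ≤ r and 2r ≤ mn. -/
namespace KOH

/-- Multisets of `m` naturals, each at most `n`, with sum `r`. -/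
def W (m n r : ℕ) : Set (Multiset ℕ) :=
  {s | s.card = m ∧ s.sum = r ∧ ∀ x ∈ s, x ≤ n}

/-- The number of such multisets. -/
noncomputable def w (m n r : ℕ) : ℕ := (W m n r).ncard

/-- The multiset of values of a function. -/
def toMS {m n : ℕ} (f : Fin m → Fin (n + 1)) : Multiset ℕ :=
  ((List.ofFn fun i => (f i : ℕ)) : Multiset ℕ)

lemma toMS_image (m n r : ℕ) :
    Set.image toMS (↑(Finset.univ.filter fun f : Fin m → Fin (n + 1) =>
    (∀ i j : Fin m, i ≤ j → f j ≤ f i) ∧ ∑ i, (f i : ℕ) = r) : Set (Fin m → Fin (n + 1)))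
      = W m n r := by
  ext s
  constructor
  · rintro ⟨f, hf, rfl⟩
    simp only [Finset.coe_filter, Finset.mem_univ, true_and, Set.mem_ofPred_eq] at hf
    refine ⟨by simp [toMS], ?_, ?_⟩
    · simp [toMS, List.sum_ofFn, hf.2]
    · intro x hx
      simp only [toMS, Multiset.mem_coe, List.mem_ofFn] at hx
      obtain ⟨i, rfl⟩ := hx
      exact Nat.lt_succ_iff.mp (f i).2
  · rintro ⟨hc, hs, hb⟩
    have hl : (s.sort (· ≥ ·)).length = m := by simp [hc]
    have hmem : ∀ i : Fin m, (s.sort (· ≥ ·)).get (i.cast hl.symm) < n + 1 := by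
      intro i
      have : (s.sort (· ≥ ·)).get (i.cast hl.symm) ∈ s := by
        rw [← Multiset.mem_sort (r := (· ≥ ·))]
        exact List.get_mem _ _
      exact Nat.lt_succ_iff.mpr (hb _ this)
    have key : toMS (fun i : Fin m => (⟨_, hmem i⟩ : Fin (n + 1))) = s := by
      conv_rhs => rw [← Multiset.sort_eq s (· ≥ ·)]
      unfold toMS
      congr 1
      apply List.ext_get
      · simp [hc]
      · intro k h1 h2
        simp
    refine ⟨fun i => ⟨_, hmem i⟩, ?_, key⟩
    simp only [Finset.coe_filter, Finset.mem_univ, true_and, Set.mem_ofPred_eq]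
    constructor
    · intro i j hij
      have := Multiset.pairwise_sort s (· ≥ ·)
      rw [Fin.mk_le_mk]
      rcases hij.eq_or_lt with rfl | h
      · exact le_rfl
      · exact (List.pairwise_iff_get.mp this) _ _ h
    · have := congrArg Multiset.sum key
      rw [hs] at this
      rw [← this]
      simp [toMS, List.sum_ofFn]

lemma toMS_injOn (m n r : ℕ) :
    Set.InjOn toMS (↑(Finset.univ.filter fun f : Fin m → Fin (n + 1) =>
    (∀ i j : Fin m, i ≤ j → f j ≤ f i) ∧ ∑ i, (f i : ℕ) = r) : Set (Fin m → Fin (n + 1))) := by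
  intro f hf g hg h
  simp only [Finset.coe_filter, Finset.mem_univ, true_and, Set.mem_ofPred_eq] at hf hg
  have hp := Multiset.coe_eq_coe.mp h
  have pw : ∀ f : Fin m → Fin (n + 1), (∀ i j : Fin m, i ≤ j → f j ≤ f i) →
      (List.ofFn fun i => (f i : ℕ)).Pairwise (· ≥ ·) := by
    intro f hf
    rw [List.pairwise_ofFn]
    intro i j hij
    exact hf i j hij.le
  have := hp.eq_of_pairwise' (pw f hf.1) (pw g hg.1)
  have := List.ofFn_injective this
  funext i
  exact Fin.ext (congrFun this i)

lemma W_finite (m n r : ℕ) : (W m n r).Finite := by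
  rw [← toMS_image]; exact (Finset.finite_toSet _).image _

lemma gaussP_eq (m n r : ℕ) : gaussP m n r = w m n r := by
  rw [w, ← toMS_image, (toMS_injOn m n r).ncard_image, Set.ncard_coe_finset, gaussP]

lemma w_zero_left (n r : ℕ) : w 0 n r = if r = 0 then 1 else 0 := by
  split_ifs with h
  · subst h
    rw [w, Set.ncard_eq_one]
    refine ⟨0, ?_⟩
    ext s
    simp only [W, Set.mem_ofPred_eq, Multiset.card_eq_zero, Set.mem_singleton_iff]
    constructor
    · exact fun h => h.1
    · rintro rfl; simp
  · rw [w, Set.ncard_eq_zero (W_finite _ _ _)]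
    ext s
    simp only [W, Set.mem_ofPred_eq, Multiset.card_eq_zero, Set.mem_empty_iff_false, iff_false]
    rintro ⟨rfl, h', -⟩
    exact h (by simpa using h'.symm)

lemma w_zero_right (m r : ℕ) : w m 0 r = if r = 0 then 1 else 0 := by
  have hh : ∀ s : Multiset ℕ, (∀ x ∈ s, x ≤ 0) → s = Multiset.replicate s.card 0 := by
    intro s hs
    exact Multiset.eq_replicate_card.mpr fun x hx => Nat.le_zero.mp (hs x hx)
  split_ifs with h
  · subst h
    rw [w, Set.ncard_eq_one]
    refine ⟨Multiset.replicate m 0, ?_⟩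
    ext s
    simp only [W, Set.mem_ofPred_eq, Set.mem_singleton_iff]
    constructor
    · rintro ⟨h1, h2, h3⟩
      rw [← h1]; exact hh s h3
    · rintro rfl
      refine ⟨by simp, by simp, ?_⟩
      intro x hx
      rw [Multiset.eq_of_mem_replicate hx]
  · rw [w, Set.ncard_eq_zero (W_finite _ _ _)]
    ext s
    simp only [W, Set.mem_ofPred_eq, Set.mem_empty_iff_false, iff_false]
    rintro ⟨h1, h2, h3⟩
    rw [hh s h3] at h2
    exact h (by simpa using h2.symm)

lemma w_succ (m n r : ℕ) : w (m + 1) (n + 1) r =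
    w (m + 1) n r + if n + 1 ≤ r then w m (n + 1) (r - (n + 1)) else 0 := by
  have hU : W (m + 1) (n + 1) r = W (m + 1) n r ∪
      (if n + 1 ≤ r then Set.image (Multiset.cons (n + 1)) (W m (n + 1) (r - (n + 1))) else ∅) := by
    ext s
    constructor
    · rintro ⟨h1, h2, h3⟩
      by_cases hs : n + 1 ∈ s
      · right
        obtain ⟨t, rfl⟩ := Multiset.exists_cons_of_mem hs
        simp only [Multiset.sum_cons, Multiset.card_cons] at h1 h2
        rw [if_pos (by omega)]
        exact ⟨t, ⟨by omega, by omega, fun x hx => h3 x (Multiset.mem_cons_of_mem hx)⟩, rfl⟩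
      · left
        refine ⟨h1, h2, fun x hx => ?_⟩
        have := h3 x hx
        have : x ≠ n + 1 := fun h => hs (h ▸ hx)
        omega
    · rintro (⟨h1, h2, h3⟩ | h)
      · exact ⟨h1, h2, fun x hx => (h3 x hx).trans (Nat.le_succ n)⟩
      · split_ifs at h with hr
        · obtain ⟨t, ⟨h1, h2, h3⟩, rfl⟩ := h
          refine ⟨by simp [h1], by simp [h2]; omega, ?_⟩
          intro x hx
          rcases Multiset.mem_cons.mp hx with rfl | hx
          · exact le_rfl
          · exact h3 x hx
        · exact absurd h (Set.notMem_empty _)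
  have hd : Disjoint (W (m + 1) n r)
      (if n + 1 ≤ r then Set.image (Multiset.cons (n + 1)) (W m (n + 1) (r - (n + 1))) else ∅) := by
    rw [Set.disjoint_left]
    rintro s ⟨h1, h2, h3⟩ h
    split_ifs at h with hr
    · obtain ⟨t, -, rfl⟩ := h
      have := h3 (n + 1) (Multiset.mem_cons_self _ _)
      omega
    · exact absurd h (Set.notMem_empty _)
  have hf : (if n + 1 ≤ r then Set.image (Multiset.cons (n + 1)) (W m (n + 1) (r - (n + 1)))
      else ∅ : Set (Multiset ℕ)).Finite := by
    split_ifs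
    · exact (W_finite _ _ _).image _
    · exact Set.finite_empty
  rw [w, hU, Set.ncard_union_eq hd (W_finite _ _ _) hf]
  congr 1
  split_ifs
  · rw [Set.ncard_image_of_injective _ (fun a b h => (Multiset.cons_inj_right _).mp h), w]
  · simp

/-- Generating function. -/
noncomputable def G (m n : ℕ) : PowerSeries ℤ := PowerSeries.mk fun r => (w m n r : ℤ)

lemma G_zero_left (n : ℕ) : G 0 n = 1 := by
  ext r
  simp [G, w_zero_left, PowerSeries.coeff_one]

lemma G_zero_right (m : ℕ) : G m 0 = 1 := by
  ext r
  simp [G, w_zero_right, PowerSeries.coeff_one]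

lemma G_succ (m n : ℕ) : G (m + 1) (n + 1) = G (m + 1) n + PowerSeries.X ^ (n + 1) * G m (n + 1) := by
  ext r
  rw [map_add, PowerSeries.coeff_X_pow_mul']
  simp only [G, PowerSeries.coeff_mk, w_succ]
  split_ifs <;> simp

lemma G_succ' : ∀ k m n : ℕ, m + n = k → G (m + 1) (n + 1) =
    G m (n + 1) + PowerSeries.X ^ (m + 1) * G (m + 1) n := by
  intro k
  induction k with
  | zero =>
    intro m n h
    obtain ⟨rfl, rfl⟩ : m = 0 ∧ n = 0 := by omega
    rw [G_succ]
    simp only [G_zero_left, G_zero_right]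
  | succ k ih =>
    intro m n h
    rcases m with _ | m
    · rcases n with _ | n
      · omega
      · have a := G_succ 0 (n + 1)
        have b := G_succ 0 n
        have c := ih 0 n (by omega)
        simp only [G_zero_left, zero_add] at *
        linear_combination a + c - PowerSeries.X * b
    · rcases n with _ | n
      · rw [G_succ]
        have h3 := ih m 0 (by omega)
        have h4 := G_succ m 0
        simp only [G_zero_right, zero_add] at *
        linear_combination PowerSeries.X * h3 - h4
      · have a := G_succ (m + 1) (n + 1)
        have b := ih (m + 1) n (by omega)
        have c := ih m (n + 1) (by omega)
        have d := G_succ m (n + 1)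
        have e := G_succ (m + 1) n
        linear_combination a + b + PowerSeries.X ^ (n + 1 + 1) * c - d
          - PowerSeries.X ^ (m + 1 + 1) * e

lemma G_symm : ∀ k m n : ℕ, m + n = k → G m n = G n m := by
  intro k
  induction k with
  | zero =>
    intro m n h
    obtain ⟨rfl, rfl⟩ : m = 0 ∧ n = 0 := by omega
    rfl
  | succ k ih =>
    intro m n h
    rcases m with _ | m
    · rw [G_zero_left, G_zero_right]
    · rcases n with _ | n
      · rw [G_zero_left, G_zero_right]
      · rw [G_succ, G_succ' _ n m rfl, ih (m + 1) n (by omega), ih m (n + 1) (by omega)]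

lemma w_symm (m n r : ℕ) : w m n r = w n m r := by
  have := congrArg (PowerSeries.coeff r) (G_symm _ m n rfl)
  simpa [G] using this

open MvPolynomial

/-- Bigrading of the variables: (degree, weight). -/
def wt (n : ℕ) (i : Fin (n + 1)) : ℤ × ℤ := (1, ((i : ℕ) : ℤ))

/-- The multiset attached to an exponent vector. -/
noncomputable def msOf {n : ℕ} (d : Fin (n + 1) →₀ ℕ) : Multiset ℕ :=
  (Finsupp.toMultiset d).map (fun i : Fin (n + 1) => (i : ℕ))

lemma weight_msOf {n : ℕ} (d : Fin (n + 1) →₀ ℕ) :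
    Finsupp.weight (wt n) d = (((msOf d).card : ℤ), ((msOf d).sum : ℤ)) := by
  induction d using Finsupp.induction_linear with
  | zero => simp [msOf]; rfl
  | add f g hf hg =>
    rw [map_add, hf, hg]
    simp [msOf]
  | single i c =>
    rw [Finsupp.weight_single]
    simp [msOf, wt, Finsupp.toMultiset_single, Multiset.nsmul_singleton]

lemma msOf_injective (n : ℕ) : Function.Injective (msOf (n := n)) := by
  intro a b h
  have := Multiset.map_injective Fin.val_injective h
  rw [← Finsupp.toMultiset_toFinsupp a, this, Finsupp.toMultiset_toFinsupp]

lemma msOf_image (n m r : ℕ) :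
    Set.image msOf {d : Fin (n + 1) →₀ ℕ | Finsupp.weight (wt n) d = ((m : ℤ), (r : ℤ))} = W m n r := by
  ext s
  constructor
  · rintro ⟨d, hd, rfl⟩
    rw [Set.mem_ofPred_eq, weight_msOf, Prod.mk.injEq] at hd
    refine ⟨by exact_mod_cast hd.1, by exact_mod_cast hd.2, ?_⟩
    intro x hx
    simp only [msOf, Multiset.mem_map] at hx
    obtain ⟨i, -, rfl⟩ := hx
    exact Nat.lt_succ_iff.mp i.2
  · rintro ⟨h1, h2, h3⟩
    have hlift : ∃ t : Multiset (Fin (n + 1)), t.map (fun i : Fin (n + 1) => (i : ℕ)) = s := by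
      refine ⟨s.pmap (fun x hx => ⟨x, hx⟩) (fun x hx => Nat.lt_succ_iff.mpr (h3 x hx)), ?_⟩
      rw [Multiset.map_pmap]
      simp only [Multiset.pmap_eq_map, Multiset.map_id']
    obtain ⟨t, rfl⟩ := hlift
    refine ⟨Multiset.toFinsupp t, ?_, by simp [msOf]⟩
    rw [Set.mem_ofPred_eq, weight_msOf]
    simp only [msOf, Multiset.toFinsupp_toMultiset]
    rw [h1, h2]

lemma exps_finite (n m r : ℕ) :
    {d : Fin (n + 1) →₀ ℕ | Finsupp.weight (wt n) d = ((m : ℤ), (r : ℤ))}.Finite := by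
  apply Set.Finite.of_finite_image (f := msOf) _ (msOf_injective n).injOn
  rw [msOf_image]; exact W_finite _ _ _

lemma exps_ncard (n m r : ℕ) :
    {d : Fin (n + 1) →₀ ℕ | Finsupp.weight (wt n) d = ((m : ℤ), (r : ℤ))}.ncard = w m n r := by
  rw [w, ← msOf_image, Set.ncard_image_of_injective _ (msOf_injective n)]

/-- The bigraded piece. -/
noncomputable abbrev V (n : ℕ) (m r : ℤ) : Submodule ℚ (MvPolynomial (Fin (n + 1)) ℚ) :=
  weightedHomogeneousSubmodule ℚ (wt n) (m, r)

lemma V_eq (n : ℕ) (m r : ℤ) :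
    V n m r = restrictSupport ℚ {d | Finsupp.weight (wt n) d = (m, r)} :=
  weightedHomogeneousSubmodule_eq_finsupp_supported ℚ _ _

lemma V_finite (n m r : ℕ) : Module.Finite ℚ (V n m r) := by
  rw [V_eq]
  have := (exps_finite n m r).to_subtype
  exact Module.Finite.of_basis (basisRestrictSupport ℚ _)

lemma V_finrank (n m r : ℕ) : Module.finrank ℚ (V n m r) = w m n r := by
  rw [V_eq, Module.finrank_eq_nat_card_basis (basisRestrictSupport ℚ _), ← exps_ncard]
  rfl

lemma V_neg (n : ℕ) (m r : ℤ) (hr : r < 0) {p : MvPolynomial (Fin (n + 1)) ℚ}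
    (hp : p ∈ V n m r) : p = 0 := by
  ext d
  by_contra h
  have := hp (by simpa using h)
  rw [weight_msOf, Prod.mk.injEq] at this
  have h2 := this.2
  omega

lemma deriv_homog {n : ℕ} (f : Fin (n + 1) → MvPolynomial (Fin (n + 1)) ℚ) (δ : ℤ × ℤ)
    (hf : ∀ i, IsWeightedHomogeneous (wt n) (f i) (wt n i + δ)) {μ : ℤ × ℤ}
    {p : MvPolynomial (Fin (n + 1)) ℚ} (hp : IsWeightedHomogeneous (wt n) p μ) :
    IsWeightedHomogeneous (wt n) (mkDerivation ℚ f p) (μ + δ) := by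
  rw [p.as_sum, map_sum]
  apply IsWeightedHomogeneous.sum
  intro d hd
  have hd' := hp (mem_support_iff.mp hd)
  rw [mkDerivation_monomial]
  rw [← mem_weightedHomogeneousSubmodule]
  apply Submodule.smul_mem
  apply Submodule.sum_mem
  intro i hi
  rw [mem_weightedHomogeneousSubmodule]
  beta_reduce
  rw [smul_eq_mul]
  have h1 := Finsupp.weight_sub_single_add (w := wt n) (Finsupp.mem_support_iff.mp hi)
  have h2 : μ + δ = Finsupp.weight (wt n) (d - Finsupp.single i 1) + (wt n i + δ) := by
    rw [← add_assoc, h1, hd']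
  rw [h2]
  exact (isWeightedHomogeneous_monomial _ _ _ rfl).mul (hf i)

lemma diag_eigen {n : ℕ} (c : Fin (n + 1) → ℚ) (a b : ℚ)
    (hc : ∀ i, c i = a + b * (i : ℕ)) {m r : ℤ}
    {p : MvPolynomial (Fin (n + 1)) ℚ} (hp : p ∈ V n m r) :
    mkDerivation ℚ (fun i => c i • (X i : MvPolynomial (Fin (n + 1)) ℚ)) p = (a * m + b * r) • p := by
  rw [p.as_sum, map_sum, Finset.smul_sum]
  apply Finset.sum_congr rfl
  intro d hd
  have hd' := hp (mem_support_iff.mp hd)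
  rw [mkDerivation_monomial]
  have h1 : (d.sum fun i k => monomial (d - Finsupp.single i 1) (k : ℚ) •
      (c i • (X i : MvPolynomial (Fin (n + 1)) ℚ))) = d.sum fun i k => ((k : ℚ) * c i) • monomial d (1 : ℚ) := by
    apply Finset.sum_congr rfl
    intro i hi
    have : d - Finsupp.single i 1 + Finsupp.single i 1 = d :=
      Finsupp.sub_add_single_one_cancel (Finsupp.mem_support_iff.mp hi)
    beta_reduce
    rw [smul_eq_mul, mul_smul_comm, X, monomial_mul, this, smul_monomial, smul_monomial]
    congr 1
    simp only [smul_eq_mul]; ring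
  have h2 : (d.sum fun i k => ((k : ℚ) * c i)) = a * m + b * r := by
    rw [Finsupp.weight_apply, Finsupp.sum, Prod.ext_iff, Prod.fst_sum, Prod.snd_sum] at hd'
    simp only [wt, Prod.smul_mk] at hd'
    rw [← hd'.1, ← hd'.2, Finsupp.sum]
    push_cast
    rw [Finset.mul_sum, Finset.mul_sum, ← Finset.sum_add_distrib]
    apply Finset.sum_congr rfl
    intro i _
    rw [hc]; simp; ring
  rw [h1, Finsupp.sum, ← Finset.sum_smul, ← h2, Finsupp.sum, smul_comm, smul_monomial (coeff d p)]
  simp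

/-- Lowering operator. -/
noncomputable def D (n : ℕ) :
    Derivation ℚ (MvPolynomial (Fin (n + 1)) ℚ) (MvPolynomial (Fin (n + 1)) ℚ) :=
  mkDerivation ℚ fun i => ((i : ℕ) : ℚ) • X (i - 1)

/-- Raising operator. -/
noncomputable def U (n : ℕ) :
    Derivation ℚ (MvPolynomial (Fin (n + 1)) ℚ) (MvPolynomial (Fin (n + 1)) ℚ) :=
  mkDerivation ℚ fun i => ((n : ℚ) - ((i : ℕ) : ℚ)) • X (i + 1)

lemma val_sub_one {n : ℕ} (i : Fin (n + 1)) (h : (i : ℕ) ≠ 0) : ((i - 1 : Fin (n + 1)) : ℕ) = i - 1 := by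
  apply Fin.val_sub_one_of_ne_zero
  intro h'; exact h (by simp [h'])

lemma val_add_one {n : ℕ} (i : Fin (n + 1)) (h : (i : ℕ) ≠ n) : ((i + 1 : Fin (n + 1)) : ℕ) = i + 1 := by
  apply Fin.val_add_one_of_lt
  have := i.2
  rw [Fin.lt_def, Fin.val_last]; omega

lemma D_mem {n : ℕ} {m r : ℤ} {p : MvPolynomial (Fin (n + 1)) ℚ} (hp : p ∈ V n m r) :
    D n p ∈ V n m (r - 1) := by
  have := deriv_homog (n := n) (fun i => ((i : ℕ) : ℚ) • X (i - 1)) (0, -1) ?_ hp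
  · rw [Prod.mk_add_mk, add_zero, ← sub_eq_add_neg] at this
    exact this
  · intro i
    by_cases h : (i : ℕ) = 0
    · simp only [h, Nat.cast_zero, zero_smul]; exact isWeightedHomogeneous_zero _ _ _
    · rw [← mem_weightedHomogeneousSubmodule]
      apply Submodule.smul_mem
      have e : wt n i + (0, -1) = wt n (i - 1) := by
        simp only [wt, val_sub_one i h, Prod.mk_add_mk]
        rw [Prod.mk.injEq]
        omega
      rw [e]
      exact isWeightedHomogeneous_X ℚ (wt n) _

lemma U_mem {n : ℕ} {m r : ℤ} {p : MvPolynomial (Fin (n + 1)) ℚ} (hp : p ∈ V n m r) :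
    U n p ∈ V n m (r + 1) := by
  have := deriv_homog (n := n) (fun i => ((n : ℚ) - ((i : ℕ) : ℚ)) • X (i + 1)) (0, 1) ?_ hp
  · rw [Prod.mk_add_mk, add_zero] at this
    exact this
  · intro i
    by_cases h : (i : ℕ) = n
    · simp only [h, sub_self, zero_smul]; exact isWeightedHomogeneous_zero _ _ _
    · rw [← mem_weightedHomogeneousSubmodule]
      apply Submodule.smul_mem
      have e : wt n i + (0, 1) = wt n (i + 1) := by
        simp only [wt, val_add_one i h, Prod.mk_add_mk]
        rw [Prod.mk.injEq]
        omega
      rw [e]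
      exact isWeightedHomogeneous_X ℚ (wt n) _

lemma comm_eq (n : ℕ) : ⁅D n, U n⁆ = mkDerivation ℚ (fun i : Fin (n + 1) =>
    ((n : ℚ) - 2 * ((i : ℕ) : ℚ)) • (X i : MvPolynomial (Fin (n + 1)) ℚ)) := by
  apply derivation_ext
  intro i
  rw [Derivation.commutator_apply, mkDerivation_X, D, U, mkDerivation_X, mkDerivation_X,
    Derivation.map_smul, Derivation.map_smul, mkDerivation_X, mkDerivation_X, smul_smul, smul_smul,
    add_sub_cancel_right, sub_add_cancel, ← sub_smul]
  congr 1
  by_cases h : (i : ℕ) = n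
  · by_cases h0 : (i : ℕ) = 0
    · rw [h0] at h
      simp [← h, h0]
    · rw [val_sub_one i h0, Nat.cast_sub (by omega), h]
      push_cast; ring
  · rw [val_add_one i h]
    by_cases h0 : (i : ℕ) = 0
    · simp [h0]
    · rw [val_sub_one i h0, Nat.cast_sub (by omega)]
      push_cast; ring

lemma DU_eq {n : ℕ} {m r : ℤ} {p : MvPolynomial (Fin (n + 1)) ℚ} (hp : p ∈ V n m r) :
    D n (U n p) = U n (D n p) + ((n : ℚ) * m - 2 * r) • p := by
  have h := diag_eigen (fun i : Fin (n + 1) => (n : ℚ) - 2 * ((i : ℕ) : ℚ)) n (-2)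
    (fun i => by ring) hp
  rw [← comm_eq, Derivation.commutator_apply] at h
  rw [sub_eq_iff_eq_add] at h
  rw [h, add_comm (_ • p)]
  congr 2; ring

lemma UD_neg {n : ℕ} {m : ℤ} : ∀ (k : ℕ) (r : ℤ) (p : MvPolynomial (Fin (n + 1)) ℚ) (μ : ℚ),
    r < k → 2 * r ≤ n * m → p ∈ V n m r → μ < 0 → U n (D n p) = μ • p → p = 0 := by
  intro k
  induction k with
  | zero =>
    intro r p μ h1 h2 hp _ _
    exact V_neg n m r (by simpa using h1) hp
  | succ k ih =>
    intro r p μ h1 h2 hp hμ h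
    have hD := D_mem hp
    have e := DU_eq hD
    rw [h, Derivation.map_smul] at e
    have hw : D n p = 0 := by
      refine ih (r - 1) (D n p) (μ - ((n : ℚ) * m - 2 * ((r - 1 : ℤ) : ℚ))) (by push_cast at h1; omega) (by omega) hD ?_ ?_
      · have : (2 * r : ℚ) ≤ n * m := by exact_mod_cast h2
        push_cast; linarith
      · rw [sub_smul, e]; simp
    rw [hw, map_zero] at h
    exact (smul_eq_zero.mp h.symm).resolve_left hμ.ne

lemma D_surj (n m r : ℕ) (h : 2 * r < m * n) (q : MvPolynomial (Fin (n + 1)) ℚ)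
    (hq : q ∈ V n m r) : ∃ p ∈ V n m (r + 1), D n p = q := by
  have := V_finite n m r
  let T : V n m r →ₗ[ℚ] V n m r :=
    ((D n).toLinearMap ∘ₗ (U n).toLinearMap).restrict (p := V n m r) (q := V n m r) (by
      intro p hp
      have := D_mem (U_mem hp)
      rwa [add_sub_cancel_right] at this)
  have hT : Function.Injective T := by
    rw [← LinearMap.ker_eq_bot, LinearMap.ker_eq_bot']
    rintro ⟨p, hp⟩ h0
    have h0' : D n (U n p) = 0 := congrArg Subtype.val h0
    rw [DU_eq hp] at h0'
    have : p = 0 := by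
      refine UD_neg (r + 1) r p (-((n : ℚ) * m - 2 * r)) (by push_cast; omega) ?_ hp ?_ ?_
      · have : (2 * r : ℤ) < m * n := by exact_mod_cast h
        linarith
      · have : (2 * r : ℚ) < m * n := by exact_mod_cast h
        linarith
      · rw [neg_smul]; exact eq_neg_of_add_eq_zero_left (by exact_mod_cast h0')
    exact Subtype.ext this
  obtain ⟨⟨p, hp⟩, hpq⟩ := (LinearMap.injective_iff_surjective.mp hT) ⟨q, hq⟩
  exact ⟨U n p, U_mem hp, congrArg Subtype.val hpq⟩

/-- Existence of a semi-invariant of degree `m` and weight `r`. -/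
def Semi (n m r : ℕ) : Prop := ∃ p ∈ V n m r, p ≠ 0 ∧ D n p = 0

lemma Semi.add {n m r m' r' : ℕ} (h : Semi n m r) (h' : Semi n m' r') :
    Semi n (m + m') (r + r') := by
  obtain ⟨p, hp, p0, hD⟩ := h
  obtain ⟨q, hq, q0, hE⟩ := h'
  refine ⟨p * q, ?_, mul_ne_zero p0 q0, ?_⟩
  · have := IsWeightedHomogeneous.mul hp hq
    rw [mem_weightedHomogeneousSubmodule]
    push_cast
    exact this
  · rw [Derivation.leibniz, hD, hE]; simp

lemma semi_zero (n m : ℕ) : Semi n m 0 := by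
  refine ⟨X 0 ^ m, ?_, pow_ne_zero _ (X_ne_zero 0), ?_⟩
  · have := (isWeightedHomogeneous_X ℚ (wt n) 0).pow m
    rw [mem_weightedHomogeneousSubmodule]
    convert this using 1
    simp [wt]
  · rw [Derivation.leibniz_pow, D, mkDerivation_X]; simp

lemma semi_iff (n m r : ℕ) (h : 2 * (r + 1) ≤ m * n) :
    Semi n m (r + 1) ↔ w m n r < w m n (r + 1) := by
  have i1 := V_finite n m r
  have i2 := V_finite n m (r + 1)
  let T : V n m (r + 1 : ℕ) →ₗ[ℚ] V n m r :=
    ((D n).toLinearMap).restrict (p := V n m (r + 1 : ℕ)) (q := V n m r) (by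
      intro p hp
      have := D_mem hp
      push_cast at this
      rwa [add_sub_cancel_right] at this)
  have hT : Function.Surjective T := by
    rintro ⟨q, hq⟩
    obtain ⟨p, hp, e⟩ := D_surj n m r (by omega) q hq
    exact ⟨⟨p, by push_cast; exact hp⟩, Subtype.ext e⟩
  have hdim := T.finrank_range_add_finrank_ker
  rw [LinearMap.range_eq_top.mpr hT, finrank_top, V_finrank, V_finrank] at hdim
  rw [← hdim]
  have : 0 < Module.finrank ℚ T.ker ↔ T.ker ≠ ⊥ := by
    rw [Nat.pos_iff_ne_zero, Ne, Submodule.finrank_eq_zero]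
  rw [lt_add_iff_pos_right, this, Submodule.ne_bot_iff]
  constructor
  · rintro ⟨p, hp, p0, e⟩
    exact ⟨⟨p, hp⟩, Subtype.ext e, fun h => p0 (congrArg Subtype.val h)⟩
  · rintro ⟨⟨p, hp⟩, e, p0⟩
    exact ⟨p, hp, fun h => p0 (Subtype.ext h), congrArg Subtype.val e⟩

/-- Strict unimodality of the Gaussian coefficient. -/
def St (m n : ℕ) : Prop := ∀ r, 2 ≤ r → 2 * r ≤ m * n → w m n (r - 1) < w m n r

lemma St.symm {m n : ℕ} (h : St m n) : St n m := by
  intro r h1 h2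
  rw [w_symm n m, w_symm n m]
  exact h r h1 (by rw [mul_comm m n]; exact h2)

lemma St.semi {m n : ℕ} (h : St m n) (r : ℕ) (h1 : r ≠ 1) (h2 : 2 * r ≤ m * n) : Semi n m r := by
  rcases r with _ | r
  · exact semi_zero n m
  · rw [semi_iff n m r h2]
    exact h (r + 1) (by omega) h2

lemma St.add {a b n : ℕ} (ha : St a n) (hb : St b n) (he : 2 ∣ a * n) (h6 : 6 ≤ a * n)
    (h4 : 4 ≤ b * n) : St (a + b) n := by
  intro r h1 h2
  have hab : (a + b) * n = a * n + b * n := by ring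
  have hs : Semi n (a + b) r := by
    obtain ⟨A, hA⟩ := he
    by_cases c1 : r ≤ A
    · exact (ha.semi r (by omega) (by omega)).add (semi_zero n b)
    · by_cases c2 : r = A + 1
      · have := (ha.semi (A - 1) (by omega) (by omega)).add (hb.semi 2 (by omega) (by omega))
        rwa [show A - 1 + 2 = r by omega] at this
      · have := (ha.semi A (by omega) (by omega)).add (hb.semi (r - A) (by omega) (by omega))
        rwa [show A + (r - A) = r by omega] at this
  rcases r with _ | r
  · omega
  · exact (semi_iff n (a + b) r h2).mp hs

/-- Adding eight to the second argument. -/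
lemma St.step {m n : ℕ} (hm : 1 ≤ m) (hn : 4 ≤ n) (h8 : St m 8) (h : St m n) : St m (n + 8) := by
  have := St.add h8.symm h.symm ⟨4 * m, by ring⟩ (by omega) (by nlinarith)
  rw [add_comm]
  exact this.symm

lemma St.steps {m n : ℕ} (hm : 1 ≤ m) (hn : 4 ≤ n) (h8 : St m 8) (h : St m n) (k : ℕ) :
    St m (n + 8 * k) := by
  induction k with
  | zero => exact h
  | succ k ih =>
    rw [Nat.mul_succ, ← add_assoc]
    exact St.step hm (by omega) h8 ih

/-- Polynomial addition. -/
noncomputable def padd (a : List ℕ) : List ℕ → List ℕ :=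
  List.rec (motive := fun _ => List ℕ → List ℕ) (fun b => b)
    (fun x a ih b => List.rec (motive := fun _ => List ℕ) (x :: a)
      (fun y b' _ => (x + y) :: ih b') b) a

lemma padd_nil (b : List ℕ) : padd [] b = b := rfl

lemma padd_cons_nil (x : ℕ) (a : List ℕ) : padd (x :: a) [] = x :: a := rfl

lemma padd_cons_cons (x y : ℕ) (a b : List ℕ) :
    padd (x :: a) (y :: b) = (x + y) :: padd a b := rfl

/-- `a + q ^ k * b`. -/
noncomputable def pshift (k : ℕ) : List ℕ → List ℕ → List ℕ :=
  Nat.rec (motive := fun _ => List ℕ → List ℕ → List ℕ) padd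
    (fun _ ih a b => List.rec (motive := fun _ => List ℕ) (0 :: ih [] b)
      (fun x a' _ => x :: ih a' b) a) k

lemma pshift_zero (a b : List ℕ) : pshift 0 a b = padd a b := rfl

lemma pshift_nil (k : ℕ) (b : List ℕ) : pshift (k + 1) [] b = 0 :: pshift k [] b := rfl

lemma pshift_cons (k x : ℕ) (a b : List ℕ) :
    pshift (k + 1) (x :: a) b = x :: pshift k a b := rfl

lemma padd_getD (a b : List ℕ) (r : ℕ) :
    (padd a b).getD r 0 = a.getD r 0 + b.getD r 0 := by
  induction a generalizing b r with
  | nil => simp [padd_nil]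
  | cons x a ih =>
    cases b with
    | nil => simp [padd_cons_nil]
    | cons y b =>
      cases r with
      | zero => simp [padd_cons_cons]
      | succ r => simpa [padd_cons_cons] using ih b r

lemma pshift_getD (k : ℕ) (a b : List ℕ) (r : ℕ) :
    (pshift k a b).getD r 0 = a.getD r 0 + if k ≤ r then b.getD (r - k) 0 else 0 := by
  induction k generalizing a r with
  | zero => simp only [pshift_zero, padd_getD]; simp
  | succ k ih =>
    cases a with
    | nil =>
      cases r with
      | zero => simp [pshift_nil]
      | succ r => simpa [pshift_nil] using ih [] r
    | cons x a =>
      cases r with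
      | zero => simp [pshift_cons]
      | succ r => simpa [pshift_cons] using ih a r

/-- The list represents the Gaussian coefficient. -/
def Rep (l : List ℕ) (m n : ℕ) : Prop := ∀ r, l.getD r 0 = w m n r

lemma Rep.zero_left (n : ℕ) : Rep [1] 0 n := by
  intro r
  rw [w_zero_left]
  cases r <;> simp

lemma Rep.zero_right (m : ℕ) : Rep [1] m 0 := by
  intro r
  rw [w_zero_right]
  cases r <;> simp

lemma Rep.succ {a b : List ℕ} {m n : ℕ} (ha : Rep a (m + 1) n) (hb : Rep b m (n + 1)) :
    Rep (pshift (n + 1) a b) (m + 1) (n + 1) := by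
  intro r
  rw [pshift_getD, w_succ, ha r, hb]

/-- A row of the table. -/
def RowOK (m : ℕ) : ℕ → List (List ℕ) → Prop
  | _, [] => True
  | k, p :: L => Rep p m k ∧ RowOK m (k + 1) L

/-- Next row. -/
noncomputable def nextRow : ℕ → List ℕ → List (List ℕ) → List (List ℕ)
  | _, _, [] => []
  | k, acc, p :: L => (fun q => q :: nextRow (k + 1) q L) (pshift k acc p)

lemma nextRow_ok (m : ℕ) (L : List (List ℕ)) : ∀ (k : ℕ) (acc : List ℕ), Rep acc (m + 1) k →
    RowOK m (k + 1) L → RowOK (m + 1) (k + 1) (nextRow (k + 1) acc L) := by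
  induction L with
  | nil => intros; trivial
  | cons p L ih =>
    intro k acc h1 h2
    have h := Rep.succ h1 h2.1
    exact ⟨h, ih (k + 1) _ h h2.2⟩

/-- `c` strict increases at the beginning of the list. -/
noncomputable def chk (l : List ℕ) (c : ℕ) : Bool :=
  Nat.rec (motive := fun _ => List ℕ → Bool) (fun _ => true)
    (fun _ ih l => List.rec (motive := fun _ => Bool) false (fun x l' _ =>
      List.rec (motive := fun _ => Bool) false
        (fun y _ _ => Bool.rec (motive := fun _ => Bool) false (ih l') (Nat.blt x y)) l') l) c l

lemma chk_nil (c : ℕ) : chk [] (c + 1) = false := rfl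

lemma chk_single (x c : ℕ) : chk [x] (c + 1) = false := rfl

lemma chk_cons (x y : ℕ) (t : List ℕ) (c : ℕ) :
    chk (x :: y :: t) (c + 1) = (Nat.blt x y && chk (y :: t) c) := by
  show Bool.rec (motive := fun _ => Bool) false (chk (y :: t) c) (Nat.blt x y) = _
  cases Nat.blt x y <;> rfl

lemma chk_spec : ∀ (c : ℕ) (l : List ℕ), chk l c = true → ∀ i < c, l.getD i 0 < l.getD (i + 1) 0 := by
  intro c
  induction c with
  | zero => intro l _ i hi; omega
  | succ c ih =>
    intro l h i hi
    rcases l with _ | ⟨x, _ | ⟨y, t⟩⟩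
    · simp [chk_nil] at h
    · simp [chk_single] at h
    · simp only [chk_cons, Bool.and_eq_true] at h
      cases i with
      | zero => simpa [Nat.blt_eq] using h.1
      | succ i => simpa using ih _ h.2 i (by omega)

/-- Check of one polynomial. -/
noncomputable def pchk (m n : ℕ) (l : List ℕ) : Bool := chk l.tail (m * n / 2 - 1)

lemma pchk_spec {m n : ℕ} {l : List ℕ} (hl : Rep l m n) (h : pchk m n l = true) : St m n := by
  intro r h1 h2
  have := chk_spec _ _ h (r - 2) (by omega)
  rw [← hl, ← hl]
  cases l with
  | nil => simp at this
  | cons x l =>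
    obtain ⟨r, rfl⟩ := Nat.exists_eq_add_of_le h1
    rw [show 2 + r - 2 = r by omega] at this
    rw [show 2 + r - 1 = r + 1 by omega, show 2 + r = r + 1 + 1 by omega]
    simpa using this

/-- The pairs for which strictness is verified by evaluation. -/
def want : ℕ → ℕ → Bool
  | 5, n => [8, 9, 11, 12, 13, 15, 18, 22].elem n
  | 6, n => [8, 10, 12, 14, 15, 17, 19, 21].elem n
  | 7, n => [8, 9, 11, 12, 13, 14, 15, 18].elem n
  | m, n => Nat.ble 8 m && Nat.ble m n && Nat.ble n 15

/-- Check of a row. -/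
noncomputable def rowChk (m : ℕ) : ℕ → List (List ℕ) → Bool
  | _, [] => true
  | k, p :: L => (cond (want m k) (pchk m k p) true) && rowChk m (k + 1) L

lemma rowChk_spec (m : ℕ) (L : List (List ℕ)) : ∀ k, RowOK m k L → rowChk m k L = true →
    ∀ n, k ≤ n → n < k + L.length → want m n = true → St m n := by
  induction L with
  | nil => intro k _ _ n h1 h2; simp at h2; omega
  | cons p L ih =>
    intro k h1 h2 n h3 h4 h5
    simp only [rowChk, Bool.and_eq_true] at h2
    rcases Nat.eq_or_lt_of_le h3 with rfl | h
    · rw [h5] at h2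
      exact pchk_spec h1.1 h2.1
    · exact ih (k + 1) h1.2 h2.2 n h (by simp at h4; omega) h5

lemma nextRow_length (L : List (List ℕ)) : ∀ k acc, (nextRow k acc L).length = L.length := by
  induction L with
  | nil => intros; rfl
  | cons p L ih => intro k acc; simp [nextRow, ih]

/-- Check all rows. -/
noncomputable def allChk : ℕ → ℕ → List (List ℕ) → Bool
  | 0, _, _ => true
  | c + 1, m, L => rowChk m 1 L && allChk c (m + 1) (nextRow 1 [1] L)

lemma allChk_spec (c : ℕ) : ∀ m L, RowOK m 1 L → allChk c m L = true →
    ∀ m', m ≤ m' → m' < m + c → ∀ n, 1 ≤ n → n < 1 + L.length → want m' n = true → St m' n := by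
  induction c with
  | zero => intro m L _ _ m' h1 h2; omega
  | succ c ih =>
    intro m L h1 h2 m' h3 h4 n h5 h6 h7
    simp only [allChk, Bool.and_eq_true] at h2
    rcases Nat.eq_or_lt_of_le h3 with rfl | h
    · exact rowChk_spec m L 1 h1 h2.1 n h5 h6 h7
    · exact ih (m + 1) _ (nextRow_ok m L 0 [1] (Rep.zero_right _) h1) h2.2 m' h (by omega) n h5
        (by rw [nextRow_length]; exact h6) h7

lemma row0_ok (c : ℕ) : ∀ k, RowOK 0 k (List.replicate c [1]) := by
  induction c with
  | zero => intro k; trivial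
  | succ c ih => intro k; exact ⟨Rep.zero_left k, ih (k + 1)⟩

lemma big_check₁ : allChk 8 0 (List.replicate 22 [1]) = true := by
  decide +kernel

lemma big_check₂ : allChk 16 0 (List.replicate 15 [1]) = true := by
  decide +kernel

lemma base {m n : ℕ} (hm : m < 8) (hn : 1 ≤ n) (hn' : n < 23) (h : want m n = true) : St m n :=
  allChk_spec 8 0 _ (row0_ok 22 1) big_check₁ m (Nat.zero_le _) (by omega) n hn
    (by simpa using by omega) h

lemma base' {m n : ℕ} (hm : m < 16) (hn : 1 ≤ n) (hn' : n < 16) (h : want m n = true) : St m n :=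
  allChk_spec 16 0 _ (row0_ok 15 1) big_check₂ m (Nat.zero_le _) (by omega) n hn
    (by simpa using by omega) h

lemma base8 {m n : ℕ} (h1 : 8 ≤ m) (h2 : m < 16) (h3 : 8 ≤ n) (h4 : n < 16) : St m n := by
  have key : ∀ m n : ℕ, 8 ≤ m → m ≤ n → n < 16 → St m n := by
    intro m n h1 h2 h3
    apply base' (by omega) (by omega) (by omega)
    obtain ⟨k, rfl⟩ := Nat.exists_eq_add_of_le h1
    rw [add_comm]
    simp [want]
    omega
  rcases le_total m n with h | h
  · exact key m n h1 h h4
  · exact (key n m h3 h h2).symm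

lemma col {m n : ℕ} (h1 : 8 ≤ m) (h2 : m < 16) (h3 : 8 ≤ n) : St m n := by
  have := St.steps (by omega) (by omega) (base8 h1 h2 le_rfl (by omega))
    (base8 (n := 8 + n % 8) h1 h2 (by omega) (by omega)) (n / 8 - 1)
  rwa [show 8 + n % 8 + 8 * (n / 8 - 1) = n by omega] at this

lemma all8 {m n : ℕ} (h1 : 8 ≤ m) (h3 : 8 ≤ n) : St m n := by
  have c : ∀ n, 8 ≤ n → n < 16 → St m n := fun n h h' => (col h h' h1).symm
  have := St.steps (by omega) (by omega) (c 8 le_rfl (by omega))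
    (c (8 + n % 8) (by omega) (by omega)) (n / 8 - 1)
  rwa [show 8 + n % 8 + 8 * (n / 8 - 1) = n by omega] at this

lemma small {m : ℕ} (hm : 1 ≤ m) (hm' : m < 8) (b : ℕ) (hb : 4 ≤ b) (hb' : b < 23)
    (w8 : want m 8 = true) (wb : want m b = true)
    {n : ℕ} (hn : b ≤ n) (hmod : n % 8 = b % 8) : St m n := by
  have := St.steps hm hb (base hm' (by omega) (by omega) w8)
    (base hm' (by omega) (by omega) wb) ((n - b) / 8)
  rwa [show b + 8 * ((n - b) / 8) = n by omega] at this

lemma five {n : ℕ} (hn : 15 ≤ n) : St 5 n := by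
  have h8 : n % 8 < 8 := Nat.mod_lt _ (by norm_num)
  generalize hk : n % 8 = k at h8
  have key : ∀ b, 4 ≤ b → b < 23 → want 5 b = true → b ≤ n → n % 8 = b % 8 → St 5 n :=
    fun b h1 h2 h3 h4 h5 => small (by norm_num) (by norm_num) b h1 h2 rfl h3 h4 h5
  interval_cases k
  · exact key 8 (by omega) (by omega) rfl (by omega) (by omega)
  · exact key 9 (by omega) (by omega) rfl (by omega) (by omega)
  · exact key 18 (by omega) (by omega) rfl (by omega) (by omega)
  · exact key 11 (by omega) (by omega) rfl (by omega) (by omega)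
  · exact key 12 (by omega) (by omega) rfl (by omega) (by omega)
  · exact key 13 (by omega) (by omega) rfl (by omega) (by omega)
  · exact key 22 (by omega) (by omega) rfl (by omega) (by omega)
  · exact key 15 (by omega) (by omega) rfl (by omega) (by omega)

lemma six {n : ℕ} (hn : 12 ≤ n) (h13 : n ≠ 13) : St 6 n := by
  have h8 : n % 8 < 8 := Nat.mod_lt _ (by norm_num)
  generalize hk : n % 8 = k at h8
  have key : ∀ b, 4 ≤ b → b < 23 → want 6 b = true → b ≤ n → n % 8 = b % 8 → St 6 n :=
    fun b h1 h2 h3 h4 h5 => small (by norm_num) (by norm_num) b h1 h2 rfl h3 h4 h5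
  interval_cases k
  · exact key 8 (by omega) (by omega) rfl (by omega) (by omega)
  · exact key 17 (by omega) (by omega) rfl (by omega) (by omega)
  · exact key 10 (by omega) (by omega) rfl (by omega) (by omega)
  · exact key 19 (by omega) (by omega) rfl (by omega) (by omega)
  · exact key 12 (by omega) (by omega) rfl (by omega) (by omega)
  · exact key 21 (by omega) (by omega) rfl (by omega) (by omega)
  · exact key 14 (by omega) (by omega) rfl (by omega) (by omega)
  · exact key 15 (by omega) (by omega) rfl (by omega) (by omega)

lemma seven {n : ℕ} (hn : 8 ≤ n) (h10 : n ≠ 10) : St 7 n := by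
  have h8 : n % 8 < 8 := Nat.mod_lt _ (by norm_num)
  generalize hk : n % 8 = k at h8
  have key : ∀ b, 4 ≤ b → b < 23 → want 7 b = true → b ≤ n → n % 8 = b % 8 → St 7 n :=
    fun b h1 h2 h3 h4 h5 => small (by norm_num) (by norm_num) b h1 h2 rfl h3 h4 h5
  interval_cases k
  · exact key 8 (by omega) (by omega) rfl (by omega) (by omega)
  · exact key 9 (by omega) (by omega) rfl (by omega) (by omega)
  · exact key 18 (by omega) (by omega) rfl (by omega) (by omega)
  · exact key 11 (by omega) (by omega) rfl (by omega) (by omega)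
  · exact key 12 (by omega) (by omega) rfl (by omega) (by omega)
  · exact key 13 (by omega) (by omega) rfl (by omega) (by omega)
  · exact key 14 (by omega) (by omega) rfl (by omega) (by omega)
  · exact key 15 (by omega) (by omega) rfl (by omega) (by omega)

end KOH

theorem stmt17 (m d0 d1 d2 r : ℕ) (hm : 4 ≤ m) (h0 : 0 < d0) (h1 : 0 < d1) (h2 : 0 < d2)
    (hcond : m * d0 ≤ (m - 4) * d2 + 1)
    (hr1 : 2 * d1 + 6 * d2 ≤ r) (hr2 : 2 * r ≤ m * (d0 + 2 * d1 + 3 * d2)) :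
    gaussP m (d0 + 2 * d1 + 3 * d2) (r - 1) < gaussP m (d0 + 2 * d1 + 3 * d2) r := by
  rw [KOH.gaussP_eq, KOH.gaussP_eq]
  have hS : KOH.St m (d0 + 2 * d1 + 3 * d2) := by
    rcases Nat.lt_or_ge m 8 with h | h
    · interval_cases m
      · omega
      · exact KOH.five (by omega)
      · exact KOH.six (by omega) (by omega)
      · exact KOH.seven (by omega) (by omega)
    · have hd2 : 2 ≤ d2 := by
        by_contra hlt
        have : d2 = 1 := by omega
        subst this
        have : m * 1 ≤ m * d0 := Nat.mul_le_mul_left m h0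
        omega
      exact KOH.all8 h (by omega)
  exact hS r (by omega) hr2
end

section
/- Let m ≥ 6 be an integer and let d_0, d_1, d_2, d_3 be positive integers with n = d_0 + 2d_1 + 3d_2 + 4d_3 and m·d_0 ≤ (m−4)·d_2 + 2(m−6)·d_3. Then p_r(m,n) > p_{r−1}(m,n) for every integer r with 2d_1 + 6d_2 + 12d_3 ≤ r and 2r ≤ mn. -/
/-- Partitions in a box, as antitone functions with natural values. -/
def boxSet (m n r : ℕ) : Set (Fin m → ℕ) :=
  {f | (∀ i j : Fin m, i ≤ j → f j ≤ f i) ∧ (∀ i, f i ≤ n) ∧ ∑ i, f i = r}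

lemma boxSet_finite (m n r : ℕ) : (boxSet m n r).Finite := by
  refine (Set.finite_Iic (fun _ : Fin m => n)).subset ?_
  intro f hf i
  exact hf.2.1 i

lemma gaussP_eq_ncard (m n r : ℕ) : gaussP m n r = (boxSet m n r).ncard := by
  unfold gaussP
  rw [← Set.ncard_coe_finset]
  refine Set.ncard_congr (fun f _ i => (f i : ℕ)) ?_ ?_ ?_
  · intro f hf
    simp only [Finset.coe_filter, Finset.mem_univ, true_and, Set.mem_ofPred_eq] at hf
    exact ⟨fun i j hij => hf.1 i j hij, fun i => Nat.lt_succ_iff.1 (f i).2, hf.2⟩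
  · intro f g _ _ h
    funext i
    exact Fin.ext (congrFun h i)
  · intro f hf
    refine ⟨fun i => ⟨f i, Nat.lt_succ_iff.2 (hf.2.1 i)⟩, ?_, rfl⟩
    simp only [Finset.coe_filter, Finset.mem_univ, true_and, Set.mem_ofPred_eq]
    exact ⟨fun i j hij => hf.1 i j hij, hf.2.2⟩

lemma gaussP_zero_left (n r : ℕ) : gaussP 0 n r = if r = 0 then 1 else 0 := by
  rw [gaussP_eq_ncard]
  split_ifs with h
  · subst h
    rw [Set.ncard_eq_one]
    refine ⟨Fin.elim0, ?_⟩
    ext f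
    simp [boxSet, Subsingleton.elim f Fin.elim0]
  · convert Set.ncard_empty (Fin 0 → ℕ)
    ext f
    simp [boxSet, Ne.symm h]

lemma gaussP_zero_right (m r : ℕ) : gaussP m 0 r = if r = 0 then 1 else 0 := by
  rw [gaussP_eq_ncard]
  have key : ∀ f : Fin m → ℕ, f ∈ boxSet m 0 r → f = 0 := fun f hf =>
    funext fun i => Nat.le_zero.1 (hf.2.1 i)
  split_ifs with h
  · subst h
    rw [Set.ncard_eq_one]
    refine ⟨0, ?_⟩
    ext f
    refine ⟨key f, ?_⟩
    rintro rfl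
    simp [boxSet]
  · convert Set.ncard_empty (Fin m → ℕ)
    ext f
    refine ⟨fun hf => ?_, fun hf => hf.elim⟩
    have := key f hf
    subst this
    exact h (by simpa using hf.2.2.symm)

lemma gaussP_rec_left (m n r : ℕ) : gaussP (m + 1) (n + 1) r =
    gaussP (m + 1) n r + if n + 1 ≤ r then gaussP m (n + 1) (r - (n + 1)) else 0 := by
  simp only [gaussP_eq_ncard]
  have hsplit : boxSet (m + 1) (n + 1) r = boxSet (m + 1) n r ∪
      (if n + 1 ≤ r then Set.image
        (fun g : Fin m → ℕ => (Fin.cons (n + 1) g : Fin (m + 1) → ℕ))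
        (boxSet m (n + 1) (r - (n + 1))) else ∅) := by
    ext f
    constructor
    · rintro ⟨ha, hb, hs⟩
      by_cases h0 : f 0 = n + 1
      · right
        rw [Fin.sum_univ_succ] at hs
        rw [if_pos (by omega)]
        refine ⟨Fin.tail f, ⟨?_, fun i => hb i.succ, ?_⟩, ?_⟩
        · intro i j hij
          exact ha _ _ (Fin.succ_le_succ_iff.2 hij)
        · simp only [Fin.tail]; omega
        · simp only
          rw [← h0]
          exact Fin.cons_self_tail f
      · left
        refine ⟨ha, fun i => ?_, hs⟩
        have := ha 0 i (Fin.zero_le i)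
        have := hb 0
        omega
    · rintro (⟨ha, hb, hs⟩ | h)
      · exact ⟨ha, fun i => (hb i).trans (Nat.le_succ n), hs⟩
      · split_ifs at h with hr
        · obtain ⟨g, ⟨ha, hb, hs⟩, rfl⟩ := h
          refine ⟨?_, ?_, ?_⟩
          · intro i j hij
            induction i using Fin.cases with
            | zero =>
              induction j using Fin.cases with
              | zero => exact le_rfl
              | succ j => simpa using hb j
            | succ i =>
              induction j using Fin.cases with
              | zero => simp at hij
              | succ j => simpa using ha i j (Fin.succ_le_succ_iff.1 hij)
          · intro i
            induction i using Fin.cases with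
            | zero => simp
            | succ i => simpa using hb i
          · rw [Fin.sum_univ_succ]
            simp only [Fin.cons_zero, Fin.cons_succ]
            omega
        · exact h.elim
  rw [hsplit, Set.ncard_union_eq ?_ ?_ ?_]
  · congr 1
    split_ifs
    · exact Set.ncard_image_of_injective _ (Fin.cons_right_injective (α := fun _ => ℕ) _)
    · exact Set.ncard_empty _
  · rw [Set.disjoint_left]
    intro f hf h
    split_ifs at h
    · obtain ⟨g, _, rfl⟩ := h
      have := hf.2.1 0
      simp at this
    · exact h
  · exact boxSet_finite _ _ _
  · split_ifs
    · exact (boxSet_finite _ _ _).image _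
    · exact Set.finite_empty

lemma gaussP_rec_right (m n r : ℕ) : gaussP (m + 1) (n + 1) r =
    gaussP m (n + 1) r + if m + 1 ≤ r then gaussP (m + 1) n (r - (m + 1)) else 0 := by
  simp only [gaussP_eq_ncard]
  have hsplit : boxSet (m + 1) (n + 1) r =
      Set.image (fun g : Fin m → ℕ => (Fin.snoc g 0 : Fin (m + 1) → ℕ)) (boxSet m (n + 1) r) ∪
      (if m + 1 ≤ r then Set.image (fun (g : Fin (m + 1) → ℕ) i => g i + 1)
        (boxSet (m + 1) n (r - (m + 1))) else ∅) := by
    ext f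
    constructor
    · rintro ⟨ha, hb, hs⟩
      by_cases h0 : f (Fin.last m) = 0
      · left
        rw [Fin.sum_univ_castSucc] at hs
        refine ⟨Fin.init f, ⟨?_, fun i => hb i.castSucc, ?_⟩, ?_⟩
        · intro i j hij
          exact ha _ _ (Fin.castSucc_le_castSucc_iff.2 hij)
        · simp only [Fin.init]; omega
        · simp only
          rw [← h0]
          exact Fin.snoc_init_self f
      · right
        have hpos : ∀ i, 1 ≤ f i := fun i => by
          have := ha i (Fin.last m) (Fin.le_last i)
          omega
        have hsum : ∑ i, f i = ∑ i, (f i - 1) + (m + 1) := by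
          have : ∀ i, f i = (f i - 1) + 1 := fun i => by have := hpos i; omega
          rw [Finset.sum_congr rfl (fun i _ => this i), Finset.sum_add_distrib]
          simp
        rw [if_pos (by omega)]
        refine ⟨fun i => f i - 1, ⟨?_, ?_, ?_⟩, ?_⟩
        · intro i j hij
          have := ha i j hij
          simp only
          omega
        · intro i
          have := hb i
          simp only
          omega
        · change ∑ i, (f i - 1) = _
          omega
        · funext i
          have := hpos i
          simp only
          omega
    · rintro (⟨g, ⟨ha, hb, hs⟩, rfl⟩ | h)
      · refine ⟨?_, ?_, ?_⟩
        · intro i j hij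
          induction j using Fin.lastCases with
          | last => simp
          | cast j =>
            induction i using Fin.lastCases with
            | last =>
              exfalso
              have := Fin.lt_def.1 (Fin.castSucc_lt_last j)
              have := Fin.le_def.1 hij
              omega
            | cast i => simpa using ha i j (Fin.castSucc_le_castSucc_iff.1 hij)
        · intro i
          induction i using Fin.lastCases with
          | last => simp
          | cast i => simpa using hb i
        · rw [Fin.sum_univ_castSucc]
          simpa using hs
      · split_ifs at h with hr
        · obtain ⟨g, ⟨ha, hb, hs⟩, rfl⟩ := h
          refine ⟨?_, ?_, ?_⟩
          · intro i j hij
            have := ha i j hij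
            simp only
            omega
          · intro i
            have := hb i
            simp only
            omega
          · rw [Finset.sum_add_distrib]
            simp
            omega
        · exact h.elim
  rw [hsplit, Set.ncard_union_eq ?_ ?_ ?_]
  · congr 1
    · exact Set.ncard_image_of_injective _ (Fin.snoc_left_injective (α := fun _ => ℕ) _)
    · split_ifs
      · refine Set.ncard_image_of_injective _ ?_
        intro f g h
        funext i
        have := congrFun h i
        simpa using this
      · exact Set.ncard_empty _
  · rw [Set.disjoint_left]
    rintro _ ⟨g, _, rfl⟩ h
    split_ifs at h
    · obtain ⟨g', _, h⟩ := h
      have := congrFun h (Fin.last m)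
      simp at this
    · exact h
  · exact (boxSet_finite _ _ _).image _
  · split_ifs
    · exact (boxSet_finite _ _ _).image _
    · exact Set.finite_empty

lemma gaussP_symm (m n r : ℕ) : gaussP m n r = gaussP n m r := by
  induction m generalizing n r with
  | zero => rw [gaussP_zero_left, gaussP_zero_right]
  | succ m ihm =>
    induction n generalizing r with
    | zero => rw [gaussP_zero_left, gaussP_zero_right]
    | succ n ihn =>
      rw [gaussP_rec_left, gaussP_rec_right, ihn]
      simp only [ihm (n + 1)]

/-- Addition of coefficient lists. -/
def addL : List ℕ → List ℕ → List ℕ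
  | [], b => b
  | x :: a, [] => x :: a
  | x :: a, y :: b => (x + y) :: addL a b

lemma addL_getD (a b : List ℕ) (r : ℕ) :
    (addL a b).getD r 0 = a.getD r 0 + b.getD r 0 := by
  induction a generalizing b r with
  | nil => simp [addL]
  | cons x a ih =>
    cases b with
    | nil => simp [addL]
    | cons y b =>
      cases r with
      | zero => simp [addL]
      | succ r => simpa [addL] using ih b r

/-- Multiplication of a coefficient list by `q ^ k`. -/
def shiftL : ℕ → List ℕ → List ℕ
  | 0, b => b
  | k + 1, b => 0 :: shiftL k b

lemma shiftL_getD (k : ℕ) (b : List ℕ) (r : ℕ) :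
    (shiftL k b).getD r 0 = if k ≤ r then b.getD (r - k) 0 else 0 := by
  induction k generalizing r with
  | zero => simp [shiftL]
  | succ k ih =>
    cases r with
    | zero => simp [shiftL]
    | succ r => simpa [shiftL] using ih r

/-- The next row of the table of Gaussian binomial coefficients. -/
def nextRow : ℕ → List ℕ → List (List ℕ) → List (List ℕ)
  | _, _, [] => []
  | k, acc, b :: t =>
    let c := addL acc (shiftL k b)
    c :: nextRow (k + 1) c t

/-- `L` lists the coefficients of the `(m, n)` Gaussian binomial. -/
def IsP (m n : ℕ) (L : List ℕ) : Prop := ∀ r, L.getD r 0 = gaussP m n r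

/-- `R` lists the Gaussian binomials `(m, k), (m, k+1), …`. -/
def IsRow (m : ℕ) : ℕ → List (List ℕ) → Prop
  | _, [] => True
  | k, b :: t => IsP m k b ∧ IsRow m (k + 1) t

lemma nextRow_isRow (m : ℕ) (t : List (List ℕ)) : ∀ (k : ℕ) (acc : List ℕ),
    IsP (m + 1) k acc → IsRow m (k + 1) t → IsRow (m + 1) (k + 1) (nextRow (k + 1) acc t) := by
  induction t with
  | nil => intro k acc _ _; trivial
  | cons b t ih =>
    intro k acc hacc hrow
    have hc : IsP (m + 1) (k + 1) (addL acc (shiftL (k + 1) b)) := by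
      intro r
      rw [addL_getD, shiftL_getD, gaussP_rec_left, hacc r]
      congr 1
      split_ifs
      · exact hrow.1 _
      · rfl
    exact ⟨hc, ih (k + 1) _ hc hrow.2⟩

/-- Row `m` of the table, with `N` entries, starting at `n = 1`. -/
def rowT (N : ℕ) : ℕ → List (List ℕ)
  | 0 => List.replicate N [1]
  | m + 1 => nextRow 1 [1] (rowT N m)

lemma isP_one_left (n : ℕ) : IsP 0 n [1] := by
  intro r
  rw [gaussP_zero_left]
  cases r <;> simp

lemma isP_one_right (m : ℕ) : IsP m 0 [1] := by
  intro r
  rw [gaussP_zero_right]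
  cases r <;> simp

lemma rowT_isRow (N m : ℕ) : IsRow m 1 (rowT N m) := by
  induction m with
  | zero =>
    have : ∀ k, IsRow 0 k (List.replicate N [1]) := by
      induction N with
      | zero => intro k; trivial
      | succ N ih => intro k; exact ⟨isP_one_left k, ih (k + 1)⟩
    exact this 1
  | succ m ih => exact nextRow_isRow m _ 0 [1] (isP_one_right _) ih

/-- The list has `c` strict increases from its start. -/
def incr : ℕ → List ℕ → Bool
  | 0, _ => true
  | _ + 1, [] => false
  | _ + 1, [_] => false
  | c + 1, x :: y :: t => Nat.blt x y && incr c (y :: t)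

lemma incr_spec (c : ℕ) : ∀ L : List ℕ, incr c L = true → ∀ r < c, L.getD r 0 < L.getD (r + 1) 0 := by
  induction c with
  | zero => intro L _ r hr; omega
  | succ c ih =>
    intro L h r hr
    match L, h with
    | x :: y :: t, h =>
      simp only [incr, Bool.and_eq_true, Nat.blt_eq] at h
      cases r with
      | zero => simpa using h.1
      | succ r => simpa using ih _ h.2 r (by omega)

/-- Strict unimodality of the `(m, n)` Gaussian binomial from rank one on. -/
def Good (m n : ℕ) : Prop := ∀ r, 2 ≤ r → 2 * r ≤ m * n → gaussP m n (r - 1) < gaussP m n r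

lemma Good.symm {m n : ℕ} (h : Good m n) : Good n m := by
  intro r h1 h2
  rw [gaussP_symm n m, gaussP_symm n m]
  exact h r h1 (by rwa [mul_comm m n])

lemma good_of_incr (m n : ℕ) (L : List ℕ) (hL : IsP m n L)
    (h : incr (m * n / 2 - 1) L.tail = true) : Good m n := by
  intro r h1 h2
  obtain ⟨s, rfl⟩ : ∃ s, r = s + 2 := ⟨r - 2, by omega⟩
  have := incr_spec _ _ h s (by omega)
  rw [← hL, ← hL]
  cases L with
  | nil => simp at this
  | cons x t => simpa using this

/-- Check a row: entries with index in `[lo, ∞)`. -/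
def checkRow (m lo : ℕ) : ℕ → List (List ℕ) → Bool
  | _, [] => true
  | k, b :: t => (Nat.blt k lo || incr (m * k / 2 - 1) b.tail) && checkRow m lo (k + 1) t

lemma checkRow_spec (m lo : ℕ) (t : List (List ℕ)) : ∀ k, IsRow m k t →
    checkRow m lo k t = true → ∀ n, lo ≤ n → k ≤ n → n < k + t.length → Good m n := by
  induction t with
  | nil => intro k _ _ n _ h1 h2; simp at h2; omega
  | cons b t ih =>
    intro k hrow hc n hlo hk hn
    simp only [checkRow, Bool.and_eq_true, Bool.or_eq_true, Nat.blt_eq] at hc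
    rcases Nat.eq_or_lt_of_le hk with rfl | hlt
    · rcases hc.1 with h | h
      · omega
      · exact good_of_incr _ _ _ hrow.1 h
    · refine ih (k + 1) hrow.2 hc.2 n hlo hlt ?_
      simp at hn
      omega

lemma nextRow_length (t : List (List ℕ)) : ∀ k acc, (nextRow k acc t).length = t.length := by
  induction t with
  | nil => intro k acc; rfl
  | cons b t ih => intro k acc; simp [nextRow, ih]

lemma rowT_length (N m : ℕ) : (rowT N m).length = N := by
  induction m with
  | zero => simp [rowT]
  | succ m ih => rw [rowT, nextRow_length, ih]

lemma good_of_check (m lo N : ℕ) (hlo : 1 ≤ lo) (h : checkRow m lo 1 (rowT N m) = true) :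
    ∀ n, lo ≤ n → n ≤ N → Good m n := fun n h1 h2 =>
  checkRow_spec m lo _ 1 (rowT_isRow N m) h n h1 (by omega) (by rw [rowT_length]; omega)

lemma good6 : ∀ n, 14 ≤ n → n ≤ 21 → Good 6 n :=
  good_of_check 6 14 21 (by norm_num) (by decide +kernel)
lemma good6_8 : Good 6 8 :=
  good_of_check 6 8 8 (by norm_num) (by decide +kernel) 8 le_rfl le_rfl
lemma good7 : ∀ n, 11 ≤ n → n ≤ 18 → Good 7 n :=
  good_of_check 7 11 18 (by norm_num) (by decide +kernel)
lemma good7_8 : Good 7 8 :=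
  good_of_check 7 8 8 (by norm_num) (by decide +kernel) 8 le_rfl le_rfl
lemma good_base (m : ℕ) (h1 : 8 ≤ m) (h2 : m ≤ 15) : ∀ n, 8 ≤ n → n ≤ 15 → Good m n := by
  refine good_of_check m 8 15 (by norm_num) ?_
  interval_cases m <;> decide +kernel

open MvPolynomial in
/-- The raising operator. -/
noncomputable def opE (m : ℕ) :
    Derivation ℚ (MvPolynomial (Fin (m + 1)) ℚ) (MvPolynomial (Fin (m + 1)) ℚ) :=
  mkDerivation ℚ fun i => ((i : ℕ) : ℚ) • X (i - 1)

open MvPolynomial in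
/-- The lowering operator. -/
noncomputable def opF (m : ℕ) :
    Derivation ℚ (MvPolynomial (Fin (m + 1)) ℚ) (MvPolynomial (Fin (m + 1)) ℚ) :=
  mkDerivation ℚ fun i => ((m : ℚ) - (i : ℕ)) • X (i + 1)

open MvPolynomial in
/-- The diagonal operator with eigenvalue `c i` on `X i`. -/
noncomputable def opD (m : ℕ) (c : Fin (m + 1) → ℚ) :
    Derivation ℚ (MvPolynomial (Fin (m + 1)) ℚ) (MvPolynomial (Fin (m + 1)) ℚ) :=
  mkDerivation ℚ fun i => c i • X i

/-- The weight operator. -/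
noncomputable abbrev opK (m : ℕ) := opD m fun i => ((i : ℕ) : ℚ)

/-- The Euler operator. -/
noncomputable abbrev opN (m : ℕ) := opD m fun _ => 1

lemma opE_X (m : ℕ) (i : Fin (m + 1)) :
    opE m (MvPolynomial.X i) = ((i : ℕ) : ℚ) • MvPolynomial.X (i - 1) := by
  simp [opE, MvPolynomial.mkDerivation_X]

lemma opF_X (m : ℕ) (i : Fin (m + 1)) :
    opF m (MvPolynomial.X i) = ((m : ℚ) - (i : ℕ)) • MvPolynomial.X (i + 1) := by
  simp [opF, MvPolynomial.mkDerivation_X]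

lemma opD_X (m : ℕ) (c : Fin (m + 1) → ℚ) (i : Fin (m + 1)) :
    opD m c (MvPolynomial.X i) = c i • MvPolynomial.X i := by
  simp [opD, MvPolynomial.mkDerivation_X]

lemma fin_pred_val {m : ℕ} (i : Fin (m + 1)) (h : i ≠ 0) : ((i - 1 : Fin (m + 1)) : ℕ) + 1 = i := by
  have := Fin.val_sub_one_of_ne_zero h
  have : (i : ℕ) ≠ 0 := fun h' => h (Fin.ext h')
  omega

lemma fin_succ_val {m : ℕ} (i : Fin (m + 1)) (h : (i : ℕ) ≠ m) :
    ((i + 1 : Fin (m + 1)) : ℕ) = i + 1 := by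
  apply Fin.val_add_one_of_lt
  rw [Fin.lt_def, Fin.val_last]
  omega

lemma comm_EF (m : ℕ) (p : MvPolynomial (Fin (m + 1)) ℚ) :
    opE m (opF m p) - opF m (opE m p) = (m : ℚ) • opN m p - (2 : ℚ) • opK m p := by
  have : ⁅opE m, opF m⁆ = (m : ℚ) • opN m - (2 : ℚ) • opK m := by
    apply MvPolynomial.derivation_ext
    intro i
    rw [Derivation.commutator_apply]
    simp only [Derivation.coe_sub, Derivation.coe_smul, Pi.sub_apply, Pi.smul_apply]
    simp only [opE_X, opF_X, opD_X, Derivation.map_smul, smul_smul]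
    have h1 : ((m : ℚ) - (i : ℕ)) * (((i + 1 : Fin (m + 1)) : ℕ) : ℚ) =
        ((m : ℚ) - (i : ℕ)) * ((i : ℕ) + 1) := by
      by_cases h : (i : ℕ) = m
      · simp [h]
      · rw [fin_succ_val i h]; push_cast; ring
    have h2 : ((i : ℕ) : ℚ) * ((m : ℚ) - ((i - 1 : Fin (m + 1)) : ℕ)) =
        ((i : ℕ) : ℚ) * ((m : ℚ) - (i : ℕ) + 1) := by
      by_cases h : i = 0
      · simp [h]
      · rw [← fin_pred_val i h]; push_cast; ring
    rw [h1, h2, add_sub_cancel_right, sub_add_cancel, ← sub_smul, ← sub_smul]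
    congr 1
    ring
  rw [← Derivation.commutator_apply, this]
  rfl

lemma comm_KE (m : ℕ) (p : MvPolynomial (Fin (m + 1)) ℚ) :
    opK m (opE m p) = opE m (opK m p) - opE m p := by
  have : ⁅opK m, opE m⁆ = - opE m := by
    apply MvPolynomial.derivation_ext
    intro i
    rw [Derivation.commutator_apply]
    simp only [Derivation.coe_neg, Pi.neg_apply]
    simp only [opE_X, opD_X, Derivation.map_smul, smul_smul]
    rw [← sub_smul, ← neg_smul]
    congr 1
    by_cases h : i = 0
    · simp [h]
    · rw [← fin_pred_val i h]; push_cast; ring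
  have h := congrArg (fun D => D p) this
  simp only [Derivation.commutator_apply, Derivation.coe_neg, Pi.neg_apply] at h
  linear_combination h

lemma comm_KF (m : ℕ) (p : MvPolynomial (Fin (m + 1)) ℚ) :
    opK m (opF m p) = opF m (opK m p) + opF m p := by
  have : ⁅opK m, opF m⁆ = opF m := by
    apply MvPolynomial.derivation_ext
    intro i
    rw [Derivation.commutator_apply]
    simp only [opF_X, opD_X, Derivation.map_smul, smul_smul]
    rw [← sub_smul]
    congr 1
    by_cases h : (i : ℕ) = m
    · simp [h]
    · rw [fin_succ_val i h]; push_cast; ring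
  have h := congrArg (fun D => D p) this
  simp only [Derivation.commutator_apply] at h
  linear_combination h

lemma comm_NE (m : ℕ) (p : MvPolynomial (Fin (m + 1)) ℚ) :
    opN m (opE m p) = opE m (opN m p) := by
  have : ⁅opN m, opE m⁆ = 0 := by
    apply MvPolynomial.derivation_ext
    intro i
    rw [Derivation.commutator_apply]
    simp [opE_X, opD_X, Derivation.map_smul]
  have h := congrArg (fun D => D p) this
  simp only [Derivation.commutator_apply, Derivation.coe_zero, Pi.zero_apply] at h
  linear_combination h

lemma comm_NF (m : ℕ) (p : MvPolynomial (Fin (m + 1)) ℚ) :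
    opN m (opF m p) = opF m (opN m p) := by
  have : ⁅opN m, opF m⁆ = 0 := by
    apply MvPolynomial.derivation_ext
    intro i
    rw [Derivation.commutator_apply]
    simp [opF_X, opD_X, Derivation.map_smul]
  have h := congrArg (fun D => D p) this
  simp only [Derivation.commutator_apply, Derivation.coe_zero, Pi.zero_apply] at h
  linear_combination h

/-- The space of forms of degree `n` and weight `r`. -/
noncomputable def wtSp (m : ℕ) (n r : ℚ) : Submodule ℚ (MvPolynomial (Fin (m + 1)) ℚ) where
  carrier := {p | opN m p = n • p ∧ opK m p = r • p}
  zero_mem' := by simp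
  add_mem' := by
    rintro p q ⟨h1, h2⟩ ⟨h3, h4⟩
    exact ⟨by rw [map_add, h1, h3, smul_add], by rw [map_add, h2, h4, smul_add]⟩
  smul_mem' := by
    rintro c p ⟨h1, h2⟩
    exact ⟨by rw [Derivation.map_smul, h1, smul_comm], by rw [Derivation.map_smul, h2, smul_comm]⟩

lemma mem_wtSp {m : ℕ} {n r : ℚ} {p : MvPolynomial (Fin (m + 1)) ℚ} :
    p ∈ wtSp m n r ↔ opN m p = n • p ∧ opK m p = r • p := Iff.rfl

lemma opE_mem {m : ℕ} {n r : ℚ} {p : MvPolynomial (Fin (m + 1)) ℚ} (h : p ∈ wtSp m n r) :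
    opE m p ∈ wtSp m n (r - 1) := by
  obtain ⟨h1, h2⟩ := h
  refine ⟨by rw [comm_NE, h1, Derivation.map_smul], ?_⟩
  rw [comm_KE, h2, Derivation.map_smul, sub_smul, one_smul]

lemma opF_mem {m : ℕ} {n r : ℚ} {p : MvPolynomial (Fin (m + 1)) ℚ} (h : p ∈ wtSp m n r) :
    opF m p ∈ wtSp m n (r + 1) := by
  obtain ⟨h1, h2⟩ := h
  refine ⟨by rw [comm_NF, h1, Derivation.map_smul], ?_⟩
  rw [comm_KF, h2, Derivation.map_smul, add_smul, one_smul]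

lemma mul_mem_wtSp {m : ℕ} {n r n' r' : ℚ} {p q : MvPolynomial (Fin (m + 1)) ℚ}
    (h : p ∈ wtSp m n r) (h' : q ∈ wtSp m n' r') : p * q ∈ wtSp m (n + n') (r + r') := by
  obtain ⟨h1, h2⟩ := h
  obtain ⟨h3, h4⟩ := h'
  constructor
  · rw [Derivation.leibniz, h1, h3]
    simp only [smul_eq_mul, MvPolynomial.smul_eq_C_mul, map_add]
    ring
  · rw [Derivation.leibniz, h2, h4]
    simp only [smul_eq_mul, MvPolynomial.smul_eq_C_mul, map_add]
    ring

lemma opD_monomial (m : ℕ) (c : Fin (m + 1) → ℚ) (e : Fin (m + 1) →₀ ℕ) (a : ℚ) :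
    opD m c (MvPolynomial.monomial e a) =
      (∑ i, (e i : ℚ) * c i) • MvPolynomial.monomial e a := by
  rw [opD, MvPolynomial.mkDerivation_monomial, Finsupp.sum_fintype _ _ (by simp), Finset.smul_sum,
    Finset.sum_smul]
  refine Finset.sum_congr rfl fun i _ => ?_
  by_cases h : e i = 0
  · simp [h]
  · have he : e - Finsupp.single i 1 + Finsupp.single i 1 = e := by
      apply tsub_add_cancel_of_le
      rw [Finsupp.single_le_iff]
      omega
    rw [MvPolynomial.X, smul_eq_mul, mul_smul_comm, MvPolynomial.monomial_mul, he,
      MvPolynomial.smul_monomial, MvPolynomial.smul_monomial, MvPolynomial.smul_monomial]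
    congr 1
    simp only [smul_eq_mul]
    ring

lemma opD_coeff (m : ℕ) (c : Fin (m + 1) → ℚ) (e : Fin (m + 1) →₀ ℕ)
    (p : MvPolynomial (Fin (m + 1)) ℚ) :
    MvPolynomial.coeff e (opD m c p) = (∑ i, (e i : ℚ) * c i) * MvPolynomial.coeff e p := by
  classical
  induction p using MvPolynomial.induction_on' with
  | monomial s a =>
    rw [opD_monomial, MvPolynomial.coeff_smul, smul_eq_mul]
    simp only [MvPolynomial.coeff_monomial]
    split_ifs with h
    · rw [h]
    · simp
  | add p q hp hq => rw [map_add, MvPolynomial.coeff_add, hp, hq, MvPolynomial.coeff_add, mul_add]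

/-- Exponent vectors of degree `n` and weight `r`. -/
def expSet (m : ℕ) (n r : ℕ) : Set (Fin (m + 1) →₀ ℕ) :=
  {e | ∑ i, e i = n ∧ ∑ i, e i * (i : ℕ) = r}

lemma mem_wtSp_iff {m : ℕ} {n r : ℚ} {p : MvPolynomial (Fin (m + 1)) ℚ} :
    p ∈ wtSp m n r ↔ ∀ e ∈ p.support, (∑ i, (e i : ℚ)) = n ∧ ∑ i, (e i : ℚ) * (i : ℕ) = r := by
  rw [mem_wtSp]
  constructor
  · rintro ⟨h1, h2⟩ e he
    rw [MvPolynomial.mem_support_iff] at he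
    have h1' := congrArg (MvPolynomial.coeff e) h1
    have h2' := congrArg (MvPolynomial.coeff e) h2
    rw [opD_coeff, MvPolynomial.coeff_smul, smul_eq_mul] at h1' h2'
    refine ⟨?_, mul_right_cancel₀ he h2'⟩
    simpa using mul_right_cancel₀ he h1'
  · intro h
    constructor
    · ext e
      rw [opD_coeff, MvPolynomial.coeff_smul, smul_eq_mul]
      by_cases he : e ∈ p.support
      · simp [← (h e he).1]
      · rw [MvPolynomial.notMem_support_iff.1 he]; simp
    · ext e
      rw [opD_coeff, MvPolynomial.coeff_smul, smul_eq_mul]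
      by_cases he : e ∈ p.support
      · rw [(h e he).2]
      · rw [MvPolynomial.notMem_support_iff.1 he]; simp

lemma wtSp_neg {m : ℕ} {n r : ℚ} (hr : r < 0) {p : MvPolynomial (Fin (m + 1)) ℚ}
    (hp : p ∈ wtSp m n r) : p = 0 := by
  rw [← MvPolynomial.support_eq_empty, Finset.eq_empty_iff_forall_notMem]
  intro e he
  have := (mem_wtSp_iff.1 hp e he).2
  have h2 : 0 ≤ ∑ i, (e i : ℚ) * ((i : ℕ) : ℚ) := Finset.sum_nonneg fun i _ => by positivity
  linarith

lemma wtSp_eq (m n r : ℕ) :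
    wtSp m n r = MvPolynomial.restrictSupport ℚ (expSet m n r) := by
  ext p
  rw [mem_wtSp_iff, MvPolynomial.mem_restrictSupport_iff]
  refine forall₂_congr fun e he => ?_
  constructor
  · rintro ⟨h1, h2⟩
    exact ⟨by exact_mod_cast h1, by exact_mod_cast h2⟩
  · rintro ⟨h1, h2⟩
    exact ⟨by exact_mod_cast h1, by exact_mod_cast h2⟩

lemma expSet_finite (m n r : ℕ) : (expSet m n r).Finite := by
  refine (Set.finite_Iic (Finsupp.equivFunOnFinite.symm fun _ : Fin (m + 1) => n)).subset ?_
  rintro e ⟨h1, _⟩ i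
  rw [← h1]
  exact Finset.single_le_sum (f := fun i => e i) (fun i _ => Nat.zero_le _) (Finset.mem_univ i)

lemma finrank_wtSp (m n r : ℕ) : Module.finrank ℚ (wtSp m n r) = (expSet m n r).ncard := by
  rw [wtSp_eq, Module.finrank_eq_nat_card_basis (MvPolynomial.basisRestrictSupport ℚ (expSet m n r))]
  rfl

lemma finite_wtSp (m n r : ℕ) : Module.Finite ℚ (wtSp m n r) := by
  rw [wtSp_eq]
  have := (expSet_finite m n r).to_subtype
  exact Module.Finite.of_basis (MvPolynomial.basisRestrictSupport ℚ (expSet m n r))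

lemma sum_count_mul (m : ℕ) (g : Fin (m + 1) → ℕ) (M : Multiset (Fin (m + 1))) :
    ∑ i, M.count i * g i = (M.map g).sum := by
  induction M using Multiset.induction_on with
  | empty => simp
  | cons a M ih =>
    simp only [Multiset.count_cons, add_mul, Finset.sum_add_distrib, ih, Multiset.map_cons,
      Multiset.sum_cons]
    simp [add_comm]

lemma toFinsupp_ofFn_mem_iff (m n r : ℕ) (f : Fin n → Fin (m + 1)) :
    Multiset.toFinsupp (Multiset.ofList (List.ofFn f)) ∈ expSet m n r ↔ ∑ i, (f i : ℕ) = r := by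
  have h1 := sum_count_mul m (fun _ => 1) (Multiset.ofList (List.ofFn f))
  have h2 := sum_count_mul m (fun i => (i : ℕ)) (Multiset.ofList (List.ofFn f))
  simp only [Multiset.map_coe, Multiset.sum_coe, List.map_ofFn, List.sum_ofFn, mul_one,
    Function.comp_apply] at h1 h2
  unfold expSet
  simp only [Set.mem_ofPred_eq, Multiset.toFinsupp_apply, h1, h2]
  simp

lemma expSet_ncard (m n r : ℕ) : (expSet m n r).ncard = gaussP n m r := by
  classical
  unfold gaussP
  rw [← Set.ncard_coe_finset]
  symm
  refine Set.ncard_congr (fun f _ => Multiset.toFinsupp (Multiset.ofList (List.ofFn f))) ?_ ?_ ?_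
  · intro f hf
    simp only [Finset.coe_filter, Finset.mem_univ, true_and, Set.mem_ofPred_eq] at hf
    exact (toFinsupp_ofFn_mem_iff m n r f).2 hf.2
  · intro f g hf hg h
    simp only [Finset.coe_filter, Finset.mem_univ, true_and, Set.mem_ofPred_eq] at hf hg
    have h1 := Multiset.toFinsupp.injective h
    rw [Multiset.coe_eq_coe] at h1
    have hs : ∀ f : Fin n → Fin (m + 1), (∀ i j : Fin n, i ≤ j → f j ≤ f i) →
        (List.ofFn f).Pairwise (· ≥ ·) := by
      intro f hf
      rw [List.pairwise_ofFn]
      intro i j hij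
      exact hf i j hij.le
    exact List.ofFn_injective (h1.eq_of_pairwise' (hs f hf.1) (hs g hg.1))
  · intro e he
    obtain ⟨l, hl, hle⟩ : ∃ l : List (Fin (m + 1)), l.Pairwise (· ≥ ·) ∧
        Multiset.toFinsupp (Multiset.ofList l) = e := by
      refine ⟨(Finsupp.toMultiset e).sort (· ≥ ·), Multiset.pairwise_sort _ _, ?_⟩
      rw [Multiset.sort_eq, Finsupp.toMultiset_toFinsupp]
    have hlen : l.length = n := by
      have h1 := sum_count_mul m (fun _ => 1) (Multiset.ofList l)
      have h2 := he.1
      rw [← hle] at h2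
      simp only [Multiset.toFinsupp_apply] at h2
      simp only [mul_one, h2] at h1
      simpa using h1.symm
    subst hlen
    have hof : List.ofFn l.get = l := List.ofFn_get l
    refine ⟨l.get, ?_, by rw [hof, hle]⟩
    simp only [Finset.coe_filter, Finset.mem_univ, true_and, Set.mem_ofPred_eq]
    constructor
    · intro i j hij
      rcases hij.eq_or_lt with rfl | hlt
      · exact le_rfl
      · exact List.pairwise_iff_get.1 hl i j hlt
    · rw [← toFinsupp_ofFn_mem_iff m, hof, hle]
      exact he

lemma finrank_wtSp_eq (m n r : ℕ) : Module.finrank ℚ (wtSp m n r) = gaussP m n r := by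
  rw [finrank_wtSp, expSet_ncard, gaussP_symm]

/-- Negative eigenvalues of `F E` do not occur in the relevant range. -/
lemma eigen_zero (m : ℕ) (n : ℚ) (s : ℕ) : ∀ (c : ℚ), 0 < c → 0 ≤ m * n - 2 * s →
    ∀ v ∈ wtSp m n s, opF m (opE m v) = (-c) • v → v = 0 := by
  induction s with
  | zero =>
    intro c hc _ v hv h
    have hE : opE m v = 0 := wtSp_neg (by norm_num) (opE_mem hv)
    rw [hE, map_zero] at h
    exact (smul_eq_zero.1 h.symm).resolve_left (by linarith)
  | succ s ih =>
    intro c hc hmu v hv h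
    have hEv := opE_mem hv
    have hcast : ((s + 1 : ℕ) : ℚ) - 1 = s := by push_cast; ring
    rw [hcast] at hEv
    push_cast at hmu
    have hE : opE m v = 0 := by
      refine ih (c + (m * n - 2 * s)) (by linarith) (by linarith) _ hEv ?_
      have h1 := comm_EF m (opE m v)
      rw [h, hEv.1, hEv.2, Derivation.map_smul, smul_smul, smul_smul, ← sub_smul] at h1
      rw [sub_eq_iff_eq_add] at h1
      rw [← sub_eq_iff_eq_add'.2 h1, ← sub_smul]
      congr 1
      ring
    rw [hE, map_zero] at h
    exact (smul_eq_zero.1 h.symm).resolve_left (by linarith)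

lemma EF_inj (m : ℕ) (n : ℚ) (s : ℕ) (hmu : 0 < m * n - 2 * s) (v) (hv : v ∈ wtSp m n s)
    (h : opE m (opF m v) = 0) : v = 0 := by
  refine eigen_zero m n s _ hmu hmu.le v hv ?_
  have h1 := comm_EF m v
  rw [h, hv.1, hv.2, smul_smul, smul_smul, ← sub_smul, zero_sub] at h1
  rw [neg_smul, ← h1, neg_neg]

/-- There is a nonzero highest weight vector of degree `n` and weight `r`. -/
def HasHW (m n r : ℕ) : Prop := ∃ p ∈ wtSp m n r, p ≠ 0 ∧ opE m p = 0

lemma HasHW.add {m n r n' r' : ℕ} (h : HasHW m n r) (h' : HasHW m n' r') :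
    HasHW m (n + n') (r + r') := by
  obtain ⟨p, hp, hp0, hE⟩ := h
  obtain ⟨q, hq, hq0, hE'⟩ := h'
  refine ⟨p * q, ?_, mul_ne_zero hp0 hq0, ?_⟩
  · push_cast
    exact mul_mem_wtSp hp hq
  · rw [Derivation.leibniz, hE, hE']
    simp

lemma hasHW_zero (m n : ℕ) : HasHW m n 0 := by
  refine ⟨MvPolynomial.X 0 ^ n, ⟨?_, ?_⟩, pow_ne_zero _ (MvPolynomial.X_ne_zero _), ?_⟩
  · rw [Derivation.leibniz_pow, opD_X]
    cases n with
    | zero => simp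
    | succ n =>
      simp only [one_smul, Nat.add_sub_cancel, smul_eq_mul, ← pow_succ]
      rw [Nat.cast_smul_eq_nsmul]
  · rw [Derivation.leibniz_pow, opD_X]
    simp
  · rw [Derivation.leibniz_pow, opE_X]
    simp

lemma lt_of_hasHW {m n r : ℕ} (hr : 2 * (r + 1) ≤ m * n) (h : HasHW m n (r + 1)) :
    gaussP m n r < gaussP m n (r + 1) := by
  obtain ⟨u, hu, hu0, hE⟩ := h
  have := finite_wtSp m n r
  have := finite_wtSp m n (r + 1)
  have hmu : (0 : ℚ) < m * n - 2 * r := by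
    have : (2 * (r + 1) : ℚ) ≤ m * n := by exact_mod_cast hr
    linarith
  let F : wtSp m n r →ₗ[ℚ] wtSp m n ((r + 1 : ℕ) : ℚ) :=
    ((opF m).toLinearMap.comp (wtSp m n r).subtype).codRestrict _ (fun v => by
      have := opF_mem v.2
      push_cast
      exact this)
  have hF : Function.Injective F := by
    rw [← LinearMap.ker_eq_bot, LinearMap.ker_eq_bot']
    intro v hv
    have h1 : opF m v = 0 := congrArg Subtype.val hv
    exact Subtype.ext (EF_inj m n r hmu v v.2 (by rw [h1, map_zero]))
  rw [← finrank_wtSp_eq, ← finrank_wtSp_eq, ← LinearMap.finrank_range_of_inj hF]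
  apply Submodule.finrank_lt
  intro htop
  have hmem : (⟨u, hu⟩ : wtSp m n ((r + 1 : ℕ) : ℚ)) ∈ LinearMap.range F := by
    rw [htop]; trivial
  obtain ⟨v, hv⟩ := hmem
  have h1 : opF m v = u := congrArg Subtype.val hv
  have h2 := EF_inj m n r hmu v v.2 (by rw [h1, hE])
  rw [h2, map_zero] at h1
  exact hu0 h1.symm

lemma hasHW_of_lt {m n r : ℕ} (h : gaussP m n r < gaussP m n (r + 1)) : HasHW m n (r + 1) := by
  have := finite_wtSp m n r
  have := finite_wtSp m n (r + 1)
  let E : wtSp m n ((r + 1 : ℕ) : ℚ) →ₗ[ℚ] wtSp m n r :=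
    ((opE m).toLinearMap.comp (wtSp m n ((r + 1 : ℕ) : ℚ)).subtype).codRestrict _ (fun v => by
      have := opE_mem v.2
      push_cast at this
      rw [add_sub_cancel_right] at this
      exact this)
  rw [← finrank_wtSp_eq, ← finrank_wtSp_eq] at h
  have hker := LinearMap.ker_ne_bot_of_finrank_lt (f := E) h
  obtain ⟨v, hv, hv0⟩ := Submodule.exists_mem_ne_zero_of_ne_bot hker
  exact ⟨v, v.2, fun h0 => hv0 (Subtype.ext h0), congrArg Subtype.val (LinearMap.mem_ker.1 hv)⟩

lemma Good.hasHW {m n : ℕ} (h : Good m n) (r : ℕ) (hr1 : r ≠ 1) (hr : 2 * r ≤ m * n) :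
    HasHW m n r := by
  match r, hr1, hr with
  | 0, _, _ => exact hasHW_zero m n
  | s + 2, _, hr => exact hasHW_of_lt (r := s + 1) (h (s + 2) (by omega) hr)

lemma Good.add_eight {m n : ℕ} (hm : 2 ≤ m) (hn : 2 ≤ n) (h8 : Good m 8)
    (h : Good m n) : Good m (n + 8) := by
  intro r h1 h2
  have hmn : 4 ≤ m * n := Nat.mul_le_mul hm hn
  obtain ⟨s, rfl⟩ : ∃ s, r = s + 1 := ⟨r - 1, by omega⟩
  rw [Nat.add_sub_cancel]
  refine lt_of_hasHW (r := s) h2 ?_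
  have key : ∃ a b, a + b = s + 1 ∧ a ≠ 1 ∧ b ≠ 1 ∧ 2 * a ≤ m * n ∧ 2 * b ≤ m * 8 := by
    rw [mul_add m n 8] at h2
    by_cases hb : 2 * (s + 1) ≤ m * 8
    · exact ⟨0, s + 1, by omega, by omega, by omega, by omega, hb⟩
    · by_cases hc : s + 1 = m * 4 + 1
      · exact ⟨2, s - 1, by omega, by omega, by omega, by omega, by omega⟩
      · exact ⟨s + 1 - m * 4, m * 4, by omega, by omega, by omega, by omega, by omega⟩
  obtain ⟨a, b, hab, ha, hb, ha2, hb2⟩ := key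
  rw [← hab]
  exact (h.hasHW a ha ha2).add (h8.hasHW b hb hb2)

lemma Good.of_window {m lo : ℕ} (hm : 2 ≤ m) (hlo : 2 ≤ lo) (h8 : Good m 8)
    (h : ∀ n, lo ≤ n → n ≤ lo + 7 → Good m n) : ∀ n, lo ≤ n → Good m n := by
  intro n
  induction n using Nat.strong_induction_on with
  | _ n ih =>
    intro hn
    by_cases hle : n ≤ lo + 7
    · exact h n hn hle
    · obtain ⟨k, rfl⟩ : ∃ k, n = k + 8 := ⟨n - 8, by omega⟩
      exact Good.add_eight hm (by omega) h8 (ih k (by omega) (by omega))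

lemma good_ge_eight (m n : ℕ) (hm : 8 ≤ m) (hn : 8 ≤ n) : Good m n := by
  have h1 : ∀ n, 8 ≤ n → n ≤ 15 → ∀ m, 8 ≤ m → Good n m := fun n hn hn' =>
    Good.of_window (by omega) (by omega) (good_base n hn hn' 8 (by norm_num) (by norm_num))
      (good_base n hn hn')
  exact Good.of_window (by omega) (by omega) (h1 8 (by norm_num) (by norm_num) m hm).symm
    (fun n h h' => (h1 n h h' m hm).symm) n hn

theorem stmt18 (m d0 d1 d2 d3 r : ℕ) (hm : 6 ≤ m)
    (h0 : 0 < d0) (h1 : 0 < d1) (h2 : 0 < d2) (h3 : 0 < d3)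
    (hcond : m * d0 ≤ (m - 4) * d2 + 2 * (m - 6) * d3)
    (hr1 : 2 * d1 + 6 * d2 + 12 * d3 ≤ r)
    (hr2 : 2 * r ≤ m * (d0 + 2 * d1 + 3 * d2 + 4 * d3)) :
    gaussP m (d0 + 2 * d1 + 3 * d2 + 4 * d3) (r - 1) <
      gaussP m (d0 + 2 * d1 + 3 * d2 + 4 * d3) r := by
  have hg : Good m (d0 + 2 * d1 + 3 * d2 + 4 * d3) := by
    rcases Nat.lt_or_ge m 8 with h | h
    · interval_cases m
      · exact Good.of_window (by norm_num) (by norm_num) good6_8 good6 _ (by omega)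
      · exact Good.of_window (by norm_num) (by norm_num) good7_8 good7 _ (by omega)
    · exact good_ge_eight m _ h (by omega)
  exact hg r (by omega) hr2
end
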